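/- arXiv:1701.01978 — 5 statements merged into one kernel-verified Lean document; each statement's English description precedes it below -/
import Mathlib

section
/- Let p be a prime, let w' ≥ 1, j ≥ 1, and t ≥ 0. Let λ' and μ' be partitions of w' such that all parts of λ' are divisible by p^t. Set w = w'·p^j, λ = p^j·λ' and μ = p^j*μ'; assume all parts of λ' and of λ are at most n, and that μ' and μ each have at most n parts. Then d_{λμ} ≡ d_{λ'μ'} (mod p^{t+1}). -/
noncomputable section

/-- The exponent vector on `Fin n` attached to a multiset `lam` of parts in `[1, n]`:
the variable `X i` gets exponent the multiplicity of `i + 1` in `lam`, so that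
`X ^ (partExp n lam)` is the monomial `X_{λ_1} ⋯ X_{λ_k}`. -/
def partExp (n : ℕ) (lam : Multiset ℕ) : Fin n →₀ ℕ :=
  Finsupp.equivFunOnFinite.symm fun i => lam.count ((i : ℕ) + 1)

namespace DCong
open MvPolynomial

/-- Evaluation at the elementary symmetric polynomials. -/
def ev (m : ℕ) : MvPolynomial (Fin m) ℤ →ₐ[ℤ] MvPolynomial (Fin m) ℤ :=
  aeval (fun i : Fin m => esymm (Fin m) ℤ ((i : ℕ) + 1))

lemma ev_injective (m : ℕ) : Function.Injective (ev m) := by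
  intro a b h
  apply (esymmAlgHom_fin_bijective ℤ m).1
  apply Subtype.ext
  have ha := esymmAlgHom_apply (σ := Fin m) (R := ℤ) (n := m) a
  have hb := esymmAlgHom_apply (σ := Fin m) (R := ℤ) (n := m) b
  exact ha.trans (h.trans hb.symm)

lemma ev_surj (m : ℕ) (f : MvPolynomial (Fin m) ℤ) (hf : f.IsSymmetric) :
    ∃ g, ev m g = f := by
  obtain ⟨g, hg⟩ := (esymmAlgHom_fin_bijective ℤ m).2 ⟨f, hf⟩
  refine ⟨g, ?_⟩
  have ha := esymmAlgHom_apply (σ := Fin m) (R := ℤ) (n := m) g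
  rw [hg] at ha
  exact ha.symm

lemma ev_symm (m : ℕ) (g : MvPolynomial (Fin m) ℤ) : (ev m g).IsSymmetric := by
  have ha := esymmAlgHom_apply (σ := Fin m) (R := ℤ) (n := m) g
  have := (esymmAlgHom (Fin m) ℤ m g).2
  rw [ev, ← ha]
  exact this

lemma expand_symm (m p : ℕ) (f : MvPolynomial (Fin m) ℤ) (hf : f.IsSymmetric) :
    (expand p f).IsSymmetric := by
  intro e
  rw [rename_expand, hf e]

lemma dvd_expand (m p : ℕ) (hp : p.Prime) (f : MvPolynomial (Fin m) ℤ) :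
    (p : MvPolynomial (Fin m) ℤ) ∣ expand p f - f ^ p := by
  have : Fact p.Prime := ⟨hp⟩
  have := (C_dvd_iff_zmod p (expand p f - f ^ p)).2 (by
    rw [map_sub, map_pow, map_expand, expand_zmod, sub_self])
  simpa using this

lemma dvd_of_ev (m p : ℕ) (hp : p.Prime) (r : MvPolynomial (Fin m) ℤ)
    (h : (p : MvPolynomial (Fin m) ℤ) ∣ ev m r) : (p : MvPolynomial (Fin m) ℤ) ∣ r := by
  obtain ⟨g, hg⟩ := h
  have hp0 : (p : MvPolynomial (Fin m) ℤ) ≠ 0 := by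
    exact_mod_cast hp.ne_zero
  have hs : g.IsSymmetric := by
    intro e
    have h1 := ev_symm m r e
    rw [hg, map_mul, map_natCast] at h1
    exact mul_left_cancel₀ hp0 h1
  obtain ⟨k, hk⟩ := ev_surj m g hs
  refine ⟨k, ev_injective m ?_⟩
  rw [hg, map_mul, map_natCast, hk]

/-- The Adams operation in elementary coordinates. -/
lemma exists_frob (m p : ℕ) (hp : p.Prime) :
    ∃ F : MvPolynomial (Fin m) ℤ →ₐ[ℤ] MvPolynomial (Fin m) ℤ,
      (∀ f, ev m (F f) = expand p (ev m f)) ∧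
      ∀ f, (p : MvPolynomial (Fin m) ℤ) ∣ F f - f ^ p := by
  have h : ∀ i : Fin m, ∃ g, ev m g = expand p (esymm (Fin m) ℤ ((i : ℕ) + 1)) := fun i =>
    ev_surj m _ (expand_symm m p _ (esymm_isSymmetric _ _ _))
  choose g hg using h
  have key : ∀ f, ev m (aeval g f) = expand p (ev m f) := by
    intro f
    have : (ev m).comp (aeval g) = (expand p).comp (ev m) := by
      ext i : 1
      simp [hg]
      simp [ev]
    exact DFunLike.congr_fun this f
  refine ⟨aeval g, key, fun f => dvd_of_ev m p hp _ ?_⟩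
  rw [map_sub, map_pow, key]
  exact dvd_expand m p hp _

section frob
variable {R : Type*} [CommRing R] (p : ℕ)

/-- Sums of elements `p ^ i * a ^ (p ^ (s - i))`. -/
inductive Wit : ℕ → R → Prop
  | gen (i k : ℕ) (a : R) : Wit (i + k) ((p : R) ^ i * a ^ p ^ k)
  | add (s : ℕ) (a b : R) : Wit s a → Wit s b → Wit s (a + b)

lemma wit_step (F : R →+* R) (hF : ∀ a, (p : R) ∣ F a - a ^ p) (s : ℕ) (a : R)
    (h : Wit p s a) : Wit p (s + 1) (F a) := by
  induction h with
  | gen i k a =>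
    obtain ⟨c, hc⟩ := dvd_sub_pow_of_dvd_sub (hF a) k
    have : F ((p : R) ^ i * a ^ p ^ k) =
        (p : R) ^ i * a ^ p ^ (k + 1) + (p : R) ^ (i + k + 1) * c ^ p ^ 0 := by
      rw [map_mul, map_pow, map_pow, map_natCast, sub_eq_iff_eq_add.1 hc]
      rw [← pow_mul, ← pow_succ']
      ring
    rw [this]
    exact Wit.add _ _ _ (Wit.gen i (k + 1) a) (Wit.gen (i + k + 1) 0 c)
  | add s a b _ _ iha ihb => rw [map_add]; exact Wit.add _ _ _ iha ihb

lemma wit_dvd (F G : R →+* R) (hF : ∀ a, (p : R) ∣ F a - a ^ p)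
    (hG : ∀ a, (p : R) ∣ G a - a ^ p) (s : ℕ) (a : R)
    (h : Wit p s a) : (p : R) ^ (s + 1) ∣ F a - G a := by
  induction h with
  | gen i k a =>
    have h1 : (p : R) ∣ F a - G a := by
      have := dvd_sub (hF a) (hG a)
      simpa using this
    have := dvd_sub_pow_of_dvd_sub h1 k
    have := mul_dvd_mul_left ((p : R) ^ i) this
    simp only [map_mul, map_pow, map_natCast]
    rw [← mul_sub, add_assoc, pow_add]
    exact this
  | add s a b _ _ iha ihb =>
    rw [map_add, map_add, add_sub_add_comm]; exact dvd_add iha ihb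

lemma wit_iter (F : R →+* R) (hF : ∀ a, (p : R) ∣ F a - a ^ p) (s : ℕ) (a : R) :
    Wit p s (F^[s] a) := by
  induction s with
  | zero => simpa using Wit.gen (p := p) 0 0 a
  | succ s ih =>
    rw [Function.iterate_succ_apply']
    exact wit_step p F hF s _ ih

end frob

lemma coeff_dvd (m : ℕ) (p : ℕ) (s : ℕ) (f : MvPolynomial (Fin m) ℤ)
    (h : (p : MvPolynomial (Fin m) ℤ) ^ s ∣ f) (b : Fin m →₀ ℕ) : (p : ℤ) ^ s ∣ f.coeff b := by
  have : C ((p : ℤ) ^ s) ∣ f := by simpa using h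
  exact (C_dvd_iff_dvd_coeff _ _).1 this b

lemma frob_coeff (m p : ℕ) (hp : p.Prime)
    (F : MvPolynomial (Fin m) ℤ →ₐ[ℤ] MvPolynomial (Fin m) ℤ)
    (hF : ∀ f, (p : MvPolynomial (Fin m) ℤ) ∣ F f - f ^ p)
    (f : MvPolynomial (Fin m) ℤ) (t j : ℕ) (b : Fin m →₀ ℕ) :
    (p : ℤ) ^ (t + 1) ∣ (F^[t + j] f).coeff (p ^ j • b) - (F^[t] f).coeff b := by
  induction j with
  | zero => simp
  | succ j ih =>
    have h1 := wit_dvd p (F : MvPolynomial (Fin m) ℤ →+* MvPolynomial (Fin m) ℤ)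
      (expand p : MvPolynomial (Fin m) ℤ →ₐ[ℤ] _) hF
      (dvd_expand m p hp) (t + j) _
      (wit_iter p (F : MvPolynomial (Fin m) ℤ →+* MvPolynomial (Fin m) ℤ) hF (t + j) f)
    have h2 := coeff_dvd m p _ _ h1 (p ^ (j + 1) • b)
    have h3 := (pow_dvd_pow (p : ℤ) (show t + 1 ≤ t + j + 1 by omega)).trans h2
    have h4 := dvd_add h3 ih
    have h5 : (expand p (F^[t + j] f)).coeff (p ^ (j + 1) • b) =
        (F^[t + j] f).coeff (p ^ j • b) := by
      rw [pow_succ', mul_smul, coeff_expand_smul p hp.ne_zero]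
    have h6 : (F^[t + (j + 1)] f).coeff (p ^ (j + 1) • b) - (F^[t] f).coeff b =
        (F (F^[t + j] f) - expand p (F^[t + j] f)).coeff (p ^ (j + 1) • b) +
        ((F^[t + j] f).coeff (p ^ j • b) - (F^[t] f).coeff b) := by
      rw [← add_assoc, Function.iterate_succ_apply', coeff_sub, h5]
      ring
    rw [h6]
    exact h4

/-- The multiset of nonzero values. -/
def vals {m : ℕ} (b : Fin m → ℕ) : Multiset ℕ := (Finset.univ.val.map b).filter (· ≠ 0)

/-- Bounded exponent vectors. -/
def box (m N : ℕ) : Finset (Fin m → ℕ) := Fintype.piFinset fun _ => Finset.range (N + 1)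

lemma mem_box {m N : ℕ} {b : Fin m → ℕ} : b ∈ box m N ↔ ∀ i, b i ≤ N := by
  simp [box]

/-- Parts lie in `[1, N]`. -/
def Good (N : ℕ) (L : Multiset ℕ) : Prop := ∀ x ∈ L, 1 ≤ x ∧ x ≤ N

lemma mem_vals {m : ℕ} {b : Fin m → ℕ} {x : ℕ} : x ∈ vals b ↔ (∃ i, b i = x) ∧ x ≠ 0 := by
  simp [vals]

lemma good_vals {m N : ℕ} {b : Fin m → ℕ} (hb : b ∈ box m N) : Good N (vals b) := by
  intro x hx
  obtain ⟨⟨i, rfl⟩, h0⟩ := mem_vals.1 hx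
  exact ⟨Nat.pos_of_ne_zero h0, mem_box.1 hb i⟩

lemma box_of_good {m N : ℕ} {b : Fin m → ℕ} (h : Good N (vals b)) : b ∈ box m N := by
  rw [mem_box]
  intro i
  by_cases h0 : b i = 0
  · omega
  · exact (h _ (mem_vals.2 ⟨⟨i, rfl⟩, h0⟩)).2

/-- Monomial symmetric polynomial. -/
def Mp (m N : ℕ) (L : Multiset ℕ) : MvPolynomial (Fin m) ℤ :=
  ∑ b ∈ (box m N).filter (fun b => vals b = L), ∏ i, X i ^ b i

lemma prod_vals {m : ℕ} {T : Type*} [CommRing T] (c : ℕ → T) (hc : c 0 = 1) (b : Fin m → ℕ) :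
    ((vals b).map c).prod = ∏ i, c (b i) := by
  have : ∀ s : Multiset ℕ, ((s.filter (· ≠ 0)).map c).prod = (s.map c).prod := by
    intro s
    induction s using Multiset.induction_on with
    | empty => simp
    | cons a s ih =>
      by_cases h : a = 0
      · subst h; simp [hc]; simpa using ih
      · rw [Multiset.filter_cons_of_pos (p := fun x : ℕ => x ≠ 0) s h, Multiset.map_cons,
          Multiset.prod_cons, Multiset.map_cons, Multiset.prod_cons, ih]
  rw [vals, this, Multiset.map_map]
  rfl

lemma cauchy {m N : ℕ} {T : Type*} [CommRing T] [Algebra ℤ T] (x : Fin m → T) (c : ℕ → T) (hc : c 0 = 1)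
    (B : Finset (Multiset ℕ)) (hB : ∀ b ∈ box m N, vals b ∈ B) :
    ∏ i, ∑ k ∈ Finset.range (N + 1), c k * x i ^ k =
      ∑ K ∈ B, aeval x (Mp m N K) * (K.map c).prod := by
  rw [Finset.prod_univ_sum]
  change ∑ b ∈ box m N, _ = _
  rw [← Finset.sum_fiberwise_of_maps_to hB]
  refine Finset.sum_congr rfl fun K _ => ?_
  rw [Mp, map_sum, Finset.sum_mul]
  refine Finset.sum_congr rfl fun b hb => ?_
  rw [← (Finset.mem_filter.1 hb).2, prod_vals c hc, Finset.prod_mul_distrib, mul_comm]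
  simp

lemma prod_one_add_esymm {m : ℕ} {T : Type*} [CommRing T] [Algebra ℤ T] (y : Fin m → T) (x : T) :
    ∏ j, (1 + x * y j) =
      ∑ k ∈ Finset.range (m + 1), aeval y (esymm (Fin m) ℤ k) * x ^ k := by
  rw [Finset.prod_one_add, Finset.sum_powerset]
  simp only [Finset.card_univ, Fintype.card_fin]
  refine Finset.sum_congr rfl fun k _ => ?_
  rw [esymm, map_sum, Finset.sum_mul]
  refine Finset.sum_congr rfl fun s hs => ?_
  rw [Finset.prod_mul_distrib, Finset.prod_const, (Finset.mem_powersetCard.1 hs).2, mul_comm]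
  simp

lemma ev_monomial {m : ℕ} {K : Multiset ℕ} (hK : Good m K) :
    ev m (monomial (partExp m K) 1) = (K.map (fun k => esymm (Fin m) ℤ k)).prod := by
  rw [ev, aeval_monomial, map_one, one_mul]
  rw [Finsupp.prod_fintype _ _ (by simp)]
  rw [Finset.prod_multiset_map_count]
  have : (∏ i : Fin m, esymm (Fin m) ℤ (i + 1) ^ (partExp m K) i) =
    ∏ k ∈ Finset.range m, esymm (Fin m) ℤ (k + 1) ^ (K.count (k + 1)) := by
    rw [Finset.prod_range]; rfl
  rw [this]
  rw [← Finset.prod_image (s := Finset.range m) (g := fun k => k + 1)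
    (f := fun k => esymm (Fin m) ℤ k ^ K.count k) (by intro a _ b _ h; simpa using h)]
  symm
  apply Finset.prod_subset
  · intro k hk
    have := hK k (Multiset.mem_toFinset.1 hk)
    exact Finset.mem_image.2 ⟨k - 1, Finset.mem_range.2 (by omega), by omega⟩
  · intro k _ hk
    rw [Multiset.mem_toFinset] at hk
    rw [Multiset.count_eq_zero_of_notMem hk, pow_zero]

lemma partExp_inj {m : ℕ} {K L : Multiset ℕ} (hK : Good m K) (hL : Good m L)
    (h : partExp m K = partExp m L) : K = L := by
  ext k
  by_cases hk : 1 ≤ k ∧ k ≤ m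
  · have := DFunLike.congr_fun h ⟨k - 1, by omega⟩
    simp only [partExp, Finsupp.equivFunOnFinite_symm_apply_apply] at this
    rwa [Nat.sub_add_cancel hk.1] at this
  · rw [Multiset.count_eq_zero_of_notMem fun h => hk (hK k h),
      Multiset.count_eq_zero_of_notMem fun h => hk (hL k h)]

lemma msymm_eq {m N w : ℕ} (mu : w.Partition) (h : Good N mu.parts) :
    msymm (Fin m) ℤ mu = Mp m N mu.parts := by
  classical
  rw [msymm, Mp]
  have hv : ∀ s : Multiset (Fin m), vals (fun i => s.count i) = s.dedup.map (fun i => s.count i) := by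
    intro s
    rw [vals, Multiset.filter_map]
    congr 1
    rw [Multiset.Nodup.ext]
    · intro a; simp
    · exact Finset.univ.nodup.filter _
    · exact Multiset.nodup_dedup _
  have hs : ∀ b : Fin m → ℕ, ∃ s : Multiset (Fin m), ∀ i, s.count i = b i := by
    intro b
    refine ⟨∑ i, b i • {i}, fun i => ?_⟩
    simp [Multiset.count_sum', Multiset.count_singleton]
  refine Finset.sum_bij (fun s _ i => s.1.1.count i) ?_ ?_ ?_ ?_
  · rintro ⟨s, hs⟩ -
    have : vals (fun i => s.1.count i) = mu.parts := by
      rw [hv, ← hs]; rfl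
    exact Finset.mem_filter.2 ⟨box_of_good (this ▸ h), this⟩
  · rintro ⟨s, hs⟩ - ⟨s', hs'⟩ - h
    apply Subtype.ext
    apply Subtype.ext
    ext i
    exact congrFun h i
  · intro b hb
    obtain ⟨s, hs⟩ := hs b
    have hb' := (Finset.mem_filter.1 hb).2
    obtain rfl : (fun i => s.count i) = b := funext hs
    rw [hv] at hb'
    have hc : Multiset.card s = w := by
      rw [← Multiset.toFinset_sum_count_eq, ← mu.parts_sum, ← hb']
      rfl
    refine ⟨⟨⟨s, hc⟩, ?_⟩, Finset.mem_univ _, rfl⟩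
    apply Nat.Partition.ext
    exact hb'
  · rintro ⟨s, hs⟩ -
    simp only
    rw [Finset.prod_multiset_map_count]
    apply Finset.prod_subset (Finset.subset_univ _)
    intro i _ hi
    rw [Multiset.mem_toFinset] at hi
    rw [Multiset.count_eq_zero_of_notMem hi, pow_zero]

lemma Mp_symm {m N : ℕ} {L : Multiset ℕ} (h : Good N L) : (Mp m N L).IsSymmetric := by
  have := msymm_eq (m := m) (N := N) (w := L.sum) ⟨L, fun {i} hi => (h i hi).1, rfl⟩ h
  rw [← this]
  exact msymm_isSymmetric _ _ _

lemma Mp_expand {m N k : ℕ} (hk : 0 < k) {L : Multiset ℕ} (h : Good N L)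
    (h' : Good N (L.map fun x => k * x)) :
    Mp m N (L.map fun x => k * x) = expand k (Mp m N L) := by
  have hv : ∀ b : Fin m → ℕ, vals (fun i => k * b i) = (vals b).map fun x => k * x := by
    intro b
    rw [vals, vals, Multiset.filter_map, Multiset.filter_map, Multiset.map_map]
    congr 1
    apply Multiset.filter_congr
    intro x _
    simp [hk.ne']
  have hinj : Function.Injective (fun x : ℕ => k * x) := fun a b h => Nat.eq_of_mul_eq_mul_left hk h
  rw [Mp, Mp, map_sum]
  symm
  refine Finset.sum_bij (fun b _ i => k * b i) ?_ ?_ ?_ ?_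
  · intro b hb
    have hb' := (Finset.mem_filter.1 hb).2
    have : vals (fun i => k * b i) = L.map fun x => k * x := by rw [hv, hb']
    exact Finset.mem_filter.2 ⟨box_of_good (this ▸ h'), this⟩
  · intro b _ b' _ hbb
    funext i
    exact hinj (congrFun hbb i)
  · intro b hb
    have hb' := (Finset.mem_filter.1 hb).2
    have : ∀ i, ∃ c, k * c = b i := by
      intro i
      by_cases h0 : b i = 0
      · exact ⟨0, by simp [h0]⟩
      · have : b i ∈ vals b := mem_vals.2 ⟨⟨i, rfl⟩, h0⟩
        rw [hb'] at this
        obtain ⟨c, _, hc⟩ := Multiset.mem_map.1 this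
        exact ⟨c, hc⟩
    choose c hc using this
    obtain rfl : (fun i => k * c i) = b := funext hc
    rw [hv] at hb'
    have hcL := Multiset.map_injective hinj hb'
    exact ⟨c, Finset.mem_filter.2 ⟨box_of_good (hcL ▸ h), hcL⟩, rfl⟩
  · intro b _
    simp [pow_mul]

open TensorProduct in
lemma cauchy_tensor (n m : ℕ) (B : Finset (Multiset ℕ)) (hB : ∀ b ∈ box n m, vals b ∈ B) :
    ∏ i : Fin n, ∏ j : Fin m, (1 + (X i : MvPolynomial (Fin n) ℤ) ⊗ₜ[ℤ] (X j : MvPolynomial (Fin m) ℤ))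
     = ∑ K ∈ B, Mp n m K ⊗ₜ[ℤ] (K.map (fun k => esymm (Fin m) ℤ k)).prod := by
  let iL : MvPolynomial (Fin n) ℤ →ₐ[ℤ] MvPolynomial (Fin n) ℤ ⊗[ℤ] MvPolynomial (Fin m) ℤ :=
    Algebra.TensorProduct.includeLeft
  let iR : MvPolynomial (Fin m) ℤ →ₐ[ℤ] MvPolynomial (Fin n) ℤ ⊗[ℤ] MvPolynomial (Fin m) ℤ :=
    Algebra.TensorProduct.includeRight
  have hL : ∀ f, aeval (fun i => iL (X i)) f = iL f := by
    intro f
    have := comp_aeval_apply (R := ℤ) (fun i => (X i : MvPolynomial (Fin n) ℤ)) iL f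
    simpa using this.symm
  have hR : ∀ f, aeval (fun i => iR (X i)) f = iR f := by
    intro f
    have := comp_aeval_apply (R := ℤ) (fun i => (X i : MvPolynomial (Fin m) ℤ)) iR f
    simpa using this.symm
  have hmul : ∀ f g, iL f * iR g = f ⊗ₜ[ℤ] g := by
    intro f g
    simp [iL, iR]
  have h1 := cauchy (N := m) (fun i => iL (X i)) (fun k => iR (esymm (Fin m) ℤ k)) (by simp) B hB
  have h2 : ∀ i : Fin n, ∏ j : Fin m,
      (1 + (X i : MvPolynomial (Fin n) ℤ) ⊗ₜ[ℤ] (X j : MvPolynomial (Fin m) ℤ)) = 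
      ∑ k ∈ Finset.range (m + 1), iR (esymm (Fin m) ℤ k) * iL (X i) ^ k := by
    intro i
    have := prod_one_add_esymm (fun j => iR (X j : MvPolynomial (Fin m) ℤ)) (iL (X i))
    simp only [hmul, hR] at this
    exact this
  simp only [h2]
  rw [h1]
  refine Finset.sum_congr rfl fun K _ => ?_
  rw [hL, ← hmul, map_multiset_prod, Multiset.map_map]
  rfl

open TensorProduct in
lemma duality (n m : ℕ) (hinj : ∀ m, Function.Injective (ev m))
    (hsurj : ∀ m N L, Good N L → ∃ g, ev m g = Mp m N L)
    (L K : Multiset ℕ) (hL : Good n L) (hK : Good m K)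
    (ψ : MvPolynomial (Fin n) ℤ) (φ : MvPolynomial (Fin m) ℤ)
    (hψ : ev n ψ = Mp n m K) (hφ : ev m φ = Mp m n L) :
    ψ.coeff (partExp n L) = φ.coeff (partExp m K) := by
  classical
  let A := insert L ((box m n).image vals)
  let B := insert K ((box n m).image vals)
  have hA : ∀ L' ∈ A, Good n L' := by
    intro L' h
    rcases Finset.mem_insert.1 h with rfl | h
    · exact hL
    · obtain ⟨b, hb, rfl⟩ := Finset.mem_image.1 h
      exact good_vals hb
  have hB : ∀ L' ∈ B, Good m L' := by
    intro L' h
    rcases Finset.mem_insert.1 h with rfl | h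
    · exact hK
    · obtain ⟨b, hb, rfl⟩ := Finset.mem_image.1 h
      exact good_vals hb
  have e1 : ∀ K', ∃ g, Good m K' → ev n g = Mp n m K' := by
    intro K'
    by_cases h : Good m K'
    · obtain ⟨g, hg⟩ := hsurj n m K' h
      exact ⟨g, fun _ => hg⟩
    · exact ⟨0, fun h' => absurd h' h⟩
  have e2 : ∀ L', ∃ g, Good n L' → ev m g = Mp m n L' := by
    intro K'
    by_cases h : Good n K'
    · obtain ⟨g, hg⟩ := hsurj m n K' h
      exact ⟨g, fun _ => hg⟩
    · exact ⟨0, fun h' => absurd h' h⟩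
  choose P hP using e1
  choose Q hQ using e2
  have hPK : P K = ψ := hinj n ((hP K hK).trans hψ.symm)
  have hQL : Q L = φ := hinj m ((hQ L hL).trans hφ.symm)
  have c1 := cauchy_tensor n m B (fun b hb =>
    Finset.mem_insert_of_mem (Finset.mem_image_of_mem _ hb))
  have c2 := cauchy_tensor m n A (fun b hb =>
    Finset.mem_insert_of_mem (Finset.mem_image_of_mem _ hb))
  have c3 : (∏ i : Fin n, ∏ j : Fin m,
      (1 + (X i : MvPolynomial (Fin n) ℤ) ⊗ₜ[ℤ] (X j : MvPolynomial (Fin m) ℤ))) =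
      ∑ L' ∈ A, (L'.map (fun k => esymm (Fin n) ℤ k)).prod ⊗ₜ[ℤ] Mp m n L' := by
    have := congrArg (Algebra.TensorProduct.comm ℤ (MvPolynomial (Fin m) ℤ)
      (MvPolynomial (Fin n) ℤ)) c2
    simp only [map_prod, map_sum, map_add, map_one, Algebra.TensorProduct.comm_tmul] at this
    rw [Finset.prod_comm, this]
  have hi : Function.Injective
      (TensorProduct.map (ev n).toLinearMap (ev m).toLinearMap) :=
    TensorProduct.map_injective_of_flat_flat _ _ (hinj n) (hinj m)
  have heq : ∑ K' ∈ B, P K' ⊗ₜ[ℤ] (monomial (partExp m K') (1 : ℤ)) =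
      ∑ L' ∈ A, (monomial (partExp n L') (1 : ℤ)) ⊗ₜ[ℤ] Q L' := by
    apply hi
    rw [map_sum, map_sum]
    simp only [TensorProduct.map_tmul, AlgHom.toLinearMap_apply]
    rw [Finset.sum_congr rfl fun K' hK' => by rw [hP K' (hB K' hK'), ev_monomial (hB K' hK')],
      ← c1, c3]
    exact (Finset.sum_congr rfl fun L' hL' => by
      rw [hQ L' (hA L' hL'), ev_monomial (hA L' hL')])
  have hc := congrArg (fun z => LinearMap.mul' ℤ ℤ (TensorProduct.map
    (lcoeff ℤ (partExp n L)) (lcoeff ℤ (partExp m K)) z)) heq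
  simp only [map_sum, TensorProduct.map_tmul, lcoeff_apply, coeff_monomial,
    LinearMap.mul'_apply] at hc
  rw [Finset.sum_eq_single K, Finset.sum_eq_single L] at hc
  · simpa [hPK, hQL] using hc
  · intro L' hL' hne
    rw [if_neg fun h => hne (partExp_inj (hA L' hL') hL h), zero_mul]
  · intro h; exact absurd (Finset.mem_insert_self _ _) h
  · intro L' hL' hne
    rw [if_neg fun h => hne (partExp_inj (hB L' hL') hK h), mul_zero]
  · intro h; exact absurd (Finset.mem_insert_self _ _) h

end DCong

/-- **Proposition (cong).**  Let `p` be prime, `w' ≥ 1`, `j ≥ 1`, `t ≥ 0`.  Let `λ'`,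
`μ'` be partitions of `w'` such that all parts of `λ'` are divisible by `p^t`.  Set
`w = w'·p^j`, `λ = p^j·λ'` (every part multiplied by `p^j`) and `μ = p^j * μ'` (the
multiset sum of `p^j` copies of `μ'`).  Then `d_{λμ} ≡ d_{λ'μ'} (mod p^{t+1})`, where
`d_{λμ}` is the coefficient of `X_{λ_1}⋯X_{λ_k}` in the unique polynomial `ψ_μ` with
`m_μ = ψ_μ(e_1, …, e_n)`, and similarly for `d_{λ'μ'}`. -/
theorem d_modEq (n : ℕ) (hn : 1 ≤ n) (p : ℕ) (hp : p.Prime)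
    (w' j t : ℕ) (hw' : 1 ≤ w') (hj : 1 ≤ j)
    (lam' mu' : w'.Partition)
    (hdvd : ∀ x ∈ lam'.parts, p ^ t ∣ x)
    (w : ℕ) (hw : w = w' * p ^ j)
    (lam : Multiset ℕ) (hlam : lam = lam'.parts.map fun x => p ^ j * x)
    (mu : w.Partition) (hmu : mu.parts = p ^ j • mu'.parts)
    (hlam'n : ∀ x ∈ lam'.parts, x ≤ n) (hlamn : ∀ x ∈ lam, x ≤ n)
    (hmu'n : Multiset.card mu'.parts ≤ n) (hmun : Multiset.card mu.parts ≤ n)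
    (ψ' ψ : MvPolynomial (Fin n) ℤ)
    (hψ' : MvPolynomial.aeval (fun i : Fin n => MvPolynomial.esymm (Fin n) ℤ ((i : ℕ) + 1)) ψ'
      = MvPolynomial.msymm (Fin n) ℤ mu')
    (hψ : MvPolynomial.aeval (fun i : Fin n => MvPolynomial.esymm (Fin n) ℤ ((i : ℕ) + 1)) ψ
      = MvPolynomial.msymm (Fin n) ℤ mu) :
    (p : ℤ) ^ (t + 1) ∣ ψ.coeff (partExp n lam) - ψ'.coeff (partExp n lam'.parts) := by
  have hq : 0 < p ^ j := pow_pos hp.pos j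
  have hww : w' ≤ w := by rw [hw]; exact Nat.le_mul_of_pos_right _ hq
  have gL' : DCong.Good n lam'.parts := fun x hx => ⟨lam'.parts_pos hx, hlam'n x hx⟩
  have gL : DCong.Good n lam := fun x hx => by
    refine ⟨?_, hlamn x hx⟩
    rw [hlam] at hx
    obtain ⟨y, hy, rfl⟩ := Multiset.mem_map.1 hx
    exact Nat.mul_pos hq (lam'.parts_pos hy)
  have gM' : DCong.Good w mu'.parts := fun x hx =>
    ⟨mu'.parts_pos hx, ((Multiset.le_sum_of_mem hx).trans mu'.parts_sum.le).trans hww⟩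
  have gM : DCong.Good w mu.parts := fun x hx =>
    ⟨mu.parts_pos hx, (Multiset.le_sum_of_mem hx).trans mu.parts_sum.le⟩
  obtain ⟨F, hF, hFp⟩ := DCong.exists_frob w p hp
  obtain ⟨L'', hL''⟩ : ∃ L'' : Multiset ℕ, lam'.parts = L''.map fun x => p ^ t * x := by
    refine ⟨lam'.parts.map fun x => x / p ^ t, ?_⟩
    rw [Multiset.map_map]
    conv_lhs => rw [← Multiset.map_id lam'.parts]
    exact Multiset.map_congr rfl fun x hx => (Nat.mul_div_cancel' (hdvd x hx)).symm
  have gL'' : DCong.Good n L'' := fun x hx => by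
    have h1 := gL' (p ^ t * x) (by rw [hL'']; exact Multiset.mem_map_of_mem _ hx)
    have h2 : 0 < p ^ t := pow_pos hp.pos t
    exact ⟨Nat.pos_of_mul_pos_left h1.1, (Nat.le_mul_of_pos_left x h2).trans h1.2⟩
  obtain ⟨f, hf⟩ := DCong.ev_surj w (DCong.Mp w n L'') (DCong.Mp_symm gL'')
  have hiter : ∀ s, DCong.ev w (F^[s] f) = MvPolynomial.expand (p ^ s) (DCong.ev w f) := by
    intro s
    induction s with
    | zero => simp
    | succ s ih =>
      rw [Function.iterate_succ_apply', hF, ih, ← MvPolynomial.expand_mul, pow_succ']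
  have h1 : DCong.ev w (F^[t] f) = DCong.Mp w n lam'.parts := by
    rw [hiter, hf, hL'', DCong.Mp_expand (pow_pos hp.pos t) gL'' (hL'' ▸ gL')]
  have hlam2 : lam = L''.map fun x => p ^ (t + j) * x := by
    rw [hlam, hL'', Multiset.map_map]
    refine Multiset.map_congr rfl fun x _ => ?_
    simp only [Function.comp]
    ring
  have h2 : DCong.ev w (F^[t + j] f) = DCong.Mp w n lam := by
    rw [hiter, hf, hlam2, DCong.Mp_expand (pow_pos hp.pos (t + j)) gL'' (hlam2 ▸ gL)]
  have hsurj : ∀ m N L, DCong.Good N L → ∃ g, DCong.ev m g = DCong.Mp m N L :=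
    fun m N L h => DCong.ev_surj m _ (DCong.Mp_symm h)
  have d1 := DCong.duality n w DCong.ev_injective hsurj lam'.parts mu'.parts gL' gM' ψ' _
    (hψ'.trans (DCong.msymm_eq mu' gM')) h1
  have d2 := DCong.duality n w DCong.ev_injective hsurj lam mu.parts gL gM ψ _
    (hψ.trans (DCong.msymm_eq mu gM)) h2
  have hpe : partExp w mu.parts = p ^ j • partExp w mu'.parts := by
    ext i
    simp [partExp, hmu]
  rw [d1, d2, hpe]
  exact DCong.frob_coeff w p hp F hFp f t j _

end
end

section
/- Let π_L be a uniformizer for L with minimum polynomial f(X) = X^n − c_1X^{n−1} + ⋯ + (−1)^n c_n over K. For a partition λ = {λ_1,…,λ_k} with parts satisfying 1 ≤ λ_i ≤ n, set c_λ = c_{λ_1}c_{λ_2}⋯c_{λ_k}. Let w ≥ 1 and let λ = {λ_1,…,λ_k} be a partition of w with 1 ≤ λ_i ≤ n for all i. Choose q minimizing v̄_p(λ_q) over 1 ≤ q ≤ k and set t = v̄_p(λ_q). Then v_L(c_λ) ≥ i_t^{π_L} + w. Moreover, if v_L(c_λ) = i_t^{π_L} + w and i_t^{π_L} < ∞, then,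 writing i_t^{π_L} = a_t·n − b_t with 1 ≤ b_t ≤ n, one has λ_q = b_t and λ_i = n for all i ≠ q. -/
open scoped Classical

noncomputable section

/-- `v` is a normalized (surjective onto `ℤ`) additive discrete valuation on the field `F`. -/
structure IsDiscreteValuationOn {F : Type*} [Field F] (v : F → WithTop ℤ) : Prop where
  eq_top_iff : ∀ x : F, v x = ⊤ ↔ x = 0
  map_mul : ∀ x y : F, v (x * y) = v x + v y
  min_le_add : ∀ x y : F, min (v x) (v y) ≤ v (x + y)
  surjective : ∀ m : ℤ, ∃ x : F, v x = (m : WithTop ℤ)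

/-- `F` is complete with respect to the additive valuation `v`: every Cauchy sequence
(with respect to `v`) converges. -/
def IsCompleteWrt {F : Type*} [Field F] (v : F → WithTop ℤ) : Prop :=
  ∀ f : ℕ → F,
    (∀ N : ℤ, ∃ M : ℕ, ∀ i ≥ M, ∀ k ≥ M, (N : WithTop ℤ) ≤ v (f i - f k)) →
      ∃ a : F, ∀ N : ℤ, ∃ M : ℕ, ∀ i ≥ M, (N : WithTop ℤ) ≤ v (f i - a)

/-- The residue field of `v` is perfect of characteristic `p`: the rational prime `p`
lies in the maximal ideal, and modulo the maximal ideal every integral element is the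
`p`-th power of an integral element. -/
def HasPerfectResidueFieldCharP {F : Type*} [Field F] (v : F → WithTop ℤ) (p : ℕ) : Prop :=
  (1 : WithTop ℤ) ≤ v (p : F) ∧
    ∀ x : F, (0 : WithTop ℤ) ≤ v x →
      ∃ y : F, (0 : WithTop ℤ) ≤ v y ∧ (1 : WithTop ℤ) ≤ v (x - y ^ p)

/-- `v̄_p(k) = min(v_p(k), ν)`. -/
def vbar (p ν k : ℕ) : ℕ := min (padicValNat p k) ν

/-- The coefficient `c_h` of the minimal polynomial
`f(X) = X^n - c_1 X^{n-1} + ... + (-1)^{n-1} c_{n-1} X + (-1)^n c_n` of `π` over `K`,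
where `n = [L:K]`; i.e. `c_h = (-1)^h · (coefficient of X^{n-h} in f)`. -/
def minpolyCoeff (K : Type*) {L : Type*} [Field K] [Field L] [Algebra K L]
    (n : ℕ) (π : L) (h : ℕ) : K :=
  (-1) ^ h * (minpoly K π).coeff (n - h)

/-- `i_j^{π_L} = min { n·v_K(c_h) - h : 1 ≤ h ≤ n, v̄_p(h) ≤ j }` (an element of
`WithTop ℤ`, the `min` of the empty set being `⊤`). -/
def iPi {K : Type*} [Field K] (vK : K → WithTop ℤ) (p ν n : ℕ) (c : ℕ → K) (j : ℕ) :
    WithTop ℤ :=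
  ((Finset.Icc 1 n).filter fun h => vbar p ν h ≤ j).inf
    fun h => (vK (c h)).map fun a => (n : ℤ) * a - (h : ℤ)

/-- The `j`-th index of inseparability
`i_j = min { i_{j'}^{π_L} + (j' - j)·e_L : j ≤ j' ≤ ν }`, where `eL = v_L(p)`. -/
def insepIdx {K : Type*} [Field K] (vK : K → WithTop ℤ) (p ν n : ℕ) (eL : WithTop ℤ)
    (c : ℕ → K) (j : ℕ) : WithTop ℤ :=
  (Finset.Icc j ν).inf fun j' => iPi vK p ν n c j' + (j' - j) • eL

/-- `φ̃_j(x) = i_j + p^j·x`. -/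
def phiTilde {K : Type*} [Field K] (vK : K → WithTop ℤ) (p ν n : ℕ) (eL : WithTop ℤ)
    (c : ℕ → K) (j x : ℕ) : WithTop ℤ :=
  insepIdx vK p ν n eL c j + (((p ^ j * x : ℕ) : ℤ) : WithTop ℤ)

/-- `φ_j(x) = min { φ̃_{j₀}(x) : 0 ≤ j₀ ≤ j }`. -/
def phiIdx {K : Type*} [Field K] (vK : K → WithTop ℤ) (p ν n : ℕ) (eL : WithTop ℤ)
    (c : ℕ → K) (j x : ℕ) : WithTop ℤ :=
  (Finset.Icc 0 j).inf fun j0 => phiTilde vK p ν n eL c j0 x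

/-- The Mathlib additive valuation attached to `IsDiscreteValuationOn`. -/
def toAddVal {F : Type*} [Field F] {v : F → WithTop ℤ} (h : IsDiscreteValuationOn v) :
    AddValuation F (WithTop ℤ) :=
  AddValuation.of v ((h.eq_top_iff 0).2 rfl)
    (by
      have h1 : v 1 ≠ ⊤ := fun h' => one_ne_zero ((h.eq_top_iff 1).1 h')
      have h2 := h.map_mul 1 1
      rw [mul_one] at h2
      obtain ⟨a, ha⟩ := WithTop.ne_top_iff_exists.1 h1
      rw [← ha] at h2 ⊢
      have h3 : a = a + a := by exact_mod_cast h2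
      have : a = 0 := by omega
      rw [this]; rfl)
    h.min_le_add h.map_mul

theorem toAddVal_apply {F : Type*} [Field F] {v : F → WithTop ℤ} (h : IsDiscreteValuationOn v)
    (x : F) : toAddVal h x = v x := rfl

theorem val_sum_eq_inf {F : Type*} [Field F] (v : AddValuation F (WithTop ℤ)) (g : ℕ → F)
    (s : Finset ℕ)
    (hd : ∀ i ∈ s, ∀ j ∈ s, i ≠ j → v (g i) ≠ ⊤ → v (g i) ≠ v (g j)) :
    v (∑ i ∈ s, g i) = s.inf fun i => v (g i) := by
  induction s using Finset.induction_on with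
  | empty => simp
  | insert a s ha ih =>
    have ih' := ih fun i hi j hj =>
      hd i (Finset.mem_insert_of_mem hi) j (Finset.mem_insert_of_mem hj)
    rw [Finset.sum_insert ha, Finset.inf_insert, ← ih']
    by_cases hne : v (g a) = v (∑ i ∈ s, g i)
    · have htop : v (g a) = ⊤ := by
        by_contra hnt
        rcases s.eq_empty_or_nonempty with rfl | hs
        · apply hnt; rw [hne]; simp
        · obtain ⟨i, hi, hii⟩ := Finset.exists_mem_eq_inf s hs fun i => v (g i)
          refine hd a (Finset.mem_insert_self _ _) i (Finset.mem_insert_of_mem hi) ?_ hnt ?_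
          · rintro rfl; exact ha hi
          · rw [hne, ih', hii]
      have := v.map_add (g a) (∑ i ∈ s, g i)
      rw [← hne, htop] at this ⊢
      simpa using this
    · exact v.map_add_of_distinct_val hne

theorem coeff_val {K L : Type*} [Field K] [Field L] [Algebra K L]
    [FiniteDimensional K L] (n : ℕ)
    (hdim : Module.finrank K L = n)
    (vK : K → WithTop ℤ) (vL : L → WithTop ℤ)
    (hvK : IsDiscreteValuationOn vK) (hvL : IsDiscreteValuationOn vL)
    (htotram : ∀ x : K, vL (algebraMap K L x) = n • vK x)
    (π : L) (hπ : vL π = 1) :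
    ∀ i < n, (1 : WithTop ℤ) ≤ vK ((minpoly K π).coeff i) := by
  have hterm : ∀ (c : K) (i : ℕ), toAddVal hvL (c • π ^ i) = n • vK c + ((i : ℤ) : WithTop ℤ) := by
    intro c i
    rw [Algebra.smul_def, AddValuation.map_mul, AddValuation.map_pow, toAddVal_apply,
      toAddVal_apply, hπ, htotram]
    congr 1
    simp
  have hpos : 0 < n := hdim ▸ Module.finrank_pos
  have htermcoe : ∀ (a : ℤ) (i : ℕ), n • ((a : ℤ) : WithTop ℤ) + ((i : ℤ) : WithTop ℤ)
      = ((n * a + i : ℤ) : WithTop ℤ) := by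
    intro a i
    have : n • ((a : ℤ) : WithTop ℤ) = ((n • a : ℤ) : WithTop ℤ) := (WithTop.coe_nsmul a n).symm
    rw [this, ← WithTop.coe_add, nsmul_eq_mul]
  have hint : IsIntegral K π := Algebra.IsIntegral.isIntegral π
  set f := minpoly K π with hf
  have hd : ∀ i ∈ Finset.range n, ∀ j ∈ Finset.range n, i ≠ j →
      toAddVal hvL (f.coeff i • π ^ i) ≠ ⊤ →
      toAddVal hvL (f.coeff i • π ^ i) ≠ toAddVal hvL (f.coeff j • π ^ j) := by
    intro i hi j hj hij hnt he
    rw [he] at hnt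
    have hnt' := hnt
    rw [← he] at hnt'
    rw [hterm] at hnt hnt'
    rw [hterm, hterm] at he
    have key : ∀ k : ℕ, n • vK (f.coeff k) + ((k : ℤ) : WithTop ℤ) ≠ ⊤ →
        ∃ a : ℤ, vK (f.coeff k) = a := by
      intro k hk
      rcases hh : vK (f.coeff k) with _ | a
      · exfalso; apply hk
        rw [hh]
        obtain ⟨m, rfl⟩ := Nat.exists_eq_succ_of_ne_zero hpos.ne'
        change (m + 1) • (⊤ : WithTop ℤ) + _ = ⊤
        rw [succ_nsmul]
        simp
      · exact ⟨a, rfl⟩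
    obtain ⟨a, ha⟩ := key i hnt'
    obtain ⟨b, hb⟩ := key j hnt
    rw [ha, hb, htermcoe, htermcoe] at he
    have he' : (n * a + i : ℤ) = n * b + j := by exact_mod_cast he
    rw [Finset.mem_range] at hi hj
    apply hij
    have h1 : ((n * a + i : ℤ)) % n = (n * b + j : ℤ) % n := by rw [he']
    rw [Int.mul_add_emod_self_left, Int.mul_add_emod_self_left,
      Int.emod_eq_of_lt (by omega) (by omega), Int.emod_eq_of_lt (by omega) (by omega)] at h1
    exact_mod_cast h1
  have hsum := val_sum_eq_inf (toAddVal hvL) (fun i => f.coeff i • π ^ i) (Finset.range n) hd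
  have hmonic : f.Monic := minpoly.monic hint
  have hK1 : vK 1 = 0 := (toAddVal hvK).map_one
  have hdeg : f.natDegree = n := by
    have hle : f.natDegree ≤ n := hdim ▸ minpoly.natDegree_le π
    by_contra hne
    have hlt : f.natDegree < n := lt_of_le_of_ne hle hne
    have h0 := Polynomial.aeval_eq_sum_range' hlt π
    rw [hf, minpoly.aeval, ← hf] at h0
    rw [← h0, AddValuation.map_zero] at hsum
    have h1 : (⊤ : WithTop ℤ) ≤ toAddVal hvL (f.coeff f.natDegree • π ^ f.natDegree) := by
      rw [hsum]
      exact Finset.inf_le (f := fun i => toAddVal hvL (f.coeff i • π ^ i))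
        (Finset.mem_range.2 hlt)
    rw [hterm, hmonic.coeff_natDegree, hK1, ← WithTop.coe_zero, htermcoe] at h1
    exact absurd h1 (by simp)
  have h0 := Polynomial.aeval_eq_sum_range (p := f) π
  rw [hdeg, hf, minpoly.aeval, ← hf, Finset.sum_range_succ] at h0
  have h1 : ∑ i ∈ Finset.range n, f.coeff i • π ^ i = -(f.coeff n • π ^ n) :=
    eq_neg_of_add_eq_zero_left h0.symm
  rw [h1, AddValuation.map_neg, hterm] at hsum
  intro i hi
  have h2 : n • vK (f.coeff n) + ((n : ℤ) : WithTop ℤ) ≤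
      toAddVal hvL (f.coeff i • π ^ i) := by
    rw [hsum]
    exact Finset.inf_le (f := fun i => toAddVal hvL (f.coeff i • π ^ i))
      (Finset.mem_range.2 hi)
  have h3 : f.coeff n = 1 := by rw [← hdeg]; exact hmonic.coeff_natDegree
  rw [h3, hK1, ← WithTop.coe_zero, htermcoe, hterm] at h2
  rcases hh : vK (f.coeff i) with _ | a
  · exact le_top
  · rw [hh] at h2
    change _ ≤ n • ((a : ℤ) : WithTop ℤ) + _ at h2
    rw [htermcoe] at h2
    have h4 : (n * 0 + n : ℤ) ≤ n * a + i := by exact_mod_cast h2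
    have h5 : 1 ≤ a := by
      by_contra hlt
      have : (n : ℤ) * a ≤ n * 0 := by
        apply mul_le_mul_of_nonneg_left <;> omega
      omega
    change ((1 : ℤ) : WithTop ℤ) ≤ ((a : ℤ) : WithTop ℤ)
    exact_mod_cast h5

theorem prod_val {K : Type*} [Field K] (v : AddValuation K (WithTop ℤ)) (n : ℕ)
    (c : ℕ → K) (s : Multiset ℕ)
    (hs : ∀ h ∈ s, h ≤ n ∧ (1 : WithTop ℤ) ≤ v (c h) ∧ v (c h) ≠ ⊤) :
    ∃ M : ℤ, v ((s.map c).prod) = (M : WithTop ℤ) ∧ (s.sum : ℤ) ≤ n * M ∧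
      ((s.sum : ℤ) = n * M → ∀ h ∈ s, h = n) := by
  induction s using Multiset.induction_on with
  | empty => exact ⟨0, by simp, by simp, by simp⟩
  | cons a s ih =>
    obtain ⟨M, h1, h2, h3⟩ := ih fun h hh => hs h (Multiset.mem_cons_of_mem hh)
    obtain ⟨ha1, ha2, ha3⟩ := hs a (Multiset.mem_cons_self a s)
    obtain ⟨m, hm⟩ := WithTop.ne_top_iff_exists.1 ha3
    rw [← hm] at ha2
    have hm1 : (1 : ℤ) ≤ m := by exact_mod_cast ha2
    have hnm : (n : ℤ) * 1 ≤ n * m := mul_le_mul_of_nonneg_left hm1 (by omega)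
    refine ⟨m + M, ?_, ?_, ?_⟩
    · rw [Multiset.map_cons, Multiset.prod_cons, AddValuation.map_mul, h1, ← hm,
        ← WithTop.coe_add]
    · rw [Multiset.sum_cons, mul_add, Nat.cast_add]; omega
    · intro he h hh
      rw [Multiset.sum_cons, mul_add, Nat.cast_add] at he
      rcases Multiset.mem_cons.1 hh with rfl | hh
      · omega
      · exact h3 (by omega) h hh

/-- **Proposition (Sigma).**  Let `π_L` be a uniformizer of the totally ramified
separable extension `L/K` of degree `n = u·p^ν`, with minimal polynomial coefficients
`c_h`, and for a partition `λ` with parts in `[1, n]` set `c_λ = c_{λ_1}⋯c_{λ_k}`.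
Let `w ≥ 1` and let `λ` be a partition of `w` with parts in `[1, n]`.  Choose `q`
minimizing `v̄_p(λ_q)` and set `t = v̄_p(λ_q)`.  Then `v_L(c_λ) ≥ i_t^{π_L} + w`;
moreover if `v_L(c_λ) = i_t^{π_L} + w` and `i_t^{π_L} < ∞`, then writing
`i_t^{π_L} = a_t·n - b_t` with `1 ≤ b_t ≤ n` one has `λ_q = b_t` and `λ_i = n` for all
`i ≠ q`. -/
theorem sigma_bound {K L : Type*} [Field K] [Field L] [Algebra K L]
    [FiniteDimensional K L] [Algebra.IsSeparable K L]
    (p u ν n : ℕ) (hp : p.Prime) (hu : ¬ p ∣ u) (hn : n = u * p ^ ν)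
    (hdim : Module.finrank K L = n)
    (vK : K → WithTop ℤ) (vL : L → WithTop ℤ)
    (hvK : IsDiscreteValuationOn vK) (hvL : IsDiscreteValuationOn vL)
    (hKcomplete : IsCompleteWrt vK)
    (hres : HasPerfectResidueFieldCharP vK p)
    (htotram : ∀ x : K, vL (algebraMap K L x) = n • vK x)
    (π : L) (hπ : vL π = 1)
    (w : ℕ) (hw : 1 ≤ w)
    (lam : Multiset ℕ) (hsum : lam.sum = w)
    (hparts : ∀ x ∈ lam, 1 ≤ x ∧ x ≤ n)
    (q : ℕ) (hq : q ∈ lam) (hqmin : ∀ x ∈ lam, vbar p ν q ≤ vbar p ν x) :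
    (iPi vK p ν n (minpolyCoeff K n π) (vbar p ν q) + ((w : ℤ) : WithTop ℤ) ≤
        vL (algebraMap K L ((lam.map (minpolyCoeff K n π)).prod))) ∧
      ∀ a_t b_t : ℕ,
        iPi vK p ν n (minpolyCoeff K n π) (vbar p ν q)
            = (((a_t : ℤ) * (n : ℤ) - (b_t : ℤ) : ℤ) : WithTop ℤ) →
          1 ≤ b_t → b_t ≤ n →
          vL (algebraMap K L ((lam.map (minpolyCoeff K n π)).prod)) =
            iPi vK p ν n (minpolyCoeff K n π) (vbar p ν q) + ((w : ℤ) : WithTop ℤ) →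
          q = b_t ∧ lam.erase q = Multiset.replicate (Multiset.card lam - 1) n := by
  have hpos : 0 < n := hdim ▸ Module.finrank_pos
  have hcv := coeff_val n hdim vK vL hvK hvL htotram π hπ
  set c := minpolyCoeff K n π with hc
  set v := toAddVal hvK with hv
  have hvc : ∀ h, 1 ≤ h → h ≤ n → (1 : WithTop ℤ) ≤ v (c h) := by
    intro h h1 h2
    have hval : v (c h) = vK ((minpoly K π).coeff (n - h)) := by
      have hn1 : v ((-1 : K) ^ h) = 0 := by
        rw [AddValuation.map_pow, AddValuation.map_neg, AddValuation.map_one, smul_zero]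
      rw [hc]
      unfold minpolyCoeff
      rw [AddValuation.map_mul, hn1, zero_add]
      rfl
    rw [hval]
    exact hcv _ (by omega)
  obtain ⟨s, rfl⟩ := Multiset.exists_cons_of_mem hq
  by_cases htop : ∃ h ∈ q ::ₘ s, c h = 0
  · obtain ⟨h, hh, h0⟩ := htop
    have hz : ((q ::ₘ s).map c).prod = 0 :=
      Multiset.prod_eq_zero (Multiset.mem_map.2 ⟨h, hh, h0⟩)
    have hz' : vL (algebraMap K L ((q ::ₘ s).map c).prod) = ⊤ := by
      rw [hz, map_zero]; exact (hvL.eq_top_iff 0).2 rfl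
    rw [hz']
    refine ⟨le_top, ?_⟩
    intro a b hab _ _ he
    rw [hab, ← WithTop.coe_add] at he
    exact absurd he WithTop.top_ne_coe
  · push Not at htop
    have hall : ∀ h ∈ q ::ₘ s, h ≤ n ∧ (1 : WithTop ℤ) ≤ v (c h) ∧ v (c h) ≠ ⊤ :=
      fun h hh => ⟨(hparts h hh).2, hvc h (hparts h hh).1 (hparts h hh).2,
        fun ht => htop h hh ((hvK.eq_top_iff _).1 ht)⟩
    obtain ⟨M, hM1, hM2, hM3⟩ := prod_val v n c s
      fun h hh => hall h (Multiset.mem_cons_of_mem hh)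
    obtain ⟨hq1, hq2, hq3⟩ := hall q (Multiset.mem_cons_self q s)
    obtain ⟨m, hm⟩ := WithTop.ne_top_iff_exists.1 hq3
    have hvLval : vL (algebraMap K L ((q ::ₘ s).map c).prod) = ((n * m + n * M : ℤ) : WithTop ℤ) := by
      have h1 : vK ((q ::ₘ s).map c).prod = ((m + M : ℤ) : WithTop ℤ) := by
        change v ((q ::ₘ s).map c).prod = _
        rw [Multiset.map_cons, Multiset.prod_cons, AddValuation.map_mul, hM1, ← hm,
          ← WithTop.coe_add]
      rw [htotram, h1, ← mul_add, ← nsmul_eq_mul]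
      exact (WithTop.coe_nsmul (m + M) n).symm
    have hi : iPi vK p ν n c (vbar p ν q) ≤ ((n * m - q : ℤ) : WithTop ℤ) := by
      have h1 : iPi vK p ν n c (vbar p ν q) ≤
          (vK (c q)).map fun a => (n : ℤ) * a - (q : ℤ) := by
        unfold iPi
        refine Finset.inf_le (f := fun h => (vK (c h)).map fun a => (n : ℤ) * a - (h : ℤ)) ?_
        rw [Finset.mem_filter, Finset.mem_Icc]
        exact ⟨hparts q hq, le_rfl⟩
      have h2 : vK (c q) = (m : WithTop ℤ) := hm.symm
      rw [h2] at h1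
      exact h1
    rw [hvLval]
    rw [Multiset.sum_cons] at hsum
    have hsum' : (q : ℤ) + (s.sum : ℤ) = w := by exact_mod_cast hsum
    obtain ⟨I, hI⟩ := WithTop.ne_top_iff_exists.1 (ne_top_of_le_ne_top WithTop.coe_ne_top hi)
    rw [← hI] at hi ⊢
    have hi' : I ≤ n * m - q := by exact_mod_cast hi
    rw [← WithTop.coe_add]
    refine ⟨?_, ?_⟩
    · have : I + w ≤ n * m + n * M := by omega
      exact_mod_cast this
    · intro a b hab hb1 hb2 he
      have hab' : I = a * n - b := by exact_mod_cast hab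
      have he' : (n * m + n * M : ℤ) = I + w := by exact_mod_cast he
      have hs := hM3 (by omega)
      have hq' : (n * m - q : ℤ) = a * n - b := by omega
      obtain ⟨hq1, hq2⟩ := hparts q hq
      refine ⟨?_, ?_⟩
      · have hdiv : (n : ℤ) ∣ (q : ℤ) - b := ⟨m - a, by linarith [mul_sub (n : ℤ) m a, mul_comm (n : ℤ) a]⟩
        have h0 := Int.eq_zero_of_abs_lt_dvd hdiv (by rw [abs_lt]; omega)
        omega
      · rw [Multiset.erase_cons_head, Multiset.card_cons, Nat.add_sub_cancel]
        exact Multiset.eq_replicate_card.2 hs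

end
end

section
/- Let π_L and π̃_L be uniformizers for L, and let φ(X) = r_1X + r_2X² + ⋯ be a power series with coefficients in O_K such that π̃_L = φ(π_L). Then for 1 ≤ h ≤ n, E_h(π̃_L) = Σ_μ r_{μ_1}r_{μ_2}⋯r_{μ_h}·M_μ(π_L), where the (convergent) sum ranges over all partitions μ = {μ_1,…,μ_h} with exactly h parts. -/
open scoped Classical

noncomputable section

/-- Convergence of a (possibly infinite) sum with respect to the additive valuation `v`:
`HasValSum v f a` means that the net of finite partial sums of `f` converges to `a`
in the valuation topology of `v`. -/
def HasValSum {F ι : Type*} [Field F] (v : F → WithTop ℤ) (f : ι → F) (a : F) : Prop :=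
  ∀ N : ℤ, ∃ s₀ : Finset ι, ∀ s : Finset ι, s₀ ⊆ s →
    (N : WithTop ℤ) ≤ v ((∑ i ∈ s, f i) - a)

/-- `E_h(α) = e_h(σ_1(α), …, σ_n(α))`, the `h`-th elementary symmetric function of the
conjugates of `α ∈ L` under the `n` distinct `K`-embeddings `σ_1, …, σ_n` of `L` into
`K^sep`.  It is computed as `(-1)^h` times the coefficient of `X^{n-h}` in the
characteristic polynomial of multiplication by `α` on `L`: for `L/K` separable of
degree `n` this characteristic polynomial equals `∏_{i=1}^n (X - σ_i(α))`. -/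
def conjE (K : Type*) {L : Type*} [Field K] [Field L] [Algebra K L]
    [FiniteDimensional K L] (n : ℕ) (h : ℕ) (α : L) : K :=
  (-1) ^ h * (LinearMap.charpoly (LinearMap.mulLeft K α)).coeff (n - h)

namespace IsDiscreteValuationOn

variable {F : Type*} [Field F] {v : F → WithTop ℤ}

theorem v_zero (hv : IsDiscreteValuationOn v) : v 0 = ⊤ := (hv.eq_top_iff 0).2 rfl

theorem v_one (hv : IsDiscreteValuationOn v) : v 1 = 0 := by
  have h := hv.map_mul 1 1
  rw [mul_one] at h
  have h1 : v 1 ≠ ⊤ := fun h => one_ne_zero ((hv.eq_top_iff 1).1 h)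
  lift v 1 to ℤ using h1 with a
  norm_cast at h ⊢
  omega

theorem v_neg_one (hv : IsDiscreteValuationOn v) : v (-1) = 0 := by
  have h := hv.map_mul (-1) (-1)
  rw [neg_one_mul, neg_neg, hv.v_one] at h
  have h1 : v (-1) ≠ ⊤ := fun h => neg_ne_zero.2 one_ne_zero ((hv.eq_top_iff (-1)).1 h)
  lift v (-1) to ℤ using h1 with a
  norm_cast at h ⊢
  omega

theorem v_neg (hv : IsDiscreteValuationOn v) (x : F) : v (-x) = v x := by
  rw [← neg_one_mul, hv.map_mul, hv.v_neg_one, zero_add]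

theorem le_add (hv : IsDiscreteValuationOn v) {N : WithTop ℤ} {x y : F} (hx : N ≤ v x)
    (hy : N ≤ v y) : N ≤ v (x + y) := (le_min hx hy).trans (hv.min_le_add x y)

theorem le_sub (hv : IsDiscreteValuationOn v) {N : WithTop ℤ} {x y : F} (hx : N ≤ v x)
    (hy : N ≤ v y) : N ≤ v (x - y) := by
  rw [sub_eq_add_neg]; exact hv.le_add hx (by rwa [hv.v_neg])

theorem le_sum (hv : IsDiscreteValuationOn v) {ι : Type*} {N : WithTop ℤ} (s : Finset ι)
    (f : ι → F) (h : ∀ i ∈ s, N ≤ v (f i)) : N ≤ v (∑ i ∈ s, f i) := by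
  induction s using Finset.induction_on with
  | empty => simp [hv.v_zero]
  | insert a s ha ih =>
    rw [Finset.sum_insert ha]
    exact hv.le_add (h a (by simp)) (ih fun i hi => h i (by simp [hi]))

theorem v_pow (hv : IsDiscreteValuationOn v) (x : F) (k : ℕ) : v (x ^ k) = k • v x := by
  induction k with
  | zero => simp [hv.v_one]
  | succ k ih => rw [pow_succ, hv.map_mul, ih, succ_nsmul]

theorem v_intCast_nonneg (hv : IsDiscreteValuationOn v) (z : ℤ) : 0 ≤ v (z : F) := by
  have hn : ∀ k : ℕ, 0 ≤ v (k : F) := by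
    intro k
    induction k with
    | zero => simp [hv.v_zero]
    | succ k ih => push_cast; exact hv.le_add ih hv.v_one.ge
  rcases Int.eq_nat_or_neg z with ⟨k, rfl | rfl⟩
  · simpa using hn k
  · simpa [hv.v_neg] using hn k

theorem prod_nonneg (hv : IsDiscreteValuationOn v) (s : Multiset F)
    (h : ∀ x ∈ s, 0 ≤ v x) : 0 ≤ v s.prod := by
  induction s using Multiset.induction_on with
  | empty => simp [hv.v_one]
  | cons a s ih =>
    rw [Multiset.prod_cons, hv.map_mul]
    exact add_nonneg (h a (by simp)) (ih fun x hx => h x (by simp [hx]))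

/-- The valuation ring. -/
def ring (hv : IsDiscreteValuationOn v) : Subring F where
  carrier := {x | 0 ≤ v x}
  mul_mem' := by
    intro a b ha hb
    simp only [Set.mem_ofPred_eq] at *
    rw [hv.map_mul]; exact add_nonneg ha hb
  one_mem' := hv.v_one.ge
  add_mem' := fun ha hb => hv.le_add ha hb
  zero_mem' := by simp [hv.v_zero]
  neg_mem' := by intro x hx; simpa [hv.v_neg] using hx

/-- The ideal of elements of valuation at least `N`. -/
def ideal (hv : IsDiscreteValuationOn v) (N : ℕ) : Ideal hv.ring where
  carrier := {x | ((N : ℤ) : WithTop ℤ) ≤ v (x : F)}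
  add_mem' := fun ha hb => hv.le_add ha hb
  zero_mem' := by simp [hv.v_zero]
  smul_mem' := by
    intro c x hx
    have hc : 0 ≤ v (c : F) := c.2
    simp only [Set.mem_ofPred_eq, smul_eq_mul, Subring.coe_mul] at *
    rw [hv.map_mul]
    simpa using add_le_add hc hx

theorem mem_ideal (hv : IsDiscreteValuationOn v) (N : ℕ) (x : hv.ring) :
    x ∈ hv.ideal N ↔ ((N : ℤ) : WithTop ℤ) ≤ v (x : F) := Iff.rfl

theorem charpoly_coeff_congr (hv : IsDiscreteValuationOn v) {ι : Type*} [Fintype ι]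
    [DecidableEq ι] (A B : Matrix ι ι F) (hA : ∀ i j, 0 ≤ v (A i j)) (hB : ∀ i j, 0 ≤ v (B i j))
    (N : ℕ) (hAB : ∀ i j, ((N : ℤ) : WithTop ℤ) ≤ v (A i j - B i j)) (k : ℕ) :
    ((N : ℤ) : WithTop ℤ) ≤ v (A.charpoly.coeff k - B.charpoly.coeff k) := by
  let A' : Matrix ι ι hv.ring := fun i j => ⟨A i j, hA i j⟩
  let B' : Matrix ι ι hv.ring := fun i j => ⟨B i j, hB i j⟩
  have eA : A = A'.map hv.ring.subtype := rfl
  have eB : B = B'.map hv.ring.subtype := rfl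
  have e : A'.map (Ideal.Quotient.mk (hv.ideal N)) = B'.map (Ideal.Quotient.mk (hv.ideal N)) := by
    ext i j
    simp only [Matrix.map_apply]
    rw [Ideal.Quotient.eq]
    exact hAB i j
  have e2 := congrArg (fun M => M.charpoly.coeff k) e
  simp only [Matrix.charpoly_map, Polynomial.coeff_map] at e2
  rw [Ideal.Quotient.eq] at e2
  rw [eA, eB, Matrix.charpoly_map, Matrix.charpoly_map, Polynomial.coeff_map, Polynomial.coeff_map]
  exact e2

theorem charpoly_coeff_nilp (hv : IsDiscreteValuationOn v) {ι : Type*} [Fintype ι]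
    [DecidableEq ι] (A : Matrix ι ι F) (hA : ∀ i j, 0 ≤ v (A i j))
    (m : ℕ) (hAm : ∀ i j, (1 : WithTop ℤ) ≤ v ((A ^ m) i j)) (k : ℕ) (hk : k < Fintype.card ι) :
    (1 : WithTop ℤ) ≤ v (A.charpoly.coeff k) := by
  let A' : Matrix ι ι hv.ring := fun i j => ⟨A i j, hA i j⟩
  have eA : A = A'.map hv.ring.subtype := rfl
  have hnil : IsNilpotent (A'.map (Ideal.Quotient.mk (hv.ideal 1))) := by
    refine ⟨m, ?_⟩
    rw [← Matrix.map_pow]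
    ext i j
    simp only [Matrix.map_apply, Matrix.zero_apply]
    rw [Ideal.Quotient.eq_zero_iff_mem, mem_ideal]
    have := hAm i j
    rw [eA, ← Matrix.map_pow] at this
    simpa using this
  have h1 := Matrix.isNilpotent_charpoly_sub_pow_of_isNilpotent hnil
  rw [Polynomial.isNilpotent_iff] at h1
  obtain ⟨q, hq⟩ := h1 k
  rw [Polynomial.coeff_sub, Polynomial.coeff_X_pow, if_neg hk.ne, sub_zero, Matrix.charpoly_map,
    Polynomial.coeff_map, ← map_pow, Ideal.Quotient.eq_zero_iff_mem, mem_ideal] at hq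
  rw [eA, Matrix.charpoly_map, Polynomial.coeff_map]
  simp only [Subring.coe_pow, hv.v_pow] at hq
  simp only [Subring.subtype_apply]
  have h0 : 0 ≤ v ((A'.charpoly.coeff k : hv.ring) : F) := (A'.charpoly.coeff k).2
  generalize v ((A'.charpoly.coeff k : hv.ring) : F) = a at *
  induction a using WithTop.recTopCoe with
  | top => exact le_top
  | coe a =>
    norm_cast at *
    by_contra hlt
    have : a = 0 := by omega
    subst this
    simp at hq

end IsDiscreteValuationOn

section Helpers

theorem infinite_of_val {F : Type*} [Field F] {v : F → WithTop ℤ}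
    (hv : IsDiscreteValuationOn v) : Infinite F := by
  refine Infinite.of_surjective (fun x => (v x).untopD 0) (fun m : ℤ => ?_)
  obtain ⟨x, hx⟩ := hv.surjective m
  exact ⟨x, by simp [hx]⟩

theorem charpoly_map_eq_prod {K L : Type*} [Field K] [Field L] [Algebra K L] [Infinite K]
    [FiniteDimensional K L] [Algebra.IsSeparable K L] (α : L) :
    (LinearMap.charpoly (LinearMap.mulLeft K α)).map (algebraMap K (AlgebraicClosure K)) =
      ∏ σ : L →ₐ[K] AlgebraicClosure K, (Polynomial.X - Polynomial.C (σ α)) := by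
  apply Polynomial.eq_of_infinite_eval_eq
  refine Set.Infinite.mono ?_ (Set.infinite_range_of_injective
    (algebraMap K (AlgebraicClosure K)).injective)
  rintro _ ⟨t, rfl⟩
  change Polynomial.eval _ _ = Polynomial.eval _ _
  rw [Polynomial.eval_map_apply, LinearMap.eval_charpoly, Polynomial.eval_prod]
  have : algebraMap K (Module.End K L) t - LinearMap.mulLeft K α =
      Algebra.lmul K L (algebraMap K L t - α) := by
    ext x
    simp [sub_mul, Algebra.smul_def]
  rw [this, ← Algebra.norm_apply, Algebra.norm_eq_prod_embeddings K (AlgebraicClosure K)]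
  simp

theorem exists_conj {K L : Type*} [Field K] [Field L] [Algebra K L] [Infinite K]
    [FiniteDimensional K L] [Algebra.IsSeparable K L] {n : ℕ} (hdim : Module.finrank K L = n) :
    ∃ σ : Fin n → (L →ₐ[K] AlgebraicClosure K), ∀ (α : L) (h : ℕ), h ≤ n →
      algebraMap K (AlgebraicClosure K) (conjE K n h α) =
        (Finset.univ.val.map fun i => σ i α).esymm h := by
  have hc : Fintype.card (L →ₐ[K] AlgebraicClosure K) = n := by rw [AlgHom.card, hdim]
  let e := (Fintype.equivFinOfCardEq hc).symm
  refine ⟨e, fun α h hh => ?_⟩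
  have h1 := congrArg (fun q => q.coeff (n - h)) (charpoly_map_eq_prod (K := K) α)
  simp only [Polynomial.coeff_map] at h1
  rw [conjE, map_mul, h1, ← e.prod_comp]
  have h2 := Multiset.prod_X_sub_C_coeff (Finset.univ.val.map fun i => e i α) (k := n - h)
    (by simp)
  simp only [Multiset.map_map, Multiset.card_map, Finset.card_val, Finset.card_univ,
    Fintype.card_fin, Nat.sub_sub_self hh] at h2
  rw [Finset.prod_eq_multiset_prod]
  change _ * ((Multiset.map ((fun t => Polynomial.X - Polynomial.C t) ∘ fun i => (e i) α) Finset.univ.val).prod).coeff (n - h) = _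
  rw [h2, ← mul_assoc]
  simp [← mul_pow]

theorem nsmul_coe (n : ℕ) (a : ℤ) : n • (a : WithTop ℤ) = ((n * a : ℤ) : WithTop ℤ) := by
  rw [← WithTop.coe_nsmul, nsmul_eq_mul]; 

theorem val_coeff {K L : Type*} [Field K] [Field L] [Algebra K L] {n : ℕ} (hn : 0 < n)
    {vK : K → WithTop ℤ} {vL : L → WithTop ℤ}
    (hvK : IsDiscreteValuationOn vK) (hvL : IsDiscreteValuationOn vL)
    (htotram : ∀ x : K, vL (algebraMap K L x) = n • vK x)
    {π : L} (hπ : vL π = 1) (a : Fin n → K) (M : WithTop ℤ)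
    (hM : M ≤ vL (∑ i, a i • π ^ (i : ℕ))) (i : Fin n) : M ≤ n • vK (a i) + ((i : ℤ) : WithTop ℤ) := by
  have ht : ∀ i, vL (a i • π ^ (i : ℕ)) = n • vK (a i) + ((i : ℤ) : WithTop ℤ) := by
    intro i
    rw [Algebra.smul_def, hvL.map_mul, htotram, hvL.v_pow, hπ]
    congr 1
    have := nsmul_coe i 1
    simpa using this
  rw [← ht]
  by_contra hlt
  push Not at hlt
  haveI : Nonempty (Fin n) := ⟨i⟩
  obtain ⟨j, -, hj⟩ := Finset.exists_min_image Finset.univ (fun i => vL (a i • π ^ (i : ℕ)))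
    ⟨i, Finset.mem_univ i⟩
  have hjM : vL (a j • π ^ (j : ℕ)) < M := (hj i (Finset.mem_univ i)).trans_lt hlt
  have hjs : ∀ k, k ≠ j → vL (a j • π ^ (j : ℕ)) < vL (a k • π ^ (k : ℕ)) := by
    intro k hk
    refine lt_of_le_of_ne (hj k (Finset.mem_univ k)) fun heq => hk ?_
    have hjt : vL (a j • π ^ (j : ℕ)) ≠ ⊤ := (hjM.trans_le le_top).ne
    have hkt : vL (a k • π ^ (k : ℕ)) ≠ ⊤ := heq ▸ hjt
    rw [ht] at hjt hkt
    rw [ht, ht] at heq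
    have hj' : vK (a j) ≠ ⊤ := by
      intro h; rw [h] at hjt; apply hjt
      obtain ⟨m, rfl⟩ : ∃ m, n = m + 1 := ⟨n - 1, by omega⟩
      simp [succ_nsmul]
    have hk' : vK (a k) ≠ ⊤ := by
      intro h; rw [h] at hkt; apply hkt
      obtain ⟨m, rfl⟩ : ∃ m, n = m + 1 := ⟨n - 1, by omega⟩
      simp [succ_nsmul]
    lift vK (a j) to ℤ using hj' with x
    lift vK (a k) to ℤ using hk' with y
    rw [nsmul_coe, nsmul_coe] at heq
    norm_cast at heq
    have h1 := congrArg (· % (n : ℤ)) heq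
    simp only [Int.mul_add_emod_self_left] at h1
    rw [Int.emod_eq_of_lt (by positivity) (by exact_mod_cast j.2),
      Int.emod_eq_of_lt (by positivity) (by exact_mod_cast k.2)] at h1
    exact Fin.ext (by exact_mod_cast h1.symm)
  have hjt : vL (a j • π ^ (j : ℕ)) ≠ ⊤ := (hjM.trans_le le_top).ne
  generalize hx : vL (a j • π ^ (j : ℕ)) = x at *
  lift x to ℤ using hjt
  have hsucc : ∀ y : WithTop ℤ, (x : WithTop ℤ) < y → ((x + 1 : ℤ) : WithTop ℤ) ≤ y := by
    intro y hy
    induction y using WithTop.recTopCoe with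
    | top => exact le_top
    | coe y => norm_cast at *
  have hrest : ((x + 1 : ℤ) : WithTop ℤ) ≤
      vL (∑ i ∈ Finset.univ.erase j, a i • π ^ (i : ℕ)) :=
    hvL.le_sum _ _ fun k hk => hsucc _ (hjs k (Finset.ne_of_mem_erase hk))
  have hsum := (hsucc _ hjM).trans hM
  have := hvL.le_sub hsum hrest
  rw [← Finset.add_sum_erase _ _ (Finset.mem_univ j), add_sub_cancel_right, hx] at this
  norm_cast at this
  omega

theorem exists_basis {K L : Type*} [Field K] [Field L] [Algebra K L] [FiniteDimensional K L]
    {n : ℕ} (hn : 0 < n) (hdim : Module.finrank K L = n)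
    {vK : K → WithTop ℤ} {vL : L → WithTop ℤ}
    (hvK : IsDiscreteValuationOn vK) (hvL : IsDiscreteValuationOn vL)
    (htotram : ∀ x : K, vL (algebraMap K L x) = n • vK x)
    {π : L} (hπ : vL π = 1) :
    ∃ b : Module.Basis (Fin n) K L, ∀ (N : ℕ) (α : L), ((n * N : ℤ) : WithTop ℤ) ≤ vL α →
      ∀ i j, ((N : ℤ) : WithTop ℤ) ≤ vK (Algebra.leftMulMatrix b α i j) := by
  have hli : LinearIndependent K (fun i : Fin n => π ^ (i : ℕ)) := by
    rw [Fintype.linearIndependent_iff]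
    intro g hg i
    have := val_coeff hn hvK hvL htotram hπ g ⊤ (by rw [hg, hvL.v_zero]) i
    rw [← hvK.eq_top_iff]
    by_contra hne
    lift vK (g i) to ℤ using hne with x
    rw [nsmul_coe] at this
    norm_cast at this
  haveI : Nonempty (Fin n) := ⟨⟨0, hn⟩⟩
  let b := basisOfLinearIndependentOfCardEqFinrank hli (by simp [hdim])
  have hb : ∀ i, b i = π ^ (i : ℕ) := by
    intro i; simp [b]
  refine ⟨b, fun N α hα i j => ?_⟩
  rw [Algebra.leftMulMatrix_eq_repr_mul]
  have h1 : ((n * N : ℤ) : WithTop ℤ) ≤ vL (α * b j) := by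
    rw [hvL.map_mul, hb, hvL.v_pow, hπ]
    refine hα.trans (le_add_of_nonneg_right ?_)
    exact nsmul_nonneg zero_le_one _
  rw [← b.sum_repr (α * b j)] at h1
  simp only [hb] at h1
  have h2 := val_coeff hn hvK hvL htotram hπ _ _ h1 i
  rw [hb]
  generalize vK _ = y at *
  induction y using WithTop.recTopCoe with
  | top => exact le_top
  | coe y =>
    rw [nsmul_coe] at h2
    norm_cast at *
    have hi : ((i : ℕ) : ℤ) < n := by exact_mod_cast i.2
    by_contra hlt
    push Not at hlt
    have : (n : ℤ) * (y + 1) ≤ n * N := by gcongr; omega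
    push_cast at *
    nlinarith

/-- Isobaric replacement. -/
theorem aeval_weight {n : ℕ} {R : Type*} [CommRing R] (x : Fin n → R) (E : Fin n → R)
    (hE : ∀ i, E i = MvPolynomial.aeval x (MvPolynomial.esymm (Fin n) ℤ ((i : ℕ) + 1)))
    (w : ℕ) (P : MvPolynomial (Fin n) ℤ) (Q : MvPolynomial (Fin n) ℤ)
    (hQ : Q.IsHomogeneous w)
    (hP : MvPolynomial.aeval (fun i : Fin n => MvPolynomial.esymm (Fin n) ℤ ((i : ℕ) + 1)) P = Q) :
    MvPolynomial.aeval E P = ∑ d ∈ P.support.filter (fun d => ∑ i : Fin n, d i * ((i : ℕ) + 1) = w),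
      ((MvPolynomial.coeff d P : ℤ) : R) * ∏ i, E i ^ d i := by
  have hes : ∀ k, (MvPolynomial.esymm (Fin n) ℤ k).IsHomogeneous k := by
    intro k
    apply MvPolynomial.IsHomogeneous.sum
    intro s hs
    rw [Finset.mem_powersetCard] at hs
    have := MvPolynomial.IsHomogeneous.prod s (fun i => (MvPolynomial.X i : MvPolynomial (Fin n) ℤ))
      (fun _ => 1) (fun i _ => MvPolynomial.isHomogeneous_X _ _)
    simpa [hs.2] using this
  let T : (Fin n →₀ ℕ) → MvPolynomial (Fin n) ℤ := fun d =>
    MvPolynomial.C (P.coeff d) * ∏ i : Fin n, MvPolynomial.esymm (Fin n) ℤ ((i : ℕ) + 1) ^ d i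
  have hT : ∀ d, (T d).IsHomogeneous (∑ i, d i * ((i : ℕ) + 1)) := by
    intro d
    apply MvPolynomial.IsHomogeneous.C_mul
    apply MvPolynomial.IsHomogeneous.prod
    intro i _
    rw [mul_comm]
    exact (hes _).pow _
  have hsum : Q = ∑ d ∈ P.support, T d := by
    rw [← hP, MvPolynomial.aeval_def, MvPolynomial.eval₂_eq']
    rfl
  have hQ2 : Q = ∑ d ∈ P.support.filter (fun d => ∑ i : Fin n, d i * ((i : ℕ) + 1) = w), T d := by
    have h1 := congrArg (MvPolynomial.homogeneousComponent w) hsum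
    rw [MvPolynomial.homogeneousComponent_of_mem hQ, if_pos rfl, map_sum] at h1
    rw [h1, Finset.sum_filter]
    refine Finset.sum_congr rfl fun d _ => ?_
    rw [MvPolynomial.homogeneousComponent_of_mem (hT d)]
    simp only [eq_comm]
  have hEx : MvPolynomial.aeval E P = MvPolynomial.aeval x Q := by
    have hE' : E = fun i : Fin n =>
        MvPolynomial.aeval x (MvPolynomial.esymm (Fin n) ℤ ((i : ℕ) + 1)) := funext hE
    rw [← hP, hE']
    exact (MvPolynomial.comp_aeval_apply _ _ _).symm
  rw [hEx, hQ2, map_sum]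
  refine Finset.sum_congr rfl fun d _ => ?_
  simp [T, hE]

theorem msymm_isHomogeneous (n w : ℕ) (μ : w.Partition) :
    (MvPolynomial.msymm (Fin n) ℤ μ).IsHomogeneous w := by
  apply MvPolynomial.IsHomogeneous.sum
  rintro ⟨s, hs⟩ -
  obtain ⟨s, rfl⟩ := s
  simp only
  clear hs μ
  induction s using Multiset.induction_on with
  | empty => simpa using MvPolynomial.isHomogeneous_one _ _
  | cons a s ih =>
    simp only [Multiset.map_cons, Multiset.prod_cons, Multiset.card_cons]
    rw [add_comm]
    exact (MvPolynomial.isHomogeneous_X _ _).mul ih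

theorem val_M {K : Type*} [Field K] {vK : K → WithTop ℤ} (hvK : IsDiscreteValuationOn vK)
    {n : ℕ} (E : Fin n → K) (hE : ∀ i, 1 ≤ vK (E i)) (d : Fin n →₀ ℕ) (w N : ℕ)
    (hd : ∑ i, d i * ((i : ℕ) + 1) = w) (hw : n * N ≤ w) (hn : 0 < n) (c : ℤ) :
    ((N : ℤ) : WithTop ℤ) ≤ vK ((c : K) * ∏ i, E i ^ d i) := by
  have h1 : ∀ s : Finset (Fin n), (((∑ i ∈ s, d i : ℕ) : ℤ) : WithTop ℤ) ≤ vK (∏ i ∈ s, E i ^ d i) := by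
    intro s
    induction s using Finset.induction_on with
    | empty => simp [hvK.v_one]
    | insert a s ha ih =>
      rw [Finset.sum_insert ha, Finset.prod_insert ha, hvK.map_mul, hvK.v_pow]
      push_cast at *
      refine add_le_add ?_ ih
      have := nsmul_le_nsmul_right (hE a) (d a)
      simpa using this
  rw [hvK.map_mul]
  refine le_trans ?_ (add_le_add (hvK.v_intCast_nonneg c) (h1 Finset.univ))
  rw [zero_add]
  norm_cast
  have h2 : w ≤ n * ∑ i, d i := by
    rw [← hd, Finset.mul_sum]
    refine Finset.sum_le_sum fun i _ => ?_
    rw [mul_comm]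
    exact Nat.mul_le_mul_right _ i.2
  exact Nat.le_of_mul_le_mul_left (hw.trans h2) hn

end Helpers

section Comb

/-- Partitions with `h` parts, all at most `D`. -/
def partsLE (h D : ℕ) : Finset (Σ w : ℕ, { μ : w.Partition // Multiset.card μ.parts = h }) :=
  (Finset.range (h * D + 1)).sigma fun _ => Finset.univ.filter fun μ => ∀ k ∈ μ.1.parts, k ≤ D

theorem mem_partsLE (h D : ℕ) (μ : Σ w : ℕ, { μ : w.Partition // Multiset.card μ.parts = h }) :
    μ ∈ partsLE h D ↔ ∀ k ∈ μ.2.1.parts, k ≤ D := by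
  simp only [partsLE, Finset.mem_sigma, Finset.mem_range, Finset.mem_filter, Finset.mem_univ,
    true_and, and_iff_right_iff_imp]
  intro hk
  have := Multiset.sum_le_card_nsmul _ _ hk
  rw [μ.2.1.parts_sum, μ.2.2, smul_eq_mul] at this
  omega

theorem lt_of_not_mem_partsLE (h D : ℕ)
    (μ : Σ w : ℕ, { μ : w.Partition // Multiset.card μ.parts = h })
    (hμ : μ ∉ partsLE h D) : D < μ.1 := by
  rw [mem_partsLE] at hμ
  push Not at hμ
  obtain ⟨k, hk, hD⟩ := hμ
  have := Multiset.le_sum_of_mem hk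
  rw [μ.2.1.parts_sum] at this
  omega

theorem lhs_expand {n : ℕ} {R : Type*} [CommRing R] (x : Fin n → R) (r : ℕ → R) (hr0 : r 0 = 0)
    (h D : ℕ) :
    (Finset.univ.val.map fun i : Fin n => ∑ k ∈ Finset.range (D + 1), r k * x i ^ k).esymm h =
      ∑ f ∈ (Fintype.piFinset fun _ : Fin n => Finset.range (D + 1)).filter
        (fun f => (Finset.univ.filter fun i => f i ≠ 0).card = h),
        ∏ i, (if f i = 0 then 1 else r (f i) * x i ^ f i) := by
  rw [Finset.esymm_map_val]
  have h1 : ∀ T ∈ Finset.powersetCard h (Finset.univ : Finset (Fin n)),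
      ∏ i ∈ T, ∑ k ∈ Finset.range (D + 1), r k * x i ^ k =
      ∑ f ∈ Fintype.piFinset (fun i => if i ∈ T then Finset.Icc 1 D else {0}),
        ∏ i, (if f i = 0 then 1 else r (f i) * x i ^ f i) := by
    intro T _
    rw [← Finset.prod_univ_sum (fun i => if i ∈ T then Finset.Icc 1 D else {0})
      (fun i k => if k = 0 then 1 else r k * x i ^ k)]
    rw [← Finset.prod_subset (Finset.subset_univ T)]
    · refine Finset.prod_congr rfl fun i hi => ?_
      have hins : Finset.range (D + 1) = insert 0 (Finset.Icc 1 D) := by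
        ext k; simp; omega
      rw [if_pos hi, hins, Finset.sum_insert (by simp), hr0, zero_mul, zero_add]
      refine Finset.sum_congr rfl fun k hk => ?_
      rw [if_neg]
      have := (Finset.mem_Icc.1 hk).1
      omega
    · intro i _ hi
      simp [hi]
  rw [Finset.sum_congr rfl h1, Finset.sum_sigma']
  refine Finset.sum_bij (fun a _ => a.2) ?_ ?_ ?_ ?_
  · rintro ⟨T, f⟩ ha
    simp only [Finset.mem_sigma, Finset.mem_powersetCard, Fintype.mem_piFinset] at ha
    obtain ⟨⟨-, hT⟩, hf⟩ := ha
    simp only [Finset.mem_filter, Fintype.mem_piFinset, Finset.mem_range]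
    refine ⟨fun i => ?_, ?_⟩
    · have := hf i
      split_ifs at this <;> simp at this <;> omega
    · rw [← hT]
      congr 1
      ext i
      have := hf i
      split_ifs at this with hi <;> simp at this <;> simp [hi] <;> omega
  · rintro ⟨T, f⟩ ha ⟨T', f'⟩ ha' hff
    simp only at hff
    subst hff
    simp only [Finset.mem_sigma, Finset.mem_powersetCard, Fintype.mem_piFinset] at ha ha'
    have : T = T' := by
      ext i
      have h1 := ha.2 i
      have h2 := ha'.2 i
      split_ifs at h1 h2 with hi hi' <;> simp at h1 h2 <;> simp [*] <;> omega
    subst this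
    rfl
  · intro f hf
    simp only [Finset.mem_filter, Fintype.mem_piFinset, Finset.mem_range] at hf
    refine ⟨⟨Finset.univ.filter fun i => f i ≠ 0, f⟩, ?_, rfl⟩
    simp only [Finset.mem_sigma, Finset.mem_powersetCard, Fintype.mem_piFinset]
    refine ⟨⟨Finset.subset_univ _, hf.2⟩, fun i => ?_⟩
    have := hf.1 i
    by_cases h0 : f i = 0
    · simp [h0]
    · simp [h0]; omega
  · rintro ⟨T, f⟩ _
    rfl

theorem rhs_expand {n : ℕ} {R : Type*} [CommRing R] (x : Fin n → R) (r : ℕ → R) (h D : ℕ) :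
    ∑ μ ∈ partsLE h D, (μ.2.1.parts.map r).prod *
        MvPolynomial.aeval x (MvPolynomial.msymm (Fin n) ℤ μ.2.1) =
      ∑ f ∈ (Fintype.piFinset fun _ : Fin n => Finset.range (D + 1)).filter
        (fun f => (Finset.univ.filter fun i => f i ≠ 0).card = h),
        ∏ i, (if f i = 0 then 1 else r (f i) * x i ^ f i) := by
  have h1 : ∀ μ ∈ partsLE h D, (μ.2.1.parts.map r).prod *
        MvPolynomial.aeval x (MvPolynomial.msymm (Fin n) ℤ μ.2.1) =
      ∑ s : {a : Sym (Fin n) μ.1 // Nat.Partition.ofSym a = μ.2.1},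
        (μ.2.1.parts.map r).prod * (s.1.1.map x).prod := by
    intro μ _
    rw [MvPolynomial.msymm, map_sum, Finset.mul_sum]
    refine Finset.sum_congr rfl fun s _ => ?_
    rw [map_multiset_prod, Multiset.map_map]
    simp [Function.comp_def]
  have hsupp : ∀ m : Multiset (Fin n),
      (Finset.univ.filter fun i => m.count i ≠ 0) = m.toFinset := by
    intro m; ext i; simp
  rw [Finset.sum_congr rfl h1, Finset.sum_sigma']
  refine Finset.sum_bij (fun a _ i => a.2.1.1.count i) ?_ ?_ ?_ ?_
  · rintro ⟨⟨w, μ, hμ⟩, s⟩ ha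
    change {a : Sym (Fin n) w // Nat.Partition.ofSym a = μ} at s
    obtain ⟨⟨m, hm⟩, rfl⟩ := s
    simp only [Finset.mem_sigma, mem_partsLE, Finset.mem_univ, and_true] at ha
    simp only [Finset.mem_filter, Fintype.mem_piFinset, Finset.mem_range]
    refine ⟨fun i => ?_, ?_⟩
    · by_cases hi : i ∈ m
      · have := ha (m.count i) (by
          simp only [Nat.Partition.ofSym, Multiset.mem_map, Multiset.mem_dedup]
          exact ⟨i, hi, rfl⟩)
        omega
      · simp [hi]
    · rw [hsupp, ← hμ]
      simp [Nat.Partition.ofSym, Multiset.toFinset]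
  · rintro ⟨⟨w, μ, hμ⟩, s⟩ ha ⟨⟨w', μ', hμ'⟩, s'⟩ ha' heq
    change {a : Sym (Fin n) w // Nat.Partition.ofSym a = μ} at s
    change {a : Sym (Fin n) w' // Nat.Partition.ofSym a = μ'} at s'
    obtain ⟨⟨m, hm⟩, rfl⟩ := s
    obtain ⟨⟨m', hm'⟩, rfl⟩ := s'
    simp only at heq
    have hmm : m = m' := by
      ext i; exact congrFun heq i
    subst hmm
    subst hm hm'
    rfl
  · intro f hf
    simp only [Finset.mem_filter, Fintype.mem_piFinset, Finset.mem_range] at hf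
    let m : Multiset (Fin n) := ∑ i, f i • {i}
    have hm : ∀ i, m.count i = f i := by
      intro i
      simp [m, Multiset.count_sum', Multiset.count_singleton]
    let s : Sym (Fin n) (Multiset.card m) := ⟨m, rfl⟩
    refine ⟨⟨⟨Multiset.card m, Nat.Partition.ofSym s, ?_⟩, ⟨s, rfl⟩⟩, ?_, ?_⟩
    · rw [← hf.2]
      simp only [← hm]
      rw [hsupp]
      simp [Nat.Partition.ofSym, Multiset.toFinset, s]
    · simp only [Finset.mem_sigma, mem_partsLE, Finset.mem_univ, and_true]
      intro k hk
      simp only [Nat.Partition.ofSym, Multiset.mem_map, Multiset.mem_dedup, s] at hk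
      obtain ⟨i, _, rfl⟩ := hk
      rw [hm]
      have := hf.1 i
      omega
    · funext i
      exact hm i
  · rintro ⟨⟨w, μ, hμ⟩, s⟩ ha
    change {a : Sym (Fin n) w // Nat.Partition.ofSym a = μ} at s
    obtain ⟨⟨m, hm⟩, rfl⟩ := s
    simp only
    rw [← Finset.prod_subset (Finset.subset_univ m.toFinset)]
    · have : ((Nat.Partition.ofSym (⟨m, hm⟩ : Sym (Fin n) w)).parts.map r).prod =
          ∏ i ∈ m.toFinset, r (m.count i) := by
        simp only [Nat.Partition.ofSym, Multiset.map_map]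
        rfl
      rw [this, Finset.prod_multiset_map_count, ← Finset.prod_mul_distrib]
      refine Finset.prod_congr rfl fun i hi => ?_
      rw [if_neg]
      simpa using hi
    · intro i _ hi
      simp only [Multiset.mem_toFinset] at hi
      simp [hi]

end Comb

/-- **Proposition (spec).**  Let `π_L`, `π̃_L` be uniformizers of the totally ramified
separable extension `L/K` of degree `n`, and let `φ(X) = r_1X + r_2X² + ⋯` be a power
series with coefficients in `O_K` such that `π̃_L = φ(π_L)`.  Then for `1 ≤ h ≤ n`,
`E_h(π̃_L) = Σ_μ r_{μ_1}⋯r_{μ_h}·M_μ(π_L)`, the convergent sum being over all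
partitions `μ = {μ_1, …, μ_h}` with exactly `h` parts.  Here
`M_μ(α) = m_μ(σ_1(α), …, σ_n(α)) = ψ_μ(E_1(α), …, E_n(α))`, where `ψ_μ` is the unique
polynomial with `m_μ = ψ_μ(e_1, …, e_n)` (a family of such `ψ_μ = Ψ w μ` is given). -/
theorem spec_sum {K L : Type*} [Field K] [Field L] [Algebra K L]
    [FiniteDimensional K L] [Algebra.IsSeparable K L]
    (p u ν n : ℕ) (hp : p.Prime) (hu : ¬ p ∣ u) (hn : n = u * p ^ ν)
    (hdim : Module.finrank K L = n)
    (vK : K → WithTop ℤ) (vL : L → WithTop ℤ)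
    (hvK : IsDiscreteValuationOn vK) (hvL : IsDiscreteValuationOn vL)
    (hKcomplete : IsCompleteWrt vK)
    (hres : HasPerfectResidueFieldCharP vK p)
    (htotram : ∀ x : K, vL (algebraMap K L x) = n • vK x)
    (π πt : L) (hπ : vL π = 1) (hπt : vL πt = 1)
    (rc : ℕ → K) (hr0 : rc 0 = 0) (hrint : ∀ i, (0 : WithTop ℤ) ≤ vK (rc i))
    (hphi : HasValSum vL (fun i : ℕ => algebraMap K L (rc i) * π ^ i) πt)
    (Ψ : (w : ℕ) → w.Partition → MvPolynomial (Fin n) ℤ)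
    (hΨ : ∀ (w : ℕ) (μ : w.Partition), Multiset.card μ.parts ≤ n →
      MvPolynomial.aeval (fun i : Fin n => MvPolynomial.esymm (Fin n) ℤ ((i : ℕ) + 1))
          (Ψ w μ) = MvPolynomial.msymm (Fin n) ℤ μ)
    (h : ℕ) (hh1 : 1 ≤ h) (hhn : h ≤ n) :
    HasValSum vK
      (fun μ : Σ w : ℕ, { μ : w.Partition // Multiset.card μ.parts = h } =>
        (μ.2.1.parts.map rc).prod *
          MvPolynomial.aeval (fun i : Fin n => conjE K n ((i : ℕ) + 1) π) (Ψ μ.1 μ.2.1))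
      (conjE K n h πt) := by
  have hn0 : 0 < n := lt_of_lt_of_le hh1 hhn
  have hinf : Infinite K := infinite_of_val hvK
  obtain ⟨b, hb⟩ := exists_basis hn0 hdim hvK hvL htotram hπ
  obtain ⟨σ, hσ⟩ := exists_conj (K := K) (L := L) hdim
  have hchar : ∀ α : L, LinearMap.charpoly (LinearMap.mulLeft K α) =
      (Algebra.leftMulMatrix b α).charpoly := fun α =>
    (LinearMap.charpoly_toMatrix (LinearMap.mulLeft K α) b).symm
  have hint : ∀ α : L, 0 ≤ vL α → ∀ i j, 0 ≤ vK (Algebra.leftMulMatrix b α i j) := by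
    intro α hα i j
    simpa using hb 0 α (by simpa using hα) i j
  have hsign : ∀ k : ℕ, vK ((-1) ^ k) = 0 := by
    intro k; rw [hvK.v_pow, hvK.v_neg_one, smul_zero]
  -- the elementary symmetric functions of `π` are in the maximal ideal
  have hE : ∀ i : Fin n, 1 ≤ vK (conjE K n ((i : ℕ) + 1) π) := by
    intro i
    rw [conjE, hvK.map_mul, hsign, zero_add, hchar]
    apply hvK.charpoly_coeff_nilp _ (hint π (by rw [hπ]; exact zero_le_one)) n
    · intro k l
      rw [← map_pow]
      have := hb 1 (π ^ n) (by rw [hvL.v_pow, hπ]; simp) k l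
      simpa using this
    · have := i.2
      rw [Fintype.card_fin]; omega
  -- continuity of `E_h`
  have hcont : ∀ (N : ℕ) (α β : L), 0 ≤ vL α → 0 ≤ vL β → ((n * N : ℤ) : WithTop ℤ) ≤ vL (α - β) →
      ((N : ℤ) : WithTop ℤ) ≤ vK (conjE K n h α - conjE K n h β) := by
    intro N α β hα hβ hαβ
    rw [conjE, conjE, ← mul_sub, hvK.map_mul, hsign, zero_add, hchar, hchar]
    apply hvK.charpoly_coeff_congr _ _ (hint α hα) (hint β hβ)
    intro i j
    have := hb N (α - β) hαβ i j
    rwa [map_sub] at this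
  -- the conjugates
  let x : Fin n → AlgebraicClosure K := fun i => σ i π
  have hinj : Function.Injective (algebraMap K (AlgebraicClosure K)) :=
    (algebraMap K (AlgebraicClosure K)).injective
  have hEx : ∀ i : Fin n, algebraMap K (AlgebraicClosure K) (conjE K n ((i : ℕ) + 1) π) =
      MvPolynomial.aeval x (MvPolynomial.esymm (Fin n) ℤ ((i : ℕ) + 1)) := by
    intro i
    rw [hσ _ _ i.2, MvPolynomial.aeval_esymm_eq_multiset_esymm]
  have haev : ∀ P : MvPolynomial (Fin n) ℤ, algebraMap K (AlgebraicClosure K)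
      (MvPolynomial.aeval (fun i : Fin n => conjE K n ((i : ℕ) + 1) π) P) =
      MvPolynomial.aeval
        (fun i : Fin n => algebraMap K (AlgebraicClosure K) (conjE K n ((i : ℕ) + 1) π)) P := by
    intro P
    exact MvPolynomial.comp_aeval_apply (fun i : Fin n => conjE K n ((i : ℕ) + 1) π)
      (algebraMap K (AlgebraicClosure K)).toIntAlgHom P
  have hM : ∀ (w : ℕ) (μ : w.Partition), Multiset.card μ.parts = h →
      algebraMap K (AlgebraicClosure K)
        (MvPolynomial.aeval (fun i : Fin n => conjE K n ((i : ℕ) + 1) π) (Ψ w μ)) =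
      MvPolynomial.aeval x (MvPolynomial.msymm (Fin n) ℤ μ) := by
    intro w μ hμ
    rw [haev, ← hΨ w μ (by omega), funext hEx]
    exact (MvPolynomial.comp_aeval_apply _ _ _).symm
  have hMval : ∀ (N w : ℕ) (μ : w.Partition), Multiset.card μ.parts = h → n * N ≤ w →
      ((N : ℤ) : WithTop ℤ) ≤
        vK (MvPolynomial.aeval (fun i : Fin n => conjE K n ((i : ℕ) + 1) π) (Ψ w μ)) := by
    intro N w μ hμ hw
    have h1 := aeval_weight x _ hEx w (Ψ w μ) _ (msymm_isHomogeneous n w μ) (hΨ w μ (by omega))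
    have h2 : MvPolynomial.aeval (fun i : Fin n => conjE K n ((i : ℕ) + 1) π) (Ψ w μ) =
        ∑ d ∈ (Ψ w μ).support.filter (fun d => ∑ i : Fin n, d i * ((i : ℕ) + 1) = w),
          ((MvPolynomial.coeff d (Ψ w μ) : ℤ) : K) *
            ∏ i : Fin n, conjE K n ((i : ℕ) + 1) π ^ d i := by
      apply hinj
      refine (haev _).trans (Eq.trans ?_ (h1.trans ?_))
      · congr!
      · simp
    rw [h2]
    apply hvK.le_sum
    intro d hd
    exact val_M hvK _ hE d w N (Finset.mem_filter.1 hd).2 hw hn0 _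
  -- the formula for truncations
  have htrunc : ∀ D : ℕ, conjE K n h (∑ k ∈ Finset.range (D + 1), algebraMap K L (rc k) * π ^ k) =
      ∑ μ ∈ partsLE h D, (μ.2.1.parts.map rc).prod *
          MvPolynomial.aeval (fun i : Fin n => conjE K n ((i : ℕ) + 1) π) (Ψ μ.1 μ.2.1) := by
    intro D
    apply hinj
    rw [hσ _ _ hhn, map_sum]
    have h1 : ∀ i : Fin n, σ i (∑ k ∈ Finset.range (D + 1), algebraMap K L (rc k) * π ^ k) =
        ∑ k ∈ Finset.range (D + 1), (algebraMap K (AlgebraicClosure K) (rc k)) * x i ^ k := by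
      intro i
      simp [x, map_sum]
    rw [funext h1, lhs_expand x (fun k => algebraMap K (AlgebraicClosure K) (rc k))
      (by simp [hr0]) h D]
    refine (rhs_expand x (fun k => algebraMap K (AlgebraicClosure K) (rc k)) h D).symm.trans ?_
    refine Finset.sum_congr rfl fun μ _ => ?_
    rw [map_mul, hM _ _ μ.2.2, map_multiset_prod, Multiset.map_map]
    rfl
  intro N₀
  let N : ℕ := N₀.toNat
  have hN : (N₀ : WithTop ℤ) ≤ ((N : ℤ) : WithTop ℤ) := by
    norm_cast; exact Int.self_le_toNat N₀
  obtain ⟨s₁, hs₁⟩ := hphi (n * N : ℤ)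
  let D : ℕ := max (n * N) (s₁.sup id)
  refine ⟨partsLE h D, fun s hs => hN.trans ?_⟩
  rw [← Finset.sum_sdiff hs, ← htrunc D, add_sub_assoc]
  apply hvK.le_add
  · apply hvK.le_sum
    intro μ hμ
    have hw := lt_of_not_mem_partsLE h D μ (Finset.mem_sdiff.1 hμ).2
    rw [hvK.map_mul]
    have h1 := hMval N μ.1 μ.2.1 μ.2.2 ((le_max_left _ _).trans hw.le)
    have h2 : 0 ≤ vK (μ.2.1.parts.map rc).prod := by
      apply hvK.prod_nonneg
      intro y hy
      obtain ⟨k, _, rfl⟩ := Multiset.mem_map.1 hy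
      exact hrint k
    simpa using add_le_add h2 h1
  · apply hcont
    · apply hvL.le_sum
      intro k _
      rw [hvL.map_mul, hvL.v_pow, hπ, htotram]
      exact add_nonneg (nsmul_nonneg (hrint k) _) (nsmul_nonneg zero_le_one _)
    · rw [hπt]; exact zero_le_one
    · apply hs₁
      intro k hk
      rw [Finset.mem_range]
      have h1 : k ≤ s₁.sup id := Finset.le_sup (f := id) hk
      have h2 : s₁.sup id ≤ D := le_max_right _ _
      omega

end
end

section
/- Let π_L and π̃_L be uniformizers for L, with minimum polynomials f(X) = X^n − c_1X^{n−1} + ⋯ + (−1)^n c_n and f̃(X) = X^n − c̃_1X^{n−1} + ⋯ + (−1)^n c̃_n over K. Suppose there exist an integer ℓ ≥ 1 and a K-automorphism σ of L such that σ(π̃_L) ≡ π_L (mod M_L^{ℓ+1}). Then for every h with 1 ≤ h ≤ n, one has c̃_h ≡ c_h (mod M_K^{κ_h(ℓ)}), where κ_h(ℓ) = ⌈(φ_ν(ℓ) + h)/n⌉ = ⌈φ_{L/K}(ℓ) + h/n⌉ and φ_{L/K} is the Hasse–Herbrand function of L/K (which satisfies φ_ν(x) = n·φ_{L/K}(x)).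 -/
open scoped Classical

noncomputable section

namespace Kras
open MvPolynomial

abbrev B (n : ℕ) := MvPolynomial (Fin n ⊕ Fin n) ℤ

def Psi (n : ℕ) : B n →ₐ[ℤ] B n :=
  aeval (Sum.elim (fun i : Fin n => rename Sum.inl (esymm (Fin n) ℤ (i + 1)))
    (fun k => X (Sum.inr k)))

def g (n : ℕ) (i : Fin n) : B n :=
  X (Sum.inl i) + ∑ k : Fin n, X (Sum.inr k) * X (Sum.inl i) ^ ((k : ℕ) + 1)

def E (n h : ℕ) : B n := aeval (g n) (esymm (Fin n) ℤ h)

lemma sumAlg_Psi (n : ℕ) (b : B n) :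
    sumAlgEquiv ℤ (Fin n) (Fin n) (Psi n b) =
      (esymmAlgHom (Fin n) (MvPolynomial (Fin n) ℤ) n (sumAlgEquiv ℤ (Fin n) (Fin n) b) :
        symmetricSubalgebra (Fin n) (MvPolynomial (Fin n) ℤ)) := by
  have : ((sumAlgEquiv ℤ (Fin n) (Fin n)).toAlgHom.comp (Psi n)) =
    (((symmetricSubalgebra (Fin n) (MvPolynomial (Fin n) ℤ)).val.comp
      (esymmAlgHom (Fin n) (MvPolynomial (Fin n) ℤ) n)).restrictScalars ℤ).comp
       (sumAlgEquiv ℤ (Fin n) (Fin n)).toAlgHom := by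
    apply MvPolynomial.algHom_ext
    rintro (i | i)
    · simp [Psi, esymmAlgHom_apply, esymm, map_sum, map_prod]
    · simp [Psi, esymmAlgHom_apply]
  exact DFunLike.congr_fun this b

lemma Psi_injective (n : ℕ) : Function.Injective (Psi n) := by
  intro a b hab
  have h := congrArg (sumAlgEquiv ℤ (Fin n) (Fin n)) hab
  rw [sumAlg_Psi, sumAlg_Psi] at h
  exact (sumAlgEquiv ℤ (Fin n) (Fin n)).injective
    ((esymmAlgHom_fin_bijective (MvPolynomial (Fin n) ℤ) n).1 (Subtype.ext h))

lemma E_mem_range (n h : ℕ) : ∃ H : B n, Psi n H = E n h := by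
  have hs : (sumAlgEquiv ℤ (Fin n) (Fin n) (E n h)).IsSymmetric := by
    intro e
    have hg : ∀ i, rename e (sumAlgEquiv ℤ (Fin n) (Fin n) (g n i)) =
        sumAlgEquiv ℤ (Fin n) (Fin n) (g n (e i)) := by
      intro i
      simp [g]
    have h1 : ∀ P : MvPolynomial (Fin n) ℤ,
        rename e (sumAlgEquiv ℤ (Fin n) (Fin n) (aeval (g n) P)) =
        sumAlgEquiv ℤ (Fin n) (Fin n) (aeval (g n) (rename e P)) := by
      intro P
      induction P using MvPolynomial.induction_on with
      | C a => simp
      | add p q hp hq => simp only [map_add, hp, hq]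
      | mul_X p i hp => simp only [map_mul, hp, aeval_X, rename_X, hg]
    rw [E, h1, rename_esymm]
  obtain ⟨b, hb⟩ := (esymmAlgHom_fin_bijective (MvPolynomial (Fin n) ℤ) n).2 ⟨_, hs⟩
  refine ⟨(sumAlgEquiv ℤ (Fin n) (Fin n)).symm b, (sumAlgEquiv ℤ (Fin n) (Fin n)).injective ?_⟩
  rw [sumAlg_Psi, AlgEquiv.apply_symm_apply, hb]

lemma pderiv_Psi (n : ℕ) (k : Fin n) (b : B n) :
    pderiv (Sum.inr k) (Psi n b) = Psi n (pderiv (Sum.inr k) b) := by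
  induction b using MvPolynomial.induction_on with
  | C a => simp [Psi]
  | add p q hp hq => simp only [map_add, hp, hq]
  | mul_X p i hp =>
    have : pderiv (Sum.inr k) (Psi n (X i)) = Psi n (pderiv (Sum.inr k) (X i)) := by
      rcases i with i | i
      · have : pderiv (Sum.inr k : Fin n ⊕ Fin n) (rename Sum.inl (esymm (Fin n) ℤ (i + 1))) = 0 := by
          apply pderiv_eq_zero_of_notMem_vars
          intro hh
          have := vars_rename Sum.inl _ hh
          simp at this
        simp [Psi, this, pderiv_X]
      · simp only [Psi, aeval_X, Sum.elim_inr, pderiv_X, Pi.single_apply]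
        split_ifs <;> simp
    simp only [map_mul, Derivation.leibniz, map_add, hp, this, smul_eq_mul]

def Iq (n q : ℕ) : Ideal (B n) :=
  Ideal.span ({(q : B n)} ∪ {x | ∃ i : Fin n, ¬ q ∣ (i : ℕ) + 1 ∧ x = X (Sum.inl i)})

lemma coeff_of_mem_Iq (n q : ℕ) (f : B n) (hf : f ∈ Iq n q) :
    ∀ s : Fin n ⊕ Fin n →₀ ℕ, (∀ i, s (Sum.inl i) ≠ 0 → q ∣ (i : ℕ) + 1) →
      (q : ℤ) ∣ coeff s f := by
  refine Submodule.span_induction (p := fun f _ => ∀ s : Fin n ⊕ Fin n →₀ ℕ,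
    (∀ i, s (Sum.inl i) ≠ 0 → q ∣ (i : ℕ) + 1) → (q : ℤ) ∣ coeff s f) ?_ ?_ ?_ ?_ hf
  · rintro x (rfl | ⟨i, hi, rfl⟩) s hs
    · have : (q : B n) = C (q : ℤ) := by simp
      rw [this, coeff_C]
      split_ifs <;> simp
    · rw [coeff_X]
      split_ifs with h
      · exact absurd (hs i (by simp [← h])) hi
      · simp
  · simp
  · intro x y _ _ hx hy s hs
    rw [coeff_add]
    exact dvd_add (hx s hs) (hy s hs)
  · intro a x _ hx s hs
    rw [smul_eq_mul, coeff_mul]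
    refine Finset.dvd_sum fun uv huv => Dvd.dvd.mul_left (hx _ fun i hi => hs i ?_) _
    rw [← Finset.HasAntidiagonal.mem_antidiagonal.mp huv]
    simp [hi]

/-- elements of `Psi (I_q)` -/
def J (n q : ℕ) : AddSubgroup (B n) := (Iq n q).toAddSubgroup.map (Psi n).toRingHom.toAddMonoidHom

lemma mem_J {n q : ℕ} {x : B n} : x ∈ J n q ↔ ∃ b ∈ Iq n q, Psi n b = x := Iff.rfl

lemma J_mul {n q : ℕ} (a : B n) {x : B n} (hx : x ∈ J n q) : Psi n a * x ∈ J n q := by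
  obtain ⟨b, hb, rfl⟩ := mem_J.1 hx
  exact mem_J.2 ⟨a * b, Ideal.mul_mem_left _ _ hb, map_mul _ _ _⟩

lemma J_esymm (n k : ℕ) : ∃ b, Psi n b = rename Sum.inl (esymm (Fin n) ℤ k) := by
  rcases Nat.eq_zero_or_pos k with rfl | hk
  · exact ⟨1, by simp⟩
  by_cases hkn : k ≤ n
  · refine ⟨X (Sum.inl ⟨k - 1, by omega⟩), ?_⟩
    simp only [Psi, aeval_X, Sum.elim_inl]
    congr 2
    omega
  · refine ⟨0, ?_⟩
    rw [map_zero, esymm, Finset.powersetCard_eq_empty.2 (by simpa using hkn)]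
    simp

lemma J_kesymm (n q k : ℕ) :
    (k : B n) * rename Sum.inl (esymm (Fin n) ℤ k) ∈ J n q := by
  rcases Nat.eq_zero_or_pos k with rfl | hk
  · simp
  by_cases hq : q ∣ k
  · obtain ⟨b, hb⟩ := J_esymm n k
    obtain ⟨c, rfl⟩ := hq
    refine mem_J.2 ⟨c * b * q, Ideal.mul_mem_left _ _ (Ideal.subset_span (Or.inl rfl)), ?_⟩
    rw [map_mul, map_mul, hb]
    push_cast
    simp only [map_natCast]
    ring
  by_cases hkn : k ≤ n
  · refine mem_J.2 ⟨(k : B n) * X (Sum.inl (⟨k - 1, by omega⟩ : Fin n)),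
      Ideal.mul_mem_left _ _ (Ideal.subset_span (Or.inr ⟨_, ?_, rfl⟩)), ?_⟩
    · simpa [Nat.sub_add_cancel hk] using hq
    simp only [Psi, map_mul, aeval_X, Sum.elim_inl, map_natCast]
    congr 3
    omega
  · rw [esymm, Finset.powersetCard_eq_empty.2 (by simpa using hkn)]
    simp

lemma J_psum (n q : ℕ) (hq : q ∣ n) (k : ℕ) :
    rename Sum.inl (psum (Fin n) ℤ k) ∈ J n q := by
  induction k using Nat.strong_induction_on with
  | _ k ih =>
  rcases Nat.eq_zero_or_pos k with rfl | hk
  · obtain ⟨c, hc⟩ := hq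
    refine mem_J.2 ⟨c * q, Ideal.mul_mem_left _ _ (Ideal.subset_span (Or.inl rfl)), ?_⟩
    rw [psum_zero, Fintype.card_fin]
    have : (n : B n) = c * q := by
      rw [mul_comm]
      exact_mod_cast congrArg (Nat.cast : ℕ → B n) hc
    simp [this]
  rw [psum_eq_mul_esymm_sub_sum _ _ _ hk, map_sub, map_sum]
  refine (J n q).sub_mem ?_ ((J n q).sum_mem fun a ha => ?_)
  · have := J_mul ((-1) ^ (k + 1)) (J_kesymm n q k)
    simpa [mul_assoc] using this
  · simp only [Finset.mem_filter, Finset.HasAntidiagonal.mem_antidiagonal, Set.mem_Ioo] at ha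
    obtain ⟨b, hb⟩ := J_esymm n a.1
    have := J_mul ((-1) ^ a.1 * b) (ih a.2 (by omega))
    simpa [hb] using this

/-- `sum_i w(x_i)` for polynomial `w` with coefficients in `ℤ[y]`. -/
lemma J_sum (n q : ℕ) (hq : q ∣ n) (w : Polynomial (MvPolynomial (Fin n) ℤ)) :
    ∑ i : Fin n, w.eval₂ (rename Sum.inr : MvPolynomial (Fin n) ℤ →ₐ[ℤ] B n).toRingHom
      (X (Sum.inl i)) ∈ J n q := by
  induction w using Polynomial.induction_on' with
  | add p r hp hr =>
    simp only [Polynomial.eval₂_add, Finset.sum_add_distrib]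
    exact (J n q).add_mem hp hr
  | monomial m a =>
    have h1 : Psi n (rename Sum.inr a) = rename Sum.inr a := by
      simp only [Psi, aeval_rename]
      induction a using MvPolynomial.induction_on with
      | C a => simp
      | add p q hp hq => simp only [map_add, hp, hq]
      | mul_X p i hp => simp only [map_mul, hp, aeval_X, rename_X, Function.comp, Sum.elim_inr]
    have := J_mul (rename Sum.inr a) (J_psum n q hq m)
    rw [h1] at this
    simpa [psum, Finset.mul_sum, Polynomial.eval₂_monomial] using this


section es
variable {ι A : Type*} [DecidableEq ι] [CommRing A]

def es (f : ι → A) (s : Finset ι) (h : ℕ) : A := ∑ t ∈ s.powersetCard h, ∏ i ∈ t, f i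

set_option linter.unusedSectionVars false in
@[simp] lemma es_zero (f : ι → A) (s : Finset ι) : es f s 0 = 1 := by simp [es]

lemma es_insert (f : ι → A) (s : Finset ι) (j : ι) (hj : j ∉ s) (h : ℕ) :
    es f (insert j s) (h + 1) = es f s (h + 1) + f j * es f s h := by
  rw [es, Finset.powersetCard_succ_insert hj, Finset.sum_union, Finset.sum_image, es, es,
    Finset.mul_sum]
  · congr 1
    refine Finset.sum_congr rfl fun t ht => ?_
    rw [Finset.prod_insert]
    exact fun h => hj ((Finset.mem_powersetCard.1 ht).1 h)
  · intro t ht t' ht' htt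
    have h1 : j ∉ t := fun h => hj ((Finset.mem_powersetCard.1 ht).1 h)
    have h2 : j ∉ t' := fun h => hj ((Finset.mem_powersetCard.1 ht').1 h)
    rw [← Finset.erase_insert h1, htt, Finset.erase_insert h2]
  · rw [Finset.disjoint_left]
    intro t ht ht'
    obtain ⟨t', _, rfl⟩ := Finset.mem_image.1 ht'
    exact hj ((Finset.mem_powersetCard.1 ht).1 (Finset.mem_insert_self _ _))

lemma es_erase (f : ι → A) (s : Finset ι) (j : ι) (hj : j ∈ s) (h : ℕ) :
    es f s (h + 1) = es f (s.erase j) (h + 1) + f j * es f (s.erase j) h := by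
  rw [← es_insert _ _ _ (Finset.notMem_erase _ _), Finset.insert_erase hj]

lemma deriv_es {R : Type*} [CommRing R] [Algebra R A] (D : Derivation R A A) (f : ι → A) (s : Finset ι) (h : ℕ) :
    D (es f s (h + 1)) = ∑ i ∈ s, D (f i) * es f (s.erase i) h := by
  induction s using Finset.induction_on generalizing h with
  | empty =>
    rw [es, Finset.powersetCard_eq_empty.2 (by simp)]
    simp
  | insert j s hj ih =>
    rw [es_insert _ _ _ hj, map_add, Derivation.leibniz, ih, Finset.sum_insert hj,
      Finset.erase_insert hj]
    have h1 : ∀ i ∈ s, (insert j s).erase i = insert j (s.erase i) := by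
      intro i hi
      rw [Finset.erase_insert_of_ne]
      rintro rfl
      exact hj hi
    have h3 : ∀ i ∈ s, D (f i) * es f ((insert j s).erase i) h =
        D (f i) * es f (insert j (s.erase i)) h := fun i hi => by rw [h1 i hi]
    rw [Finset.sum_congr rfl h3]
    cases h with
    | zero => simp [add_comm]
    | succ h =>
      have h2 : ∀ i ∈ s, D (f i) * es f (insert j (s.erase i)) (h + 1) =
          D (f i) * es f (s.erase i) (h + 1) + f j * (D (f i) * es f (s.erase i) h) := by
        intro i hi
        rw [es_insert _ _ _ (fun hh => hj (Finset.mem_of_mem_erase hh))]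
        ring
      rw [Finset.sum_congr rfl h2, Finset.sum_add_distrib, ← Finset.mul_sum, ih]
      simp only [smul_eq_mul]
      ring

end es

lemma E_eq (n h : ℕ) : E n h = es (g n) Finset.univ h := by
  simp [E, es, esymm, map_sum, map_prod]

lemma J_Q (n q : ℕ) (hq : q ∣ n) (k : Fin n) (h : ℕ) : ∀ a : ℕ,
    ∑ i : Fin n, pderiv (Sum.inr k) (g n i) * g n i ^ a * es (g n) (Finset.univ.erase i) h ∈
      J n q := by
  have hg : ∀ i, pderiv (Sum.inr k) (g n i) = X (Sum.inl i) ^ ((k : ℕ) + 1) := by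
    intro i
    rw [g, map_add, map_sum]
    simp [Derivation.leibniz, pderiv_X, Pi.single_apply, Derivation.leibniz_pow]
  have h0 : ∀ a : ℕ, ∑ i : Fin n, pderiv (Sum.inr k) (g n i) * g n i ^ a ∈ J n q := by
    intro a
    have := J_sum n q hq (Polynomial.X ^ ((k : ℕ) + 1) *
      (Polynomial.X + ∑ k : Fin n, Polynomial.C (X k) * Polynomial.X ^ ((k : ℕ) + 1)) ^ a)
    convert this using 2 with i
    rw [hg]
    simp [g, Polynomial.eval₂_mul, Polynomial.eval₂_pow, Polynomial.eval₂_finsetSum]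
  induction h with
  | zero => simpa using h0
  | succ h ih =>
    intro a
    obtain ⟨b, hb⟩ := E_mem_range n (h + 1)
    have h1 := (J n q).sub_mem (J_mul b (h0 a)) (ih (a + 1))
    convert h1 using 1
    rw [hb, E_eq, Finset.mul_sum, ← Finset.sum_sub_distrib]
    refine Finset.sum_congr rfl fun i _ => ?_
    rw [es_erase _ _ i (Finset.mem_univ i)]
    ring

lemma pderiv_H_mem (n q h : ℕ) (hq : q ∣ n) (k : Fin n) (H : B n) (hH : Psi n H = E n h) :
    pderiv (Sum.inr k) H ∈ Iq n q := by
  have : pderiv (Sum.inr k) (E n h) ∈ J n q := by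
    cases h with
    | zero => simp [E_eq]
    | succ h =>
      rw [E_eq, deriv_es]
      simpa using J_Q n q hq k h 0
  rw [← hH, pderiv_Psi] at this
  obtain ⟨b, hb, hb'⟩ := mem_J.1 this
  rwa [← Psi_injective n hb']

lemma coeff_H (n q h : ℕ) (hq : q ∣ n) (k : Fin n) (H : B n) (hH : Psi n H = E n h)
    (s : Fin n ⊕ Fin n →₀ ℕ) (hs : ∀ i, s (Sum.inl i) ≠ 0 → q ∣ (i : ℕ) + 1) :
    (q : ℤ) ∣ s (Sum.inr k) * coeff s H := by
  rcases Nat.eq_zero_or_pos (s (Sum.inr k)) with h0 | h0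
  · simp [h0]
  have hle : Finsupp.single (Sum.inr k) 1 ≤ s := by
    simpa [Finsupp.single_le_iff] using Nat.succ_le_of_lt h0
  obtain ⟨m, rfl⟩ := exists_add_of_le hle
  have := coeff_of_mem_Iq n q _ (pderiv_H_mem n q h hq k H hH) m (by
    intro i hi
    exact hs i (by simpa using hi))
  rw [coeff_pderiv] at this
  rw [add_comm, mul_comm]
  simpa using this

/-- evaluation of the universal polynomial -/
lemma eval_H {Ω : Type*} [CommRing Ω] (n h : ℕ) (H : B n) (hH : Psi n H = E n h)
    (x a : Fin n → Ω) :
    aeval (Sum.elim (fun i : Fin n => es x Finset.univ ((i : ℕ) + 1)) a) H =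
      es (fun l => x l + ∑ k : Fin n, a k * x l ^ ((k : ℕ) + 1)) Finset.univ h := by
  have h1 : aeval (Sum.elim x a) (Psi n H) =
    aeval (Sum.elim (fun i : Fin n => es x Finset.univ ((i : ℕ) + 1)) a) H := by
    have : (aeval (Sum.elim x a)).comp (Psi n) =
      aeval (R := ℤ) (Sum.elim (fun i : Fin n => es x Finset.univ ((i : ℕ) + 1)) a) := by
      apply MvPolynomial.algHom_ext
      rintro (i | i)
      · simp [Psi, aeval_rename, es, esymm, map_sum, map_prod]
      · simp [Psi]
    exact DFunLike.congr_fun this H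
  rw [← h1, hH, E_eq]
  simp [es, g, map_sum, map_prod]

end Kras

namespace Kras

def toAdd {F : Type*} [Field F] (v : F → WithTop ℤ) (hv : IsDiscreteValuationOn v) :
    AddValuation F (WithTop ℤ) :=
  AddValuation.of v ((hv.eq_top_iff 0).2 rfl)
    (by
      have h := hv.map_mul 1 1
      have h1 : v 1 ≠ ⊤ := fun h => one_ne_zero ((hv.eq_top_iff 1).1 h)
      rw [mul_one] at h
      lift v 1 to ℤ using h1 with a
      norm_cast at h ⊢
      omega)
    hv.min_le_add hv.map_mul

@[simp] lemma toAdd_apply {F : Type*} [Field F] (v : F → WithTop ℤ) (hv : IsDiscreteValuationOn v)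
    (x : F) : toAdd v hv x = v x := rfl

lemma int_nonneg {F : Type*} [Field F] (w : AddValuation F (WithTop ℤ)) (d : ℤ) :
    0 ≤ w (d : F) := by
  have hn : ∀ m : ℕ, 0 ≤ w (m : F) := by
    intro m
    induction m with
    | zero => simp
    | succ m ih =>
      push_cast
      exact w.map_le_add ih (by simp)
  obtain ⟨m, rfl | rfl⟩ := d.eq_nat_or_neg
  · simpa using hn m
  · simpa using hn m

lemma nsmul_top' {m : ℕ} (hm : m ≠ 0) : m • (⊤ : WithTop ℤ) = ⊤ := by
  obtain ⟨k, rfl⟩ := Nat.exists_eq_succ_of_ne_zero hm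
  rw [Nat.succ_eq_add_one, succ_nsmul, add_top]

lemma v_neg {F : Type*} [Field F] {v : F → WithTop ℤ} (hv : IsDiscreteValuationOn v) (x : F) :
    v (-x) = v x := (toAdd v hv).map_neg x

section tot
variable {K L : Type*} [Field K] [Field L] [Algebra K L]
  (n : ℕ) (vK : K → WithTop ℤ) (vL : L → WithTop ℤ)

lemma vL_pow (hvL : IsDiscreteValuationOn vL) (π : L) (hπ : vL π = 1) (k : ℕ) :
    vL (π ^ k) = ((k : ℤ) : WithTop ℤ) := by
  have := (toAdd vL hvL).map_pow π k
  simp only [toAdd_apply, hπ] at this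
  rw [this]
  simp

lemma term_inj (hvK : IsDiscreteValuationOn vK) (hvL : IsDiscreteValuationOn vL)
    (htotram : ∀ x : K, vL (algebraMap K L x) = n • vK x)
    (π : L) (hπ : vL π = 1) (b c : K) (i j : ℕ) (hi : i < n) (hj : j < n)
    (hb : vL (algebraMap K L b * π ^ i) ≠ ⊤)
    (h : vL (algebraMap K L b * π ^ i) = vL (algebraMap K L c * π ^ j)) : i = j := by
  rw [hvL.map_mul, hvL.map_mul, vL_pow _ hvL π hπ, vL_pow _ hvL π hπ, htotram, htotram] at h
  rw [hvL.map_mul, vL_pow _ hvL π hπ, htotram] at hb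
  have hb' : vK b ≠ ⊤ := by
    intro h0
    rw [h0] at hb
    apply hb
    rw [nsmul_top' (by omega)]
    simp
  have hc' : vK c ≠ ⊤ := by
    intro h0
    rw [h0, nsmul_top' (by omega), top_add] at h
    exact hb h
  lift vK b to ℤ using hb' with x
  lift vK c to ℤ using hc' with y
  norm_cast at h
  simp only [nsmul_eq_mul] at h
  have h1 : ((i : ℤ) - j) = n * (y - x) := by linarith
  have h2 : (n : ℤ) ∣ (i : ℤ) - j := ⟨_, h1⟩
  have h3 := Int.eq_zero_of_abs_lt_dvd h2 (by rw [abs_lt]; constructor <;> omega)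
  omega

lemma val_sum (hvK : IsDiscreteValuationOn vK) (hvL : IsDiscreteValuationOn vL)
    (htotram : ∀ x : K, vL (algebraMap K L x) = n • vK x)
    (π : L) (hπ : vL π = 1) (b : Fin n → K) (k : Fin n) :
    vL (∑ i, algebraMap K L (b i) * π ^ (i : ℕ)) ≤ vL (algebraMap K L (b k) * π ^ (k : ℕ)) := by
  obtain ⟨k0, -, hk0⟩ := Finset.exists_min_image Finset.univ
    (fun i : Fin n => vL (algebraMap K L (b i) * π ^ (i : ℕ))) ⟨k, Finset.mem_univ _⟩
  by_cases htop : vL (algebraMap K L (b k0) * π ^ (k0 : ℕ)) = ⊤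
  · have := hk0 k (Finset.mem_univ _)
    rw [htop, top_le_iff] at this
    rw [this]
    exact le_top
  have hlt : vL (algebraMap K L (b k0) * π ^ (k0 : ℕ)) <
      toAdd vL hvL (∑ i ∈ Finset.univ.erase k0, algebraMap K L (b i) * π ^ (i : ℕ)) := by
    refine (toAdd vL hvL).map_lt_sum htop ?_
    intro i hi
    refine lt_of_le_of_ne (hk0 i (Finset.mem_univ _)) fun heq => Finset.ne_of_mem_erase hi ?_
    exact Fin.ext (term_inj n vK vL hvK hvL htotram π hπ _ _ _ _ k0.2 i.2 htop heq).symm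
  have h2 := (toAdd vL hvL).map_add_eq_of_lt_left hlt
  rw [Finset.add_sum_erase Finset.univ (fun i : Fin n => algebraMap K L (b i) * π ^ (i : ℕ)) (Finset.mem_univ k0)] at h2
  simp only [toAdd_apply] at h2
  rw [h2]
  exact hk0 k (Finset.mem_univ _)

lemma linInd (hvK : IsDiscreteValuationOn vK) (hvL : IsDiscreteValuationOn vL)
    (htotram : ∀ x : K, vL (algebraMap K L x) = n • vK x)
    (π : L) (hπ : vL π = 1) : LinearIndependent K (fun i : Fin n => π ^ (i : ℕ)) := by
  rw [Fintype.linearIndependent_iff]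
  intro b hb i
  have h := val_sum n vK vL hvK hvL htotram π hπ b i
  simp only [Algebra.smul_def] at hb
  rw [hb, (hvL.eq_top_iff 0).2 rfl, top_le_iff, hvL.eq_top_iff] at h
  have hπ0 : π ≠ 0 := by
    rintro rfl
    rw [(hvL.eq_top_iff 0).2 rfl] at hπ
    exact WithTop.top_ne_one hπ
  rcases mul_eq_zero.1 h with h | h
  · simpa using h
  · exact absurd h (pow_ne_zero _ hπ0)

variable [FiniteDimensional K L]

lemma natDegree_minpoly (hvK : IsDiscreteValuationOn vK) (hvL : IsDiscreteValuationOn vL)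
    (htotram : ∀ x : K, vL (algebraMap K L x) = n • vK x)
    (hdim : Module.finrank K L = n) (π : L) (hπ : vL π = 1) : (minpoly K π).natDegree = n := by
  refine le_antisymm (hdim ▸ minpoly.natDegree_le π) ?_
  by_contra hlt
  push Not at hlt
  have h0 := minpoly.aeval K π
  rw [Polynomial.aeval_eq_sum_range' hlt, Finset.sum_range] at h0
  have h1 := Fintype.linearIndependent_iff.1 (linInd n vK vL hvK hvL htotram π hπ) _ h0
    ⟨_, hlt⟩
  exact minpoly.ne_zero (IsIntegral.of_finite K π) (Polynomial.leadingCoeff_eq_zero.1 h1)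

lemma exists_expansion (hvK : IsDiscreteValuationOn vK) (hvL : IsDiscreteValuationOn vL)
    (htotram : ∀ x : K, vL (algebraMap K L x) = n • vK x)
    (hdim : Module.finrank K L = n) (hn : 0 < n) (π : L) (hπ : vL π = 1) (x : L) :
    ∃ b : Fin n → K, x = ∑ i, algebraMap K L (b i) * π ^ (i : ℕ) := by
  haveI : Nonempty (Fin n) := ⟨⟨0, hn⟩⟩
  let bs := basisOfLinearIndependentOfCardEqFinrank (linInd n vK vL hvK hvL htotram π hπ)
    (by simp [hdim])
  refine ⟨fun i => bs.repr x i, ?_⟩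
  conv_lhs => rw [← bs.sum_repr x]
  simp [bs, Algebra.smul_def]

lemma minpoly_sum (hvK : IsDiscreteValuationOn vK) (hvL : IsDiscreteValuationOn vL)
    (htotram : ∀ x : K, vL (algebraMap K L x) = n • vK x)
    (hdim : Module.finrank K L = n) (π : L) (hπ : vL π = 1) :
    vL (∑ i : Fin n, algebraMap K L ((minpoly K π).coeff i) * π ^ (i : ℕ)) =
      ((n : ℤ) : WithTop ℤ) := by
  have hd := natDegree_minpoly n vK vL hvK hvL htotram hdim π hπ
  have h0 := minpoly.aeval K π
  have hm : (minpoly K π).coeff n = 1 := by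
    have := minpoly.monic (IsIntegral.of_finite K π)
    rw [Polynomial.Monic, Polynomial.leadingCoeff, hd] at this
    exact this
  rw [Polynomial.aeval_eq_sum_range, hd, Finset.sum_range_succ, hm, Finset.sum_range, one_smul] at h0
  simp only [Algebra.smul_def] at h0
  rw [eq_neg_of_add_eq_zero_left h0]
  have := (toAdd vL hvL).map_neg (π ^ n)
  simp only [toAdd_apply] at this
  rw [this, vL_pow _ hvL π hπ]

lemma eis_le (hvK : IsDiscreteValuationOn vK) (hvL : IsDiscreteValuationOn vL)
    (htotram : ∀ x : K, vL (algebraMap K L x) = n • vK x)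
    (hdim : Module.finrank K L = n) (π : L) (hπ : vL π = 1) (h : ℕ) (h1 : 1 ≤ h) (hh : h ≤ n) :
    ((h : ℤ) : WithTop ℤ) ≤ vL (algebraMap K L (minpolyCoeff K n π h)) := by
  have := val_sum n vK vL hvK hvL htotram π hπ (fun i => (minpoly K π).coeff i) ⟨n - h, by omega⟩
  rw [minpoly_sum n vK vL hvK hvL htotram hdim π hπ, hvL.map_mul, vL_pow _ hvL π hπ] at this
  have h2 : vL (algebraMap K L (minpolyCoeff K n π h)) =
      vL (algebraMap K L ((minpoly K π).coeff (n - h))) := by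
    rw [minpolyCoeff]
    rcases neg_one_pow_eq_or K h with h | h
    · simp [h]
    · simp [h, v_neg hvL]
  rw [h2]
  simp only at this
  cases hx : vL (algebraMap K L ((minpoly K π).coeff (n - h))) with
  | top => exact le_top
  | coe a =>
    rw [hx] at this
    norm_cast at this ⊢
    omega

lemma eis_eq (hvK : IsDiscreteValuationOn vK) (hvL : IsDiscreteValuationOn vL)
    (htotram : ∀ x : K, vL (algebraMap K L x) = n • vK x)
    (hdim : Module.finrank K L = n) (hn : 0 < n) (π : L) (hπ : vL π = 1) :
    vL (algebraMap K L (minpolyCoeff K n π n)) ≤ ((n : ℤ) : WithTop ℤ) := by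
  have h2 : vL (algebraMap K L (minpolyCoeff K n π n)) =
      vL (algebraMap K L ((minpoly K π).coeff 0) * π ^ 0) := by
    rw [minpolyCoeff, pow_zero, mul_one, Nat.sub_self]
    rcases neg_one_pow_eq_or K n with h | h
    · simp [h]
    · simp [h, v_neg hvL]
  rw [h2]
  by_contra hlt
  push Not at hlt
  have hs := minpoly_sum n vK vL hvK hvL htotram hdim π hπ
  have : ((n : ℤ) : WithTop ℤ) <
      toAdd vL hvL (∑ i : Fin n, algebraMap K L ((minpoly K π).coeff i) * π ^ (i : ℕ)) := by
    refine (toAdd vL hvL).map_lt_sum (by simp) ?_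
    intro i _
    by_cases hi : (i : ℕ) = 0
    · rw [hi]
      exact hlt
    · have h3 := val_sum n vK vL hvK hvL htotram π hπ (fun i => (minpoly K π).coeff i) i
      rw [hs] at h3
      refine lt_of_le_of_ne h3 fun heq => ?_
      rw [toAdd_apply, hvL.map_mul, htotram, vL_pow _ hvL π hπ] at heq
      cases hx : vK ((minpoly K π).coeff i) with
      | top =>
        rw [hx, nsmul_top' (by omega), top_add] at heq
        exact WithTop.coe_ne_top heq
      | coe a =>
        rw [hx] at heq
        norm_cast at heq
        rw [nsmul_eq_mul] at heq
        have h4 : (n : ℤ) ∣ i := ⟨1 - a, by push_cast at heq ⊢; linarith⟩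
        have h5 := Nat.le_of_dvd (by omega) (Int.natCast_dvd_natCast.1 h4)
        have := i.2
        omega
  rw [toAdd_apply, hs] at this
  exact lt_irrefl _ this

end tot

section conj
variable {K L : Type*} [Field K] [Field L] [Algebra K L] [FiniteDimensional K L]
  [Algebra.IsSeparable K L]

lemma conj_es {Ω : Type*} [Field Ω] [Algebra K Ω] [IsAlgClosed Ω] (n : ℕ)
    (e : Fin n ≃ (L →ₐ[K] Ω)) (hdim : Module.finrank K L = n) (θ : L)
    (hθ : (minpoly K θ).natDegree = n) (h : ℕ) (hh : h ≤ n) :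
    algebraMap K Ω (minpolyCoeff K n θ h) = es (fun l => e l θ) Finset.univ h := by
  have hprim : IntermediateField.adjoin K {θ} = ⊤ := by
    rw [Field.primitive_element_iff_minpoly_natDegree_eq, hθ, hdim]
  have hinj : Function.Injective (fun l => e l θ) := by
    intro a b hab
    apply e.injective
    exact (Field.primitive_element_iff_algHom_eq_of_eval K Ω (fun _ => IsAlgClosed.splits _) θ (e a)).1 hprim (e b) hab
  have hint : IsIntegral K θ := IsIntegral.of_finite K θ
  have hroots : ((minpoly K θ).map (algebraMap K Ω)).roots =
      Finset.univ.val.map (fun l => e l θ) := by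
    symm
    refine Multiset.eq_of_le_of_card_le ?_ ?_
    · rw [Multiset.le_iff_subset (Multiset.Nodup.map hinj Finset.univ.nodup)]
      intro x hx
      obtain ⟨l, _, rfl⟩ := Multiset.mem_map.1 hx
      rw [Polynomial.mem_roots (Polynomial.map_ne_zero (minpoly.ne_zero hint)),
        Polynomial.IsRoot, Polynomial.eval_map_algebraMap]
      exact minpoly.aeval_algHom K (e l) θ
    · refine (Polynomial.card_roots' _).trans ?_
      simp [hθ]
  have hcard : ((minpoly K θ).map (algebraMap K Ω)).roots.card =
      ((minpoly K θ).map (algebraMap K Ω)).natDegree := by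
    rw [hroots]; simp [hθ]
  have := Polynomial.coeff_eq_esymm_roots_of_card hcard (k := n - h) (by simp [hθ])
  rw [hroots, Polynomial.coeff_map, Polynomial.natDegree_map, hθ, Polynomial.leadingCoeff_map,
    (minpoly.monic hint).leadingCoeff, map_one, one_mul, Nat.sub_sub_self hh,
    Finset.esymm_map_val] at this
  rw [minpolyCoeff, map_mul, this, ← mul_assoc, map_pow, map_neg, map_one, ← mul_pow]
  simp [es]

lemma es_smul {ι A : Type*} [CommRing A] (c : A) (f : ι → A) (s : Finset ι) (h : ℕ) :
    es (fun i => c * f i) s h = c ^ h * es f s h := by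
  rw [es, es, Finset.mul_sum]
  refine Finset.sum_congr rfl fun t ht => ?_
  rw [Finset.prod_mul_distrib, Finset.prod_const, (Finset.mem_powersetCard.1 ht).2]

end conj
end Kras

namespace Kras
open MvPolynomial

lemma prod_nonneg {L ι : Type*} [Field L] [Fintype ι] (w : AddValuation L (WithTop ℤ)) (f : ι → L)
    (m : ι → ℕ) (hf : ∀ i, 0 ≤ w (f i)) (s : Finset ι) : 0 ≤ w (∏ i ∈ s, f i ^ m i) := by
  induction s using Finset.induction_on with
  | empty => simp
  | insert j s hj ih =>
    rw [Finset.prod_insert hj, w.map_mul, w.map_pow]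
    exact add_nonneg (nsmul_nonneg (hf j) _) ih

lemma prod_ge {L ι : Type*} [Field L] [Fintype ι] (w : AddValuation L (WithTop ℤ)) (f : ι → L)
    (m : ι → ℕ) (hf : ∀ i, 0 ≤ w (f i)) (i : ι) : m i • w (f i) ≤ w (∏ i, f i ^ m i) := by
  rw [← Finset.mul_prod_erase Finset.univ _ (Finset.mem_univ i), w.map_mul, w.map_pow]
  exact le_add_of_nonneg_right (prod_nonneg w f m hf _)

lemma dvd_arith {p : ℕ} (hp : p.Prime) {ν j' m : ℕ} {d : ℤ} (hj' : j' ≤ ν) (hm : m ≠ 0)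
    (h : ((p ^ j' : ℕ) : ℤ) ∣ m * d) : ((p ^ (j' - vbar p ν m) : ℕ) : ℤ) ∣ d := by
  haveI := Fact.mk hp
  by_cases hle : j' ≤ vbar p ν m
  · simp [Nat.sub_eq_zero_of_le hle]
  push Not at hle
  have hv : vbar p ν m = padicValNat p m := by
    unfold vbar at hle ⊢
    omega
  rw [hv] at hle ⊢
  obtain ⟨t, ht, hm'⟩ : ∃ t, ¬ p ∣ t ∧ m = p ^ padicValNat p m * t := by
    obtain ⟨t, ht⟩ := pow_padicValNat_dvd (p := p) (n := m)
    refine ⟨t, fun ⟨r, hr⟩ => ?_, ht⟩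
    apply pow_succ_padicValNat_not_dvd (p := p) hm
    refine ⟨r, ?_⟩
    rw [pow_succ, mul_assoc, ← hr]
    exact ht
  generalize padicValNat p m = j at *
  obtain ⟨r, rfl⟩ := Nat.exists_eq_add_of_le hle.le
  rw [Nat.add_sub_cancel_left]
  rw [hm', pow_add, Nat.cast_mul, Nat.cast_mul, mul_assoc] at h
  have h2 := Int.dvd_of_mul_dvd_mul_left (by exact_mod_cast (pow_pos hp.pos j).ne') h
  refine IsCoprime.dvd_of_dvd_mul_left ?_ h2
  rw [Nat.isCoprime_iff_coprime]
  exact Nat.Coprime.pow_left _ ((Nat.Prime.coprime_iff_not_dvd hp).2 ht)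

lemma mono_bound {K L : Type*} [Field K] [Field L] (p ν n ℓ h : ℕ) (hp : p.Prime)
    (hn : 0 < n) (hpn : p ^ ν ∣ n) (vK : K → WithTop ℤ) (w : AddValuation L (WithTop ℤ))
    (c : ℕ → K) (c' a' : Fin n → L)
    (hc : ∀ i : Fin n, w (c' i) =
      (vK (c ((i : ℕ) + 1))).map fun a => (n : ℤ) * a - (((i : ℕ) + 1 : ℕ) : ℤ))
    (hc0 : ∀ i, 0 ≤ w (c' i)) (hcn : iPi vK p ν n c ν ≤ 0)
    (ha : ∀ k, ((ℓ : ℤ) : WithTop ℤ) ≤ w (a' k))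
    (H : B n) (hH : Psi n H = E n h) (s : Fin n ⊕ Fin n →₀ ℕ) (k0 : Fin n)
    (hk0 : s (Sum.inr k0) ≠ 0) :
    phiIdx vK p ν n (w (p : L)) c ν ℓ ≤
      w (((coeff s H : ℤ) : L) * ((∏ i, c' i ^ s (Sum.inl i)) * ∏ k, a' k ^ s (Sum.inr k))) := by
  set m := s (Sum.inr k0) with hm
  set j := vbar p ν m with hj
  have hjν : j ≤ ν := min_le_right _ _
  have ha0 : ∀ k, 0 ≤ w (a' k) := fun k => le_trans (by exact_mod_cast Nat.zero_le ℓ) (ha k)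
  -- the a part
  have hA : (((p ^ j * ℓ : ℕ) : ℤ) : WithTop ℤ) ≤ w (∏ k, a' k ^ s (Sum.inr k)) := by
    refine le_trans ?_ (prod_ge w a' (fun k => s (Sum.inr k)) ha0 k0)
    refine le_trans ?_ (nsmul_le_nsmul_right (ha k0) _)
    have hpm : p ^ j ≤ m := by
      refine Nat.le_of_dvd (Nat.pos_of_ne_zero hk0) ?_
      exact (pow_dvd_pow p (min_le_left _ _)).trans pow_padicValNat_dvd
    rw [← WithTop.coe_nsmul, WithTop.coe_le_coe, nsmul_eq_mul]
    exact_mod_cast Nat.mul_le_mul_right ℓ hpm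
  -- choice of the exponent
  obtain ⟨j', hj'ν, hdiv, hC⟩ : ∃ j' ≤ ν, (∀ i : Fin n, s (Sum.inl i) ≠ 0 → p ^ j' ∣ (i : ℕ) + 1) ∧
      iPi vK p ν n c (max j j') ≤ w (∏ i, c' i ^ s (Sum.inl i)) := by
    by_cases hemp : ∃ i : Fin n, s (Sum.inl i) ≠ 0
    · obtain ⟨i1, hi1⟩ := hemp
      obtain ⟨i0, hi0, hmin⟩ := Finset.exists_min_image
        (Finset.univ.filter fun i : Fin n => s (Sum.inl i) ≠ 0)
        (fun i => vbar p ν ((i : ℕ) + 1)) ⟨i1, by simp [hi1]⟩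
      have hi0' : s (Sum.inl i0) ≠ 0 := (Finset.mem_filter.1 hi0).2
      refine ⟨vbar p ν ((i0 : ℕ) + 1), min_le_right _ _, fun i hi => ?_, ?_⟩
      · refine (pow_dvd_pow p ((hmin i (by simp [hi])).trans (min_le_left _ _))).trans
          pow_padicValNat_dvd
      · refine le_trans ?_ (prod_ge w c' (fun i => s (Sum.inl i)) hc0 i0)
        have h1 : iPi vK p ν n c (max j (vbar p ν ((i0 : ℕ) + 1))) ≤ w (c' i0) := by
          rw [hc, iPi]
          exact Finset.inf_le (f := fun h : ℕ => (vK (c h)).map fun a => (n : ℤ) * a - (h : ℤ))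
            (Finset.mem_filter.2 ⟨Finset.mem_Icc.2 ⟨by omega, i0.2⟩, le_max_right _ _⟩)
        refine h1.trans ?_
        obtain ⟨r, hr⟩ := Nat.exists_eq_succ_of_ne_zero hi0'
        rw [hr, Nat.succ_eq_add_one, succ_nsmul]
        exact le_add_of_nonneg_left (nsmul_nonneg (hc0 _) _)
    · push Not at hemp
      refine ⟨ν, le_rfl, fun i hi => absurd (hemp i) hi, ?_⟩
      rw [max_eq_right hjν]
      simpa [hemp] using hcn
  have hd : (max j j' - j) • w (p : L) ≤ w ((coeff s H : ℤ) : L) := by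
    have h1 := coeff_H n (p ^ j') h ((pow_dvd_pow p hj'ν).trans hpn) k0 H hH s hdiv
    obtain ⟨r, hr⟩ := dvd_arith hp hj'ν hk0 h1
    have h2 : max j j' - j = j' - j := by omega
    rw [h2, hr, Int.cast_mul, w.map_mul]
    push_cast
    rw [w.map_pow]
    exact le_add_of_nonneg_right (int_nonneg w r)
  calc phiIdx vK p ν n (w (p : L)) c ν ℓ ≤ phiTilde vK p ν n (w (p : L)) c j ℓ :=
        Finset.inf_le (Finset.mem_Icc.2 ⟨Nat.zero_le _, hjν⟩)
    _ ≤ (iPi vK p ν n c (max j j') + (max j j' - j) • w (p : L)) +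
          (((p ^ j * ℓ : ℕ) : ℤ) : WithTop ℤ) := by
        refine add_le_add ?_ le_rfl
        exact Finset.inf_le (f := fun j' => iPi vK p ν n c j' + (j' - j) • w (p : L))
          (Finset.mem_Icc.2 ⟨le_max_left _ _, max_le hjν hj'ν⟩)
    _ ≤ _ := by
        rw [w.map_mul, w.map_mul, ← add_assoc]
        refine add_le_add ?_ hA
        rw [add_comm (w _)]
        exact add_le_add hC hd

lemma diff_bound {L : Type*} [Field L] (n : ℕ) (w : AddValuation L (WithTop ℤ)) (φ : WithTop ℤ)
    (c' a' : Fin n → L) (H : B n)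
    (hb : ∀ (s : Fin n ⊕ Fin n →₀ ℕ) (k0 : Fin n), s (Sum.inr k0) ≠ 0 → φ ≤
      w (((coeff s H : ℤ) : L) * ((∏ i, c' i ^ s (Sum.inl i)) * ∏ k, a' k ^ s (Sum.inr k)))) :
    φ ≤ w (aeval (Sum.elim c' a') H - aeval (Sum.elim c' (fun _ => 0)) H) := by
  rw [aeval_def, aeval_def, eval₂_eq', eval₂_eq', ← Finset.sum_sub_distrib]
  refine w.map_le_sum fun s _ => ?_
  simp only [Fintype.prod_sum_type, Sum.elim_inl, Sum.elim_inr, eq_intCast]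
  by_cases hs : ∃ k0, s (Sum.inr k0) ≠ 0
  · obtain ⟨k0, hk0⟩ := hs
    have : ∏ x : Fin n, (0 : L) ^ s (Sum.inr x) = 0 :=
      Finset.prod_eq_zero (Finset.mem_univ k0) (zero_pow hk0)
    rw [this, mul_zero, mul_zero, sub_zero]
    exact hb s k0 hk0
  · push Not at hs
    simp [hs]

end Kras


namespace Kras

lemma hom_aeval {R S τ : Type*} [CommRing R] [CommRing S] (f : R →+* S) (v : τ → R)
    (P : MvPolynomial τ ℤ) :
    f (MvPolynomial.aeval v P) = MvPolynomial.aeval (fun i => f (v i)) P := by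
  induction P using MvPolynomial.induction_on with
  | C a => simp
  | add p q hp hq => simp only [map_add, hp, hq]
  | mul_X p i hp => simp only [map_mul, hp, MvPolynomial.aeval_X]

lemma iPi_nonpos {K : Type*} [Field K] (vK : K → WithTop ℤ) (p ν n : ℕ) (hn0 : 0 < n)
    (c : ℕ → K) (h2 : n • vK (c n) ≤ ((n : ℤ) : WithTop ℤ)) : iPi vK p ν n c ν ≤ 0 := by
  have hmem : n ∈ (Finset.Icc 1 n).filter fun h => vbar p ν h ≤ ν := by
    rw [Finset.mem_filter, Finset.mem_Icc]
    exact ⟨⟨hn0, le_rfl⟩, min_le_right _ _⟩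
  have h1 : iPi vK p ν n c ν ≤ (vK (c n)).map fun a => (n : ℤ) * a - (n : ℤ) := by
    unfold iPi
    exact Finset.inf_le (f := fun h : ℕ => (vK (c h)).map fun a => (n : ℤ) * a - (h : ℤ)) hmem
  refine h1.trans ?_
  cases hz : vK (c n) with
  | top =>
    rw [hz, Kras.nsmul_top' (by omega)] at h2
    exact absurd (top_le_iff.1 h2) WithTop.coe_ne_top
  | coe z =>
    rw [hz, ← WithTop.coe_nsmul, WithTop.coe_le_coe, nsmul_eq_mul] at h2
    rw [WithTop.map_coe]
    exact_mod_cast (by linarith : (n : ℤ) * z - n ≤ 0)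

end Kras

set_option maxHeartbeats 2000000 in
/-- **Krasner's congruence.**  Let `π_L`, `π̃_L` be uniformizers of the totally ramified
separable extension `L/K` of degree `n = u·p^ν`, with minimal polynomials
`f(X) = X^n - c_1 X^{n-1} + ⋯ + (-1)^n c_n` and
`f̃(X) = X^n - c̃_1 X^{n-1} + ⋯ + (-1)^n c̃_n` over `K`.  If there are `ℓ ≥ 1` and a
`K`-automorphism `σ` of `L` with `σ(π̃_L) ≡ π_L (mod M_L^{ℓ+1})`, then for all
`1 ≤ h ≤ n` one has `c̃_h ≡ c_h (mod M_K^{κ_h(ℓ)})`, where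
`κ_h(ℓ) = ⌈(φ_ν(ℓ) + h)/n⌉ = ⌈φ_{L/K}(ℓ) + h/n⌉` (here `φ_ν = n·φ_{L/K}`, with
`φ_{L/K}` the Hasse–Herbrand function of `L/K`). -/
theorem krasner_congruence {K L : Type*} [Field K] [Field L] [Algebra K L]
    [FiniteDimensional K L] [Algebra.IsSeparable K L]
    (p u ν n : ℕ) (hp : p.Prime) (hu : ¬ p ∣ u) (hn : n = u * p ^ ν)
    (hdim : Module.finrank K L = n)
    (vK : K → WithTop ℤ) (vL : L → WithTop ℤ)
    (hvK : IsDiscreteValuationOn vK) (hvL : IsDiscreteValuationOn vL)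
    (hKcomplete : IsCompleteWrt vK)
    (hres : HasPerfectResidueFieldCharP vK p)
    (htotram : ∀ x : K, vL (algebraMap K L x) = n • vK x)
    (π πt : L) (hπ : vL π = 1) (hπt : vL πt = 1)
    (ℓ : ℕ) (hℓ : 1 ≤ ℓ) (σ : L ≃ₐ[K] L)
    (hcong : (((ℓ + 1 : ℕ) : ℤ) : WithTop ℤ) ≤ vL (σ πt - π))
    (h : ℕ) (hh1 : 1 ≤ h) (hhn : h ≤ n) :
    ((phiIdx vK p ν n (vL (p : L)) (minpolyCoeff K n π) ν ℓ).map
        fun a : ℤ => (⌈((a : ℚ) + (h : ℚ)) / (n : ℚ)⌉ : ℤ)) ≤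
      vK (minpolyCoeff K n πt h - minpolyCoeff K n π h) := by
  have hn0 : 0 < n := by omega
  set c := minpolyCoeff K n π with hcdef
  set w := Kras.toAdd vL hvL with hw
  have hwv : ∀ x, w x = vL x := fun x => rfl
  have hπ0 : π ≠ 0 := by
    rintro rfl
    rw [(hvL.eq_top_iff 0).2 rfl] at hπ
    exact WithTop.top_ne_one hπ
  -- the conjugate uniformizer
  have hminp : minpoly K (σ πt) = minpoly K πt := minpoly.algEquiv_eq σ πt
  have hct : minpolyCoeff K n πt h = minpolyCoeff K n (σ πt) h := by
    rw [minpolyCoeff, minpolyCoeff, hminp]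
  set θ := σ πt with hθdef
  have hθ : vL θ = 1 := by
    have h1 : w π < w (θ - π) := by
      rw [hwv, hwv, hπ]
      refine lt_of_lt_of_le ?_ hcong
      exact_mod_cast (by omega : 1 < ℓ + 1)
    have h2 := w.map_add_eq_of_lt_left h1
    rw [add_sub_cancel, hwv, hwv, hπ] at h2
    exact h2
  -- expansion of the difference
  obtain ⟨b, hb⟩ := Kras.exists_expansion n vK vL hvK hvL htotram hdim hn0 π hπ ((θ - π) / π)
  have hbℓ : ∀ k : Fin n, ((ℓ : ℤ) : WithTop ℤ) ≤ w (algebraMap K L (b k) * π ^ (k : ℕ)) := by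
    intro k
    refine le_trans ?_ (Kras.val_sum n vK vL hvK hvL htotram π hπ b k)
    rw [← hb]
    have h1 : vL (θ - π) = vL ((θ - π) / π) + vL π := by
      rw [← hvL.map_mul, div_mul_cancel₀ _ hπ0]
    rw [h1, hπ] at hcong
    cases hx : vL ((θ - π) / π) with
    | top => exact le_top
    | coe a =>
      rw [hx] at hcong
      norm_cast at hcong ⊢
      push_cast at hcong
      omega
  have hθexp : θ = π + ∑ k : Fin n, algebraMap K L (b k) * π ^ ((k : ℕ) + 1) := by
    have h1 : θ - π = ((θ - π) / π) * π := (div_mul_cancel₀ _ hπ0).symm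
    rw [hb, Finset.sum_mul] at h1
    rw [← sub_eq_iff_eq_add', h1]
    exact Finset.sum_congr rfl fun k _ => by ring
  set a' : Fin n → L := fun k => algebraMap K L (b k) * π ^ (k : ℕ) with ha'
  set c' : Fin n → L := fun i => algebraMap K L (c ((i : ℕ) + 1)) / π ^ ((i : ℕ) + 1) with hc'
  obtain ⟨H, hH⟩ := Kras.E_mem_range n h
  -- identities
  let Ω := AlgebraicClosure L
  have hcard : Fintype.card (L →ₐ[K] Ω) = n := by rw [AlgHom.card, hdim]
  let e : Fin n ≃ (L →ₐ[K] Ω) := (Fintype.equivFinOfCardEq hcard).symm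
  have hdegπ := Kras.natDegree_minpoly n vK vL hvK hvL htotram hdim π hπ
  have hdegθ := Kras.natDegree_minpoly n vK vL hvK hvL htotram hdim θ hθ
  let x : Fin n → Ω := fun l => e l π / algebraMap L Ω π
  have hπΩ : algebraMap L Ω π ≠ 0 := by simpa using hπ0
  have hx : ∀ l, e l π = algebraMap L Ω π * x l := fun l => (mul_div_cancel₀ _ hπΩ).symm
  have hcx : ∀ i : Fin n, algebraMap L Ω (c' i) = Kras.es x Finset.univ ((i : ℕ) + 1) := by
    intro i
    have h1 := Kras.conj_es (Ω := Ω) n e hdim π hdegπ ((i : ℕ) + 1) i.2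
    simp only [hx] at h1
    rw [Kras.es_smul] at h1
    simp only [hc', map_div₀, map_pow]
    rw [← IsScalarTower.algebraMap_apply, h1, mul_div_cancel_left₀ _ (pow_ne_zero _ hπΩ)]
  have heval : ∀ a : Fin n → L, algebraMap L Ω (MvPolynomial.aeval (Sum.elim c' a) H) =
      Kras.es (fun l => x l + ∑ k : Fin n, algebraMap L Ω (a k) * x l ^ ((k : ℕ) + 1))
        Finset.univ h := by
    intro a
    rw [← Kras.eval_H n h H hH x (fun k => algebraMap L Ω (a k))]
    rw [Kras.hom_aeval]
    congr 2
    funext i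
    rcases i with i | i
    · exact hcx i
    · rfl
  have hid1 : algebraMap K L (c h) =
      π ^ h * MvPolynomial.aeval (Sum.elim c' (fun _ => 0)) H := by
    apply (algebraMap L Ω).injective
    rw [map_mul, map_pow, heval, ← IsScalarTower.algebraMap_apply, hcdef,
      Kras.conj_es (Ω := Ω) n e hdim π hdegπ h hhn]
    simp only [hx, Kras.es_smul]
    simp
  have hid2 : algebraMap K L (minpolyCoeff K n θ h) =
      π ^ h * MvPolynomial.aeval (Sum.elim c' a') H := by
    apply (algebraMap L Ω).injective
    rw [map_mul, map_pow, heval, ← IsScalarTower.algebraMap_apply,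
      Kras.conj_es (Ω := Ω) n e hdim θ hdegθ h hhn, ← Kras.es_smul]
    congr 1
    funext l
    rw [hθexp, map_add, map_sum, mul_add, ← hx, Finset.mul_sum]
    congr 1
    refine Finset.sum_congr rfl fun k _ => ?_
    rw [map_mul, map_pow, AlgHom.commutes, hx, ha']
    simp only [map_mul, map_pow]
    rw [← IsScalarTower.algebraMap_apply]
    ring
  -- valuations of the coefficients
  have hcval : ∀ i : Fin n, w (c' i) =
      (vK (c ((i : ℕ) + 1))).map fun a => (n : ℤ) * a - (((i : ℕ) + 1 : ℕ) : ℤ) := by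
    intro i
    have h1 : vL (algebraMap K L (c ((i : ℕ) + 1))) = w (c' i) + vL (π ^ ((i : ℕ) + 1)) := by
      rw [hwv, ← hvL.map_mul, hc', div_mul_cancel₀ _ (pow_ne_zero _ hπ0)]
    rw [htotram, Kras.vL_pow _ hvL π hπ] at h1
    cases hk : vK (c ((i : ℕ) + 1)) with
    | top =>
      rw [hk, Kras.nsmul_top' (by omega)] at h1
      rw [WithTop.map_top]
      cases hz : w (c' i) with
      | top => rfl
      | coe z =>
        rw [hz] at h1
        exact absurd h1.symm WithTop.coe_ne_top
    | coe a =>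
      rw [hk] at h1
      rw [WithTop.map_coe]
      cases hz : w (c' i) with
      | top =>
        rw [hz, top_add] at h1
        exact absurd h1 WithTop.coe_ne_top
      | coe z =>
        rw [hz, ← WithTop.coe_nsmul, ← WithTop.coe_add, WithTop.coe_inj, nsmul_eq_mul] at h1
        rw [WithTop.coe_inj, h1]
        ring
  have hc0 : ∀ i, 0 ≤ w (c' i) := by
    intro i
    have h1 : vL (algebraMap K L (c ((i : ℕ) + 1))) = w (c' i) + vL (π ^ ((i : ℕ) + 1)) := by
      rw [hwv, ← hvL.map_mul, hc', div_mul_cancel₀ _ (pow_ne_zero _ hπ0)]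
    have h2 := Kras.eis_le n vK vL hvK hvL htotram hdim π hπ ((i : ℕ) + 1) (by omega) i.2
    rw [← hcdef, h1, Kras.vL_pow _ hvL π hπ] at h2
    cases hz : w (c' i) with
    | top => exact le_top
    | coe z =>
      rw [hz, ← WithTop.coe_add, WithTop.coe_le_coe] at h2
      exact_mod_cast (by linarith : 0 ≤ z)
  have hcn : iPi vK p ν n c ν ≤ 0 := by
    have h2 := Kras.eis_eq n vK vL hvK hvL htotram hdim hn0 π hπ
    rw [← hcdef, htotram] at h2
    exact Kras.iPi_nonpos vK p ν n hn0 c h2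
  have hmain := Kras.diff_bound n w _ c' a' H (fun s k0 hk0 =>
    Kras.mono_bound p ν n ℓ h hp hn0 ⟨u, by rw [hn, mul_comm]⟩ vK w c c' a' hcval hc0 hcn hbℓ
      H hH s k0 hk0)
  have hfin : n • vK (minpolyCoeff K n θ h - c h) = ((h : ℤ) : WithTop ℤ) +
      w (MvPolynomial.aeval (Sum.elim c' a') H -
        MvPolynomial.aeval (Sum.elim c' (fun _ => 0)) H) := by
    rw [← htotram, map_sub, hid1, hid2, ← mul_sub, hvL.map_mul, Kras.vL_pow _ hvL π hπ, hwv]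
  rw [hct]
  have hle : ((h : ℤ) : WithTop ℤ) + phiIdx vK p ν n (vL (p : L)) c ν ℓ ≤
      n • vK (minpolyCoeff K n θ h - c h) := by
    rw [hfin]
    exact add_le_add le_rfl hmain
  cases hv : vK (minpolyCoeff K n θ h - c h) with
  | top => exact le_top
  | coe y =>
    rw [hv] at hle
    cases hφ : phiIdx vK p ν n (vL (p : L)) c ν ℓ with
    | top =>
      rw [hφ, add_top] at hle
      exact absurd (top_le_iff.1 hle) WithTop.coe_ne_top
    | coe a =>
      rw [hφ, ← WithTop.coe_nsmul, ← WithTop.coe_add, WithTop.coe_le_coe, nsmul_eq_mul] at hle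
      rw [WithTop.map_coe, WithTop.coe_le_coe, Int.ceil_le, div_le_iff₀ (by exact_mod_cast hn0)]
      have : a + (h : ℤ) ≤ y * n := by linarith
      exact_mod_cast this

end
end

section
/- Let π_L be a uniformizer for L with minimum polynomial f(X) = X^n − c_1X^{n−1} + ⋯ + (−1)^n c_n over K, and for a partition λ = {λ_1,…,λ_k} with parts in [1,n] set c_λ = c_{λ_1}⋯c_{λ_k}. Let ℓ ≥ 1, let 1 ≤ h ≤ n, set j = v̄_p(h), let 1 ≤ s ≤ h, and let μ_s be the partition of ℓs + h consisting of h − s copies of 1 and s copies of ℓ + 1. Then for every partition λ of ℓs + h all of whose parts lie in [1,n], one has v_L(d_{λμ_s}·c_λ) ≥ φ_j(ℓ) + h, where d_{λμ_s} is the coefficient in ψ_{μ_s} of the monomial X_{λ_1}⋯X_{λ_k}. -/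
open scoped Classical

noncomputable section

namespace KeatingAux
open MvPolynomial

/-- Polynomials all of whose coefficients at exponents supported on multiples of `q`
are divisible by `q`. -/
def goodIdeal (n q : ℕ) : Ideal (MvPolynomial (Fin n) ℤ) where
  carrier := {f | ∀ e : Fin n →₀ ℕ, (∀ i : Fin n, ¬ q ∣ (i : ℕ) + 1 → e i = 0) →
    (q : ℤ) ∣ f.coeff e}
  add_mem' := by
    intro a b ha hb e he
    rw [coeff_add]
    exact dvd_add (ha e he) (hb e he)
  zero_mem' := by
    intro e he
    simp
  smul_mem' := by
    intro c f hf e he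
    rw [smul_eq_mul, coeff_mul]
    apply Finset.dvd_sum
    intro x hx
    apply Dvd.dvd.mul_left
    apply hf
    intro i hi
    have h1 := he i hi
    rw [← Finset.HasAntidiagonal.mem_antidiagonal.1 hx, Finsupp.add_apply] at h1
    omega

lemma mem_goodIdeal {n q : ℕ} {f : MvPolynomial (Fin n) ℤ} :
    f ∈ goodIdeal n q ↔ ∀ e : Fin n →₀ ℕ, (∀ i : Fin n, ¬ q ∣ (i : ℕ) + 1 → e i = 0) →
    (q : ℤ) ∣ f.coeff e := Iff.rfl

/-- the map sending `X_i` to `e_{i+1}`. -/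
def Phi (n : ℕ) : MvPolynomial (Fin n) ℤ →ₐ[ℤ] MvPolynomial (Fin n) ℤ :=
  aeval (fun i : Fin n => esymm (Fin n) ℤ ((i : ℕ) + 1))

/-- image of the ideal. -/
def img (n q : ℕ) : AddSubgroup (MvPolynomial (Fin n) ℤ) :=
  (Submodule.toAddSubgroup (goodIdeal n q)).map (Phi n).toRingHom.toAddMonoidHom

lemma mem_img {n q : ℕ} {x : MvPolynomial (Fin n) ℤ} :
    x ∈ img n q ↔ ∃ f ∈ goodIdeal n q, Phi n f = x := Iff.rfl

lemma Phi_injective (n : ℕ) : Function.Injective (Phi n) := by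
  intro a b hab
  apply esymmAlgHom_fin_injective (R := ℤ) (le_refl n)
  apply Subtype.ext
  rw [esymmAlgHom_apply, esymmAlgHom_apply]
  exact hab

lemma exists_Phi_of_symm {n : ℕ} {x : MvPolynomial (Fin n) ℤ} (hx : x.IsSymmetric) :
    ∃ f, Phi n f = x := by
  obtain ⟨f, hf⟩ := esymmAlgHom_fin_surjective (R := ℤ) (le_refl n) ⟨x, hx⟩
  refine ⟨f, ?_⟩
  have h1 := congrArg Subtype.val hf
  rw [esymmAlgHom_apply] at h1
  exact h1

lemma mul_mem_img {n q : ℕ} {x y : MvPolynomial (Fin n) ℤ} (hx : x.IsSymmetric)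
    (hy : y ∈ img n q) : x * y ∈ img n q := by
  obtain ⟨f, rfl⟩ := exists_Phi_of_symm hx
  obtain ⟨g, hg, rfl⟩ := mem_img.1 hy
  exact mem_img.2 ⟨f * g, Ideal.mul_mem_left _ _ hg, map_mul _ _ _⟩

lemma natCast_mul_esymm_mem {n q k : ℕ} (hk : 0 < k) :
    (k : MvPolynomial (Fin n) ℤ) * esymm (Fin n) ℤ k ∈ img n q := by
  by_cases hkn : k ≤ n
  · have hX : Phi n (X ⟨k - 1, by omega⟩) = esymm (Fin n) ℤ k := by
      simp [Phi, Nat.sub_add_cancel hk]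
    refine mem_img.2 ⟨(k : MvPolynomial (Fin n) ℤ) * X ⟨k - 1, by omega⟩, ?_, ?_⟩
    · by_cases hq : q ∣ k
      · intro e he
        rw [← map_natCast (C : ℤ →+* MvPolynomial (Fin n) ℤ), coeff_C_mul]
        exact Dvd.dvd.mul_right (by exact_mod_cast hq) _
      · apply Ideal.mul_mem_left
        intro e he
        have h1 := he ⟨k - 1, by omega⟩ (by simpa [Nat.sub_add_cancel hk] using hq)
        rw [coeff_X, if_neg]
        · exact dvd_zero _
        · rintro rfl
          simp at h1
    · rw [map_mul, hX, map_natCast]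
  · have : esymm (Fin n) ℤ k = 0 := by
      rw [esymm, Finset.powersetCard_eq_empty.2 (by simpa using hkn), Finset.sum_empty]
    rw [this, mul_zero]
    exact zero_mem _

lemma psum_mem {n q : ℕ} : ∀ k : ℕ, 0 < k → psum (Fin n) ℤ k ∈ img n q := by
  intro k
  induction k using Nat.strong_induction_on with
  | _ k ih =>
    intro hk
    have hs : ∀ m : ℕ, ((-1 : MvPolynomial (Fin n) ℤ) ^ m).IsSymmetric := by
      intro m
      exact pow_mem (S := symmetricSubalgebra (Fin n) ℤ) (neg_mem (one_mem _)) m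
    rw [psum_eq_mul_esymm_sub_sum (Fin n) ℤ k hk]
    apply sub_mem
    · rw [mul_assoc]
      exact mul_mem_img (hs _) (natCast_mul_esymm_mem hk)
    · apply sum_mem
      intro a ha
      simp only [Finset.mem_filter, Finset.HasAntidiagonal.mem_antidiagonal, Set.mem_Ioo] at ha
      apply mul_mem_img ((hs _).mul (esymm_isSymmetric _ _ _))
      apply ih <;> omega

/-- the factor `1 + S x^α + T x^β`. -/
def fac (n α β : ℕ) (r : Fin n) : Polynomial (Polynomial (MvPolynomial (Fin n) ℤ)) :=
  Polynomial.C (1 + Polynomial.C (X r ^ α) * Polynomial.X) +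
    Polynomial.C (Polynomial.C (X r ^ β)) * Polynomial.X

/-- coefficient of `S^a T^b` in the product of the factors. -/
def M (n α β : ℕ) (S : Finset (Fin n)) (a b : ℕ) : MvPolynomial (Fin n) ℤ :=
  ((∏ r ∈ S, fac n α β r).coeff b).coeff a

lemma M_symm (n α β a b : ℕ) : (M n α β Finset.univ a b).IsSymmetric := by
  intro σ
  have h1 : Polynomial.map (Polynomial.mapRingHom (rename σ : _ →ₐ[ℤ] _).toRingHom)
      (∏ r : Fin n, fac n α β r) = ∏ r : Fin n, fac n α β r := by
    rw [Polynomial.map_prod, ← Equiv.prod_comp σ (fac n α β)]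
    apply Finset.prod_congr rfl
    intro r _
    simp [fac]
  have h2 := congrArg (fun P => (P.coeff b).coeff a) h1
  simp only [Polynomial.coeff_map, Polynomial.coe_mapRingHom] at h2
  exact h2

lemma coeff_fac_mul_zero (n α β : ℕ) (r : Fin n) (P) :
    ((fac n α β r) * P).coeff 0 = (1 + Polynomial.C (X r ^ α) * Polynomial.X) * P.coeff 0 := by
  rw [fac, add_mul, Polynomial.coeff_add, Polynomial.coeff_C_mul, mul_assoc,
    Polynomial.coeff_C_mul, Polynomial.coeff_X_mul_zero, mul_zero, add_zero]

lemma coeff_fac_mul_succ (n α β : ℕ) (r : Fin n) (P) (b : ℕ) :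
    ((fac n α β r) * P).coeff (b + 1) =
      (1 + Polynomial.C (X r ^ α) * Polynomial.X) * P.coeff (b + 1)
      + Polynomial.C (X r ^ β) * P.coeff b := by
  rw [fac, add_mul, Polynomial.coeff_add, Polynomial.coeff_C_mul, mul_assoc,
    Polynomial.coeff_C_mul, Polynomial.coeff_X_mul]

lemma coeff_lin_mul_zero {R : Type*} [CommRing R] (x : R) (P : Polynomial R) :
    ((1 + Polynomial.C x * Polynomial.X) * P).coeff 0 = P.coeff 0 := by
  simp

lemma coeff_lin_mul_succ {R : Type*} [CommRing R] (x : R) (P : Polynomial R) (a : ℕ) :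
    ((1 + Polynomial.C x * Polynomial.X) * P).coeff (a + 1)
      = P.coeff (a + 1) + x * P.coeff a := by
  rw [add_mul, one_mul, Polynomial.coeff_add, mul_assoc, Polynomial.coeff_C_mul,
    Polynomial.coeff_X_mul]

lemma M_rec (n α β : ℕ) (r : Fin n) (a b : ℕ) :
    M n α β (Finset.univ.erase r) a b = M n α β Finset.univ a b
      - (if a = 0 then 0 else X r ^ α * M n α β (Finset.univ.erase r) (a - 1) b)
      - (if b = 0 then 0 else X r ^ β * M n α β (Finset.univ.erase r) a (b - 1)) := by
  have h1 : M n α β Finset.univ a b =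
    ((fac n α β r * ∏ r ∈ Finset.univ.erase r, fac n α β r).coeff b).coeff a := by
    rw [Finset.mul_prod_erase _ _ (Finset.mem_univ r)]; rfl
  rw [h1]
  cases b with
  | zero =>
    rw [coeff_fac_mul_zero]
    cases a with
    | zero => rw [coeff_lin_mul_zero]; simp [M]
    | succ a => rw [coeff_lin_mul_succ]; simp [M]
  | succ b =>
    rw [coeff_fac_mul_succ, Polynomial.coeff_add, Polynomial.coeff_C_mul]
    cases a with
    | zero => rw [coeff_lin_mul_zero]; simp [M]
    | succ a => rw [coeff_lin_mul_succ]; simp [M]; ring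

lemma key_mem (n q α β : ℕ) : ∀ k a b : ℕ, a + b = k → ∀ c, 0 < c →
    ∑ r : Fin n, X r ^ c * M n α β (Finset.univ.erase r) a b ∈ img n q := by
  intro k
  induction k with
  | zero =>
    intro a b hab c hc
    obtain ⟨rfl, rfl⟩ : a = 0 ∧ b = 0 := by omega
    have : ∑ r : Fin n, X r ^ c * M n α β (Finset.univ.erase r) 0 0
        = M n α β Finset.univ 0 0 * psum (Fin n) ℤ c := by
      rw [psum, Finset.mul_sum]
      apply Finset.sum_congr rfl
      intro r _
      rw [M_rec]; simp; ring
    rw [this]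
    exact mul_mem_img (M_symm _ _ _ _ _) (psum_mem _ hc)
  | succ k ih =>
    intro a b hab c hc
    have : ∑ r : Fin n, X r ^ c * M n α β (Finset.univ.erase r) a b
        = M n α β Finset.univ a b * psum (Fin n) ℤ c
        - (if a = 0 then 0 else
            ∑ r : Fin n, X r ^ (c + α) * M n α β (Finset.univ.erase r) (a - 1) b)
        - (if b = 0 then 0 else
            ∑ r : Fin n, X r ^ (c + β) * M n α β (Finset.univ.erase r) a (b - 1)) := by
      have : ∀ r : Fin n, X r ^ c * M n α β (Finset.univ.erase r) a b = 
          M n α β Finset.univ a b * X r ^ c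
          - (if a = 0 then 0 else X r ^ (c + α) * M n α β (Finset.univ.erase r) (a - 1) b)
          - (if b = 0 then 0 else
             X r ^ (c + β) * M n α β (Finset.univ.erase r) a (b - 1)) := by
        intro r
        rw [M_rec]
        split_ifs <;> ring
      rw [Finset.sum_congr rfl (fun r _ => this r), Finset.sum_sub_distrib,
        Finset.sum_sub_distrib, psum, Finset.mul_sum]
      split_ifs <;> simp
    rw [this]
    apply sub_mem
    · apply sub_mem
      · exact mul_mem_img (M_symm _ _ _ _ _) (psum_mem _ hc)
      · split_ifs with h
        · exact zero_mem _
        · exact ih _ _ (by omega) _ (by omega)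
    · split_ifs with h
      · exact zero_mem _
      · exact ih _ _ (by omega) _ (by omega)

lemma b_mul_M_mem (n q α β a b : ℕ) (hβ : 0 < β) :
    (b : MvPolynomial (Fin n) ℤ) * M n α β Finset.univ a b ∈ img n q := by
  cases b with
  | zero => simp [zero_mem]
  | succ b =>
    have h1 := congrArg (fun P => (P.coeff b).coeff a)
      (Polynomial.derivative_prod_finset (s := Finset.univ) (f := fac n α β))
    have h2 : ∀ r, Polynomial.derivative (fac n α β r) =
        Polynomial.C (Polynomial.C (X r ^ β)) := by
      intro r
      rw [fac, Polynomial.derivative_add, Polynomial.derivative_C, zero_add,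
        Polynomial.derivative_C_mul, Polynomial.derivative_X, mul_one]
    simp only [h2, Polynomial.coeff_derivative, Polynomial.finsetSum_coeff,
      Polynomial.coeff_mul_C] at h1
    have h3 : ((b + 1 : ℕ) : MvPolynomial (Fin n) ℤ) * M n α β Finset.univ a (b + 1)
       = ∑ r : Fin n, X r ^ β * M n α β (Finset.univ.erase r) a b := by
      have h4 : ((b : Polynomial (MvPolynomial (Fin n) ℤ)) + 1)
        = Polynomial.C ((b + 1 : ℕ) : MvPolynomial (Fin n) ℤ) := by simp
      rw [h4, Polynomial.coeff_mul_C] at h1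
      rw [mul_comm]
      refine h1.trans ?_
      apply Finset.sum_congr rfl
      intro r _
      rw [mul_comm]; rfl
    rw [h3]
    exact key_mem n q α β _ a b rfl β hβ

lemma M_eq (n α β a b : ℕ) : M n α β Finset.univ a b =
    ∑ P ∈ (Finset.powersetCard b (Finset.univ : Finset (Fin n))).sigma
      (fun B => Finset.powersetCard a (Finset.univ \ B)),
      (∏ i ∈ P.1, X i ^ β) * ∏ i ∈ P.2, X i ^ α := by
  have h1 : ∏ r : Fin n, fac n α β r = ∑ B ∈ (Finset.univ : Finset (Fin n)).powerset,
      Polynomial.C (Polynomial.C (∏ i ∈ B, X i ^ β) *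
       ∑ A ∈ (Finset.univ \ B).powerset, Polynomial.C (∏ i ∈ A, X i ^ α) * Polynomial.X ^ A.card)
       * Polynomial.X ^ B.card := by
    have h0 : ∀ r : Fin n, fac n α β r = Polynomial.C (Polynomial.C (X r ^ β)) * Polynomial.X
      + Polynomial.C (1 + Polynomial.C (X r ^ α) * Polynomial.X) := fun r => add_comm _ _
    simp only [h0]
    refine (Finset.prod_add (R := Polynomial (Polynomial (MvPolynomial (Fin n) ℤ)))
      (fun r : Fin n => Polynomial.C (Polynomial.C (X r ^ β)) * Polynomial.X)
      (fun r : Fin n => Polynomial.C (1 + Polynomial.C (X r ^ α) * Polynomial.X))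
      Finset.univ).trans ?_
    apply Finset.sum_congr rfl
    intro B _
    rw [← map_prod, Finset.prod_one_add, Finset.prod_mul_distrib]
    simp only [Finset.prod_mul_distrib, Finset.prod_const, map_mul, map_prod]
    ring
  rw [M, h1, Finset.sum_sigma, Finset.powersetCard_eq_filter, Finset.sum_filter]
  simp only [Polynomial.finsetSum_coeff, Polynomial.coeff_C_mul_X_pow]
  apply Finset.sum_congr rfl
  intro B _
  by_cases hB : B.card = b
  · rw [if_pos hB.symm, if_pos hB, Polynomial.coeff_C_mul, Finset.powersetCard_eq_filter,
      Finset.sum_filter, Polynomial.finsetSum_coeff, Finset.mul_sum]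
    apply Finset.sum_congr rfl
    intro A _
    rw [Polynomial.coeff_C_mul_X_pow]
    by_cases hA : A.card = a
    · rw [if_pos hA.symm, if_pos hA]
    · rw [if_neg (Ne.symm hA), if_neg hA, mul_zero]
  · rw [if_neg (Ne.symm hB), if_neg hB, Polynomial.coeff_zero]

lemma msymm_eq_M (n α β a b N : ℕ) (hα : 0 < α) (hβ : 0 < β) (hne : α ≠ β)
    (mu : N.Partition)
    (hmu : mu.parts = Multiset.replicate a α + Multiset.replicate b β) :
    msymm (Fin n) ℤ mu = M n α β Finset.univ a b := by
  have hcount : ∀ s : {s : Sym (Fin n) N // Nat.Partition.ofSym s = mu}, 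
      s.1.1.dedup.map s.1.1.count = Multiset.replicate a α + Multiset.replicate b β := by
    intro s
    rw [← hmu]
    exact congrArg Nat.Partition.parts s.2
  have hval : ∀ s : {s : Sym (Fin n) N // Nat.Partition.ofSym s = mu}, ∀ x,
      s.1.1.count x = 0 ∨ s.1.1.count x = α ∨ s.1.1.count x = β := by
    intro s x
    by_cases hx : x ∈ s.1.1
    · right
      have : s.1.1.count x ∈ s.1.1.dedup.map s.1.1.count :=
        Multiset.mem_map_of_mem _ (Multiset.mem_dedup.2 hx)
      rw [hcount, Multiset.mem_add] at this
      exact this.imp Multiset.eq_of_mem_replicate Multiset.eq_of_mem_replicate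
    · left
      exact Multiset.count_eq_zero.2 hx
  have hcard : ∀ s : {s : Sym (Fin n) N // Nat.Partition.ofSym s = mu}, ∀ γ, 0 < γ →
      (Finset.univ.filter (fun x => s.1.1.count x = γ)).card
       = (Multiset.replicate a α + Multiset.replicate b β).count γ := by
    intro s γ hγ
    rw [← hcount s, Multiset.count_map]
    have : Finset.univ.filter (fun x => s.1.1.count x = γ)
       = s.1.1.toFinset.filter (fun x => γ = s.1.1.count x) := by
      ext x
      simp only [Finset.mem_filter, Finset.mem_univ, true_and, Multiset.mem_toFinset]
      constructor
      · intro h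
        exact ⟨Multiset.count_pos.1 (by omega), h.symm⟩
      · intro h
        exact h.2.symm
    rw [this]
    rfl
  rw [M_eq, msymm]
  refine Finset.sum_bij
    (fun s _ => ⟨Finset.univ.filter (fun x => s.1.1.count x = β),
      Finset.univ.filter (fun x => s.1.1.count x = α)⟩) ?_ ?_ ?_ ?_
  · intro s _
    simp only [Finset.mem_sigma, Finset.mem_powersetCard, Finset.subset_univ, true_and]
    refine ⟨?_, ?_, ?_⟩
    · rw [hcard s β hβ]
      simp [Multiset.count_replicate, hne]
    · intro x
      simp only [Finset.mem_filter, Finset.mem_univ, true_and, Finset.mem_sdiff]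
      omega
    · rw [hcard s α hα]
      simp [Multiset.count_replicate, hne.symm]
  · intro s _ t _ hst
    simp only [Sigma.mk.injEq, heq_eq_eq] at hst
    apply Subtype.ext
    apply Subtype.ext
    apply Multiset.ext.2
    intro x
    have h1 := Finset.ext_iff.1 hst.1 x
    have h2 := Finset.ext_iff.1 hst.2 x
    simp only [Finset.mem_filter, Finset.mem_univ, true_and] at h1 h2
    have h3 := hval s x
    have h4 := hval t x
    omega
  · rintro ⟨B, A⟩ hBA
    simp only [Finset.mem_sigma, Finset.mem_powersetCard, Finset.subset_univ, true_and] at hBA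
    obtain ⟨hB, hAB, hA⟩ := hBA
    have hdisj : Disjoint A B := by
      rw [Finset.disjoint_left]
      intro x hx
      exact (Finset.mem_sdiff.1 (hAB hx)).2
    have hc : ∀ x, (α • A.val + β • B.val).count x
        = if x ∈ A then α else if x ∈ B then β else 0 := by
      intro x
      rw [Multiset.count_add, Multiset.count_nsmul, Multiset.count_nsmul,
        Multiset.count_eq_of_nodup A.nodup, Multiset.count_eq_of_nodup B.nodup]
      simp only [Finset.mem_val]
      by_cases hxA : x ∈ A
      · simp [hxA, Finset.disjoint_left.1 hdisj hxA]
      · simp [hxA]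
    have hN : Multiset.card (α • A.val + β • B.val) = N := by
      rw [← mu.parts_sum, hmu]
      simp [hA, hB, mul_comm]
    have hded : (α • A.val + β • B.val).dedup = A.val + B.val := by
      have : (α • A.val + β • B.val).toFinset = A.disjUnion B hdisj := by
        ext x
        rw [Multiset.mem_toFinset, ← Multiset.count_pos, hc, Finset.mem_disjUnion]
        split_ifs <;> simp_all
      exact congrArg Finset.val this
    refine ⟨⟨⟨α • A.val + β • B.val, hN⟩, ?_⟩, Finset.mem_univ _, ?_⟩
    · apply Nat.Partition.ext
      rw [hmu]
      change (α • A.val + β • B.val).dedup.map (α • A.val + β • B.val).count = _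
      rw [hded, Multiset.map_add]
      congr 1
      · rw [Multiset.map_congr rfl (g := fun _ => α), Multiset.map_const', Finset.card_val, hA]
        intro x hx
        rw [Finset.mem_val] at hx
        rw [hc, if_pos hx]
      · rw [Multiset.map_congr rfl (g := fun _ => β), Multiset.map_const', Finset.card_val, hB]
        intro x hx
        rw [Finset.mem_val] at hx
        rw [hc, if_neg (Finset.disjoint_right.1 hdisj hx), if_pos hx]
    · simp only [hc, Sigma.mk.injEq, heq_eq_eq]
      constructor
      · ext x
        simp only [Finset.mem_filter, Finset.mem_univ, true_and]
        have : x ∈ A → x ∉ B := fun h => Finset.disjoint_left.1 hdisj h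
        split_ifs <;> simp_all
        omega
      · ext x
        simp only [Finset.mem_filter, Finset.mem_univ, true_and]
        split_ifs <;> simp_all <;> omega
  · intro s _
    have hs : s.1.1 = β • (Finset.univ.filter (fun x => s.1.1.count x = β)).val
        + α • (Finset.univ.filter (fun x => s.1.1.count x = α)).val := by
      ext x
      rw [Multiset.count_add, Multiset.count_nsmul, Multiset.count_nsmul,
        Multiset.count_eq_of_nodup (Finset.nodup _), Multiset.count_eq_of_nodup (Finset.nodup _)]
      simp only [Finset.mem_val, Finset.mem_filter, Finset.mem_univ, true_and]
      rcases hval s x with h | h | h <;> rw [h]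
      · simp [hα.ne, hβ.ne]
      · simp [hne]
      · simp [hne.symm]
    conv_lhs => rw [hs]
    rw [Multiset.map_add, Multiset.prod_add, Multiset.map_nsmul, Multiset.map_nsmul,
      Multiset.prod_nsmul, Multiset.prod_nsmul, Finset.prod_pow, Finset.prod_pow]
    rfl

lemma dvd_mul_coeff (n q α β a b N : ℕ) (hα : 0 < α) (hβ : 0 < β) (hne : α ≠ β)
    (mu : N.Partition)
    (hmu : mu.parts = Multiset.replicate a α + Multiset.replicate b β)
    (ψ : MvPolynomial (Fin n) ℤ)
    (hψ : aeval (fun i : Fin n => esymm (Fin n) ℤ ((i : ℕ) + 1)) ψ = msymm (Fin n) ℤ mu)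
    (e : Fin n →₀ ℕ) (he : ∀ i : Fin n, ¬ q ∣ (i : ℕ) + 1 → e i = 0) :
    (q : ℤ) ∣ b * ψ.coeff e := by
  have h1 := b_mul_M_mem n q α β a b hβ
  rw [← msymm_eq_M n α β a b N hα hβ hne mu hmu, ← hψ] at h1
  obtain ⟨f, hf, hfe⟩ := mem_img.1 h1
  have h2 : f = (b : MvPolynomial (Fin n) ℤ) * ψ := by
    apply Phi_injective
    rw [hfe, map_mul, map_natCast]; rfl
  have h3 := hf e he
  rw [h2, ← map_natCast (C : ℤ →+* MvPolynomial (Fin n) ℤ), coeff_C_mul] at h3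
  exact_mod_cast h3

end KeatingAux

namespace KeatingAux

/-- the additive valuation attached to `v`. -/
def toVal {F : Type*} [Field F] (v : F → WithTop ℤ) (hv : IsDiscreteValuationOn v) :
    AddValuation F (WithTop ℤ) :=
  AddValuation.of v ((hv.eq_top_iff 0).2 rfl)
    (by
      have h1 := hv.map_mul 1 1
      have h2 : v 1 ≠ ⊤ := fun h => one_ne_zero ((hv.eq_top_iff 1).1 h)
      rw [mul_one] at h1
      lift v 1 to ℤ using h2 with a
      norm_cast at h1 ⊢
      omega)
    hv.min_le_add hv.map_mul

lemma nsmul_coe (m : ℕ) (a : ℤ) : m • (a : WithTop ℤ) = (((m : ℤ) * a : ℤ) : WithTop ℤ) := by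
  rw [← nsmul_eq_mul]
  exact (WithTop.coe_nsmul a m).symm

lemma sum_le_term {F : Type*} [Field F] (v : AddValuation F (WithTop ℤ)) (n : ℕ) (f : ℕ → F)
    (hf : ∀ i < n, ∀ j < n, v (f i) = v (f j) → v (f i) ≠ ⊤ → i = j) (i : ℕ) (hi : i < n) :
    v (∑ k ∈ Finset.range n, f k) ≤ v (f i) := by
  obtain ⟨i0, hi0, hmin⟩ := Finset.exists_min_image (Finset.range n) (fun k => v (f k))
    ⟨i, Finset.mem_range.2 hi⟩
  have hle := hmin i (Finset.mem_range.2 hi)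
  refine le_trans ?_ hle
  by_cases htop : v (f i0) = ⊤
  · rw [htop]; exact le_top
  rw [← Finset.add_sum_erase _ _ hi0]
  apply le_of_eq
  apply AddValuation.map_add_eq_of_lt_left
  apply AddValuation.map_lt_sum _ htop
  intro k hk
  have hk' := Finset.mem_of_mem_erase hk
  refine lt_of_le_of_ne (hmin k hk') ?_
  intro h
  exact Finset.ne_of_mem_erase hk
    (hf i0 (Finset.mem_range.1 hi0) k (Finset.mem_range.1 hk') h htop).symm

lemma val_minpolyCoeff {K L : Type*} [Field K] [Field L] [Algebra K L]
    [FiniteDimensional K L] (n : ℕ) (hdim : Module.finrank K L = n)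
    (vK : K → WithTop ℤ) (vL : L → WithTop ℤ)
    (hvK : IsDiscreteValuationOn vK) (hvL : IsDiscreteValuationOn vL)
    (htotram : ∀ x : K, vL (algebraMap K L x) = n • vK x)
    (π : L) (hπ : vL π = 1) (h : ℕ) (hh1 : 1 ≤ h) (hhn : h ≤ n) :
    1 ≤ vK (minpolyCoeff K n π h) := by
  let v := toVal vL hvL
  let w := toVal vK hvK
  have hv : ∀ x, v x = vL x := fun x => rfl
  have hw : ∀ x, w x = vK x := fun x => rfl
  have hpow : ∀ i : ℕ, v (π ^ i) = ((i : ℤ) : WithTop ℤ) := by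
    intro i
    rw [AddValuation.map_pow, hv, hπ]
    have := nsmul_coe i 1
    rw [mul_one] at this
    exact this
  have hterm : ∀ (x : K) (i : ℕ), v (algebraMap K L x * π ^ i) = n • vK x + ((i : ℤ) : WithTop ℤ) := by
    intro x i
    rw [AddValuation.map_mul, hpow, hv, htotram]
  have hn0 : 0 < n := by omega
  set f := minpoly K π with hfdef
  have hmonic : f.Monic := minpoly.monic (IsIntegral.of_finite K π)
  have hdist : ∀ i < n, ∀ j < n, v (algebraMap K L (f.coeff i) * π ^ i)
      = v (algebraMap K L (f.coeff j) * π ^ j) →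
      v (algebraMap K L (f.coeff i) * π ^ i) ≠ ⊤ → i = j := by
    intro i hi j hj hij hne
    have hi0 : vK (f.coeff i) ≠ ⊤ := by
      intro h0
      apply hne
      rw [(hvK.eq_top_iff _).1 h0, map_zero, zero_mul, AddValuation.map_zero]
    have hj0 : vK (f.coeff j) ≠ ⊤ := by
      intro h0
      apply hne
      rw [hij, (hvK.eq_top_iff _).1 h0, map_zero, zero_mul, AddValuation.map_zero]
    rw [hterm, hterm] at hij
    lift vK (f.coeff i) to ℤ using hi0 with a
    lift vK (f.coeff j) to ℤ using hj0 with b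
    rw [nsmul_coe, nsmul_coe] at hij
    have hij' : (n : ℤ) * a + i = n * b + j := by exact_mod_cast hij
    have h1 := congrArg (· % (n : ℤ)) hij'
    simp only [Int.mul_add_emod_self_left] at h1
    rw [Int.emod_eq_of_lt (by omega) (by omega), Int.emod_eq_of_lt (by omega) (by omega)] at h1
    exact_mod_cast h1
  have hdeg : f.natDegree = n := by
    have hle : f.natDegree ≤ n := hdim ▸ minpoly.natDegree_le π
    by_contra hne
    have hlt : f.natDegree < n := by omega
    have h0 : ∑ i ∈ Finset.range n, algebraMap K L (f.coeff i) * π ^ i = 0 := by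
      rw [← minpoly.aeval K π, Polynomial.aeval_eq_sum_range' hlt]
      simp [Algebra.smul_def, f]
    have h1 := sum_le_term v n (fun i => algebraMap K L (f.coeff i) * π ^ i) hdist _ hlt
    simp only [h0, AddValuation.map_zero, top_le_iff] at h1
    rw [Polynomial.coeff_natDegree, hmonic.leadingCoeff, map_one, one_mul, hpow] at h1
    exact WithTop.coe_ne_top h1
  have hsum : ∑ i ∈ Finset.range n, algebraMap K L (f.coeff i) * π ^ i = - π ^ n := by
    have h2 : ∑ i ∈ Finset.range (n + 1), algebraMap K L (f.coeff i) * π ^ i = 0 := by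
      rw [← minpoly.aeval K π, Polynomial.aeval_eq_sum_range' (n := n + 1) (by rw [← hfdef]; omega)]
      simp [Algebra.smul_def, f]
    rw [Finset.sum_range_succ] at h2
    have h3 : f.coeff n = 1 := by rw [← hdeg]; exact hmonic
    rw [h3, map_one, one_mul] at h2
    exact eq_neg_of_add_eq_zero_left h2
  have h1 := sum_le_term v n (fun i => algebraMap K L (f.coeff i) * π ^ i) hdist (n - h) (by omega)
  rw [hsum, AddValuation.map_neg, hpow, hterm] at h1
  have h2 : vK (minpolyCoeff K n π h) = vK (f.coeff (n - h)) := by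
    rw [minpolyCoeff, ← hfdef, ← hw, ← hw]
    rcases neg_one_pow_eq_or K h with h3 | h3 <;> rw [h3]
    · rw [one_mul]
    · rw [neg_one_mul, AddValuation.map_neg]
  rw [h2]
  by_cases htop : vK (f.coeff (n - h)) = ⊤
  · rw [htop]; exact le_top
  lift vK (f.coeff (n - h)) to ℤ using htop with a
  rw [nsmul_coe] at h1
  have h1' : (n : ℤ) ≤ n * a + (n - h : ℕ) := by exact_mod_cast h1
  have h3 : (1 : ℤ) ≤ a := by
    by_contra hcon
    have : (n : ℤ) * a ≤ 0 := mul_nonpos_of_nonneg_of_nonpos (by omega) (by omega)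
    omega
  exact_mod_cast h3

lemma val_int_nonneg {F : Type*} [Field F] (v : AddValuation F (WithTop ℤ)) (m : ℤ) :
    0 ≤ v (m : F) := by
  induction m with
  | zero => simp
  | succ i ih =>
    push_cast at ih ⊢
    exact AddValuation.map_le_add _ ih (by rw [AddValuation.map_one])
  | pred i ih =>
    push_cast at ih ⊢
    exact AddValuation.map_le_sub _ ih (by rw [AddValuation.map_one])

lemma val_dvd {F : Type*} [Field F] (v : AddValuation F (WithTop ℤ)) (p k : ℕ) (d : ℤ)
    (hd : (p : ℤ) ^ k ∣ d) : k • v (p : F) ≤ v (d : F) := by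
  obtain ⟨e, rfl⟩ := hd
  push_cast
  rw [AddValuation.map_mul, AddValuation.map_pow]
  exact le_add_of_nonneg_right (val_int_nonneg v e)

lemma val_prod_ge {K L : Type*} [Field K] [Field L] [Algebra K L]
    (v : AddValuation L (WithTop ℤ)) (n : ℕ) (c : ℕ → K)
    (hc : ∀ i, 1 ≤ i → i ≤ n → ((n : ℤ) : WithTop ℤ) ≤ v (algebraMap K L (c i))) (lam : Multiset ℕ)
    (hlam : ∀ x ∈ lam, 1 ≤ x ∧ x ≤ n) :
    ((lam.sum : ℤ) : WithTop ℤ) ≤ v (algebraMap K L (lam.map c).prod) := by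
  induction lam using Multiset.induction_on with
  | empty => simp
  | cons x lam ih =>
    have h1 := ih (fun y hy => hlam y (Multiset.mem_cons_of_mem hy))
    obtain ⟨h2, h3⟩ := hlam x (Multiset.mem_cons_self x lam)
    rw [Multiset.map_cons, Multiset.prod_cons, map_mul, AddValuation.map_mul, Multiset.sum_cons]
    push_cast
    refine add_le_add (le_trans ?_ (hc x h2 h3)) ?_
    · exact_mod_cast h3
    · exact_mod_cast h1


lemma pow_dvd_of_dvd_mul (p t g j : ℕ) (hp : p.Prime) (hg : g ≠ 0) (d : ℤ)
    (hj : padicValNat p g ≤ j) (h : ((p ^ t : ℕ) : ℤ) ∣ g * d) : (p : ℤ) ^ (t - j) ∣ d := by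
  have := Fact.mk hp
  obtain ⟨g', hg'⟩ := pow_padicValNat_dvd (p := p) (n := g)
  have hnd : ¬ p ∣ g' := by
    rintro ⟨k, rfl⟩
    apply pow_succ_padicValNat_not_dvd (p := p) hg
    exact ⟨k, hg'.trans (by ring)⟩
  by_cases ht : t ≤ padicValNat p g
  · rw [Nat.sub_eq_zero_of_le (ht.trans hj), pow_zero]; exact one_dvd _
  have h1 : (p : ℤ) ^ padicValNat p g * (p : ℤ) ^ (t - padicValNat p g)
      ∣ (p : ℤ) ^ padicValNat p g * (g' * d) := by
    rw [← pow_add, Nat.add_sub_cancel' (by omega)]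
    have h2 : (g : ℤ) = (p : ℤ) ^ padicValNat p g * g' := by exact_mod_cast hg'
    rw [← mul_assoc, ← h2]
    exact_mod_cast h
  have h3 := Int.dvd_of_mul_dvd_mul_left (by exact_mod_cast (pow_pos hp.pos _).ne') h1
  have h4 : IsCoprime ((p : ℤ) ^ (t - padicValNat p g)) (g' : ℤ) := by
    apply IsCoprime.pow_left
    exact Nat.isCoprime_iff_coprime.2 ((Nat.Prime.coprime_iff_not_dvd hp).2 hnd)
  exact (pow_dvd_pow _ (by omega)).trans (h4.dvd_of_dvd_mul_left h3)

end KeatingAux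

/-- Let `π_L` be a uniformizer of the totally ramified separable extension `L/K` of
degree `n = u·p^ν`, with minimal polynomial coefficients `c_h`, and for a partition `λ`
with parts in `[1, n]` set `c_λ = c_{λ_1}⋯c_{λ_k}`.  Let `ℓ ≥ 1`, `1 ≤ h ≤ n`,
`j = v̄_p(h)`, `1 ≤ s ≤ h`, and let `μ_s` be the partition of `ℓs + h` consisting of
`h - s` copies of `1` and `s` copies of `ℓ + 1`.  Then for every partition `λ` of
`ℓs + h` with parts in `[1, n]` one has `v_L(d_{λμ_s}·c_λ) ≥ φ_j(ℓ) + h`, where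
`d_{λμ_s}` is the coefficient of `X_{λ_1}⋯X_{λ_k}` in the unique polynomial `ψ_{μ_s}`
with `m_{μ_s} = ψ_{μ_s}(e_1, …, e_n)`. -/
theorem val_d_mul_c_ge {K L : Type*} [Field K] [Field L] [Algebra K L]
    [FiniteDimensional K L] [Algebra.IsSeparable K L]
    (p u ν n : ℕ) (hp : p.Prime) (hu : ¬ p ∣ u) (hn : n = u * p ^ ν)
    (hdim : Module.finrank K L = n)
    (vK : K → WithTop ℤ) (vL : L → WithTop ℤ)
    (hvK : IsDiscreteValuationOn vK) (hvL : IsDiscreteValuationOn vL)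
    (hKcomplete : IsCompleteWrt vK)
    (hres : HasPerfectResidueFieldCharP vK p)
    (htotram : ∀ x : K, vL (algebraMap K L x) = n • vK x)
    (π : L) (hπ : vL π = 1)
    (ℓ : ℕ) (hℓ : 1 ≤ ℓ)
    (h : ℕ) (hh1 : 1 ≤ h) (hhn : h ≤ n)
    (s : ℕ) (hs1 : 1 ≤ s) (hsh : s ≤ h)
    (mu : (ℓ * s + h).Partition)
    (hmu : mu.parts = Multiset.replicate (h - s) 1 + Multiset.replicate s (ℓ + 1))
    (lam : Multiset ℕ) (hlamsum : lam.sum = ℓ * s + h)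
    (hlam : ∀ x ∈ lam, 1 ≤ x ∧ x ≤ n)
    (ψ : MvPolynomial (Fin n) ℤ)
    (hψ : MvPolynomial.aeval (fun i : Fin n => MvPolynomial.esymm (Fin n) ℤ ((i : ℕ) + 1)) ψ
      = MvPolynomial.msymm (Fin n) ℤ mu) :
    phiIdx vK p ν n (vL (p : L)) (minpolyCoeff K n π) (vbar p ν h) ℓ +
        ((h : ℤ) : WithTop ℤ) ≤
      vL (algebraMap K L
        (((ψ.coeff (partExp n lam) : ℤ) : K) * (lam.map (minpolyCoeff K n π)).prod)) := by
  have := Fact.mk hp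
  have hn0 : 0 < n := by omega
  set c := minpolyCoeff K n π with hcdef
  set d := ψ.coeff (partExp n lam) with hddef
  let v := KeatingAux.toVal vL hvL
  have hv : ∀ x, vL x = v x := fun x => rfl
  have hc : ∀ i, 1 ≤ i → i ≤ n → ((n : ℤ) : WithTop ℤ) ≤ v (algebraMap K L (c i)) := by
    intro i hi1 hin
    have h1 := KeatingAux.val_minpolyCoeff n hdim vK vL hvK hvL htotram π hπ i hi1 hin
    rw [← hv, htotram]
    rw [← hcdef] at h1
    by_cases htop : vK (c i) = ⊤
    · have : c i = 0 := (hvK.eq_top_iff _).1 htop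
      rw [← htotram, this, map_zero, (hvL.eq_top_iff 0).2 rfl]
      exact le_top
    lift vK (c i) to ℤ using htop with a
    rw [KeatingAux.nsmul_coe]
    have h2 : (1 : ℤ) ≤ a := by exact_mod_cast h1
    have h3 : (n : ℤ) ≤ n * a := by nlinarith
    exact_mod_cast h3
  -- the gcd of `s` and `h`
  set g := Nat.gcd s h with hg
  have hg0 : g ≠ 0 := (Nat.gcd_pos_of_pos_left _ hs1).ne'
  set j0 := min (padicValNat p g) ν with hj0
  have hj0h : j0 ≤ vbar p ν h := by
    have : padicValNat p g ≤ padicValNat p h :=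
      (padicValNat_dvd_iff_le (by omega)).1 (pow_padicValNat_dvd.trans (Nat.gcd_dvd_right s h))
    unfold vbar
    omega
  have hpj0 : p ^ j0 ≤ s := by
    apply Nat.le_of_dvd hs1
    exact ((pow_dvd_pow p (min_le_left _ _)).trans pow_padicValNat_dvd).trans (Nat.gcd_dvd_left s h)
  -- a part of minimal valuation
  have hlamne : lam.toFinset.Nonempty := by
    rw [Multiset.toFinset_nonempty]
    rintro rfl
    simp at hlamsum
    omega
  obtain ⟨h', hh'mem, hh'min⟩ := Finset.exists_min_image lam.toFinset (vbar p ν) hlamne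
  rw [Multiset.mem_toFinset] at hh'mem
  obtain ⟨hh'1, hh'n⟩ := hlam h' hh'mem
  set t := vbar p ν h' with ht
  have htν : t ≤ ν := min_le_right _ _
  have htdvd : ∀ x ∈ lam, p ^ t ∣ x := by
    intro x hx
    have h1 := hh'min x (Multiset.mem_toFinset.2 hx)
    have h2 : vbar p ν x ≤ padicValNat p x := min_le_left _ _
    exact (pow_dvd_pow p (h1.trans h2)).trans pow_padicValNat_dvd
  have hexp : ∀ i : Fin n, ¬ p ^ t ∣ (i : ℕ) + 1 → partExp n lam i = 0 := by
    intro i hi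
    change lam.count ((i : ℕ) + 1) = 0
    rw [Multiset.count_eq_zero]
    exact fun hmem => hi (htdvd _ hmem)
  have hd1 : ((p ^ t : ℕ) : ℤ) ∣ s * d :=
    KeatingAux.dvd_mul_coeff n (p ^ t) 1 (ℓ + 1) (h - s) s _ one_pos (by omega) (by omega) mu hmu
      ψ hψ _ hexp
  have hd2 : ((p ^ t : ℕ) : ℤ) ∣ ((h - s : ℕ) : ℤ) * d :=
    KeatingAux.dvd_mul_coeff n (p ^ t) (ℓ + 1) 1 s (h - s) _ (by omega) one_pos (by omega) mu
      (by rw [hmu, add_comm]) ψ hψ _ hexp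
  have hd3 : ((p ^ t : ℕ) : ℤ) ∣ (g : ℤ) * d := by
    have h1 : ((p ^ t : ℕ) : ℤ) ∣ (h : ℤ) * d := by
      have h2 := dvd_add hd1 hd2
      rw [← add_mul, ← Nat.cast_add, Nat.add_sub_cancel' hsh] at h2
      exact h2
    rw [hg, Nat.gcd_eq_gcd_ab, add_mul]
    apply dvd_add
    · rw [mul_right_comm]; exact Dvd.dvd.mul_right hd1 _
    · rw [mul_right_comm]; exact Dvd.dvd.mul_right h1 _
  have hd4 : (p : ℤ) ^ (t - j0) ∣ d := by
    by_cases hle : padicValNat p g ≤ ν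
    · exact KeatingAux.pow_dvd_of_dvd_mul p t g j0 hp hg0 d (by omega) hd3
    · rw [Nat.sub_eq_zero_of_le (by omega), pow_zero]; exact one_dvd _
  have hvd : (max j0 t - j0) • vL (p : L) ≤ v ((d : ℤ) : L) := by
    rw [show max j0 t - j0 = t - j0 by omega]
    exact KeatingAux.val_dvd v p _ d hd4
  -- bound of the left hand side
  have hphi : phiIdx vK p ν n (vL (p : L)) c (vbar p ν h) ℓ ≤
      ((vK (c h')).map fun a => (n : ℤ) * a - (h' : ℤ)) + (max j0 t - j0) • vL (p : L)
        + (((p ^ j0 * ℓ : ℕ) : ℤ) : WithTop ℤ) := by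
    have h1 : phiIdx vK p ν n (vL (p : L)) c (vbar p ν h) ℓ ≤
        phiTilde vK p ν n (vL (p : L)) c j0 ℓ :=
      Finset.inf_le (Finset.mem_Icc.2 ⟨Nat.zero_le _, hj0h⟩)
    have h2 : insepIdx vK p ν n (vL (p : L)) c j0 ≤
        iPi vK p ν n c (max j0 t) + (max j0 t - j0) • vL (p : L) :=
      Finset.inf_le (f := fun j' => iPi vK p ν n c j' + (j' - j0) • vL (p : L))
        (Finset.mem_Icc.2 ⟨by omega, by omega⟩)
    have h3 : iPi vK p ν n c (max j0 t) ≤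
        (vK (c h')).map fun a => (n : ℤ) * a - (h' : ℤ) :=
      Finset.inf_le (f := fun h => (vK (c h)).map fun a => (n : ℤ) * a - (h : ℤ))
        (Finset.mem_filter.2 ⟨Finset.mem_Icc.2 ⟨hh'1, hh'n⟩, le_max_right _ _⟩)
    refine h1.trans ?_
    unfold phiTilde
    exact add_le_add (h2.trans (add_le_add h3 le_rfl)) le_rfl
  -- the right hand side
  obtain ⟨rest, hrest⟩ := Multiset.exists_cons_of_mem hh'mem
  have hsumrest : h' + rest.sum = ℓ * s + h := by
    rw [← hlamsum, hrest, Multiset.sum_cons]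
  have hprod := KeatingAux.val_prod_ge v n c hc rest
    (fun x hx => hlam x (hrest ▸ Multiset.mem_cons_of_mem hx))
  rw [hrest, Multiset.map_cons, Multiset.prod_cons, map_mul, map_mul, hv (_ * _), AddValuation.map_mul,
    AddValuation.map_mul, map_intCast, ← hv (algebraMap K L (c h')), htotram]
  by_cases htop : vK (c h') = ⊤
  · have : c h' = 0 := (hvK.eq_top_iff _).1 htop
    rw [← htotram, this, map_zero, (hvL.eq_top_iff 0).2 rfl]
    simp
  refine (add_le_add hphi le_rfl).trans ?_
  lift vK (c h') to ℤ using htop with a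
  rw [KeatingAux.nsmul_coe, WithTop.map_coe]
  refine le_trans ?_ (add_le_add hvd (add_le_add le_rfl hprod))
  generalize (max j0 t - j0) • vL (p : L) = E
  rw [add_comm _ E, add_assoc, add_assoc]
  refine add_le_add le_rfl ?_
  have hfin : ((n : ℤ) * a - h') + (((p ^ j0 * ℓ : ℕ) : ℤ) + (h : ℤ)) ≤ n * a + (rest.sum : ℤ) := by
    have h1 : p ^ j0 * ℓ ≤ ℓ * s := by rw [mul_comm]; exact Nat.mul_le_mul_left _ hpj0
    have h2 : (h' : ℤ) + rest.sum = (ℓ * s : ℕ) + h := by exact_mod_cast hsumrest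
    have h3 : ((p ^ j0 * ℓ : ℕ) : ℤ) ≤ (ℓ * s : ℕ) := by exact_mod_cast h1
    linarith
  exact_mod_cast hfin

end
end
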